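/- Let k = k(r) ≥ 2 and n = n(r) = k(r)·r be sequences with λ = k − 1 and k = o(n^{1−α}) for some fixed 0 < α < 1 as r → ∞. Let E_n^{{0,k}}(T) denote the expected value of T(f) over uniformly random {0,k}-mappings f on [n]. Then log E_n^{{0,k}}(T) = k₀ · (n/λ)^{1/3}/log^{2/3}(n/λ) · (1 + o(1)) as r → ∞, where k₀ = (3/2)·(3I)^{2/3} and I = ∫₀^∞ log log(e/(1 − e^{−t})) dt. -/

import Mathlib

open Filter Finset Asymptotics MeasureTheory

noncomputable section

open scoped Classical

/-- `f` is a `{0,k}`-mapping: every point has either `0` or `k` preimages. -/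
def IsZKMap {n : ℕ} (k : ℕ) (f : Fin n → Fin n) : Prop :=
  ∀ y : Fin n,
    (Finset.univ.filter fun x => f x = y).card = 0 ∨
    (Finset.univ.filter fun x => f x = y).card = k

/-- The finite set of `{0,k}`-mappings on `[n]`. -/
def zkMaps (n k : ℕ) : Finset (Fin n → Fin n) :=
  Finset.univ.filter fun f => IsZKMap k f

/-- The set of cyclic nodes of `f`. -/
def cyclicSet {n : ℕ} (f : Fin n → Fin n) : Finset (Fin n) :=
  Finset.univ.filter fun x => ∃ m, 0 < m ∧ f^[m] x = x

/-- `Z f`: the number of cyclic nodes of `f`. -/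
def Zmap {n : ℕ} (f : Fin n → Fin n) : ℕ := (cyclicSet f).card

/-- The cycles of `f`: the orbits of the cyclic nodes under `f`. -/
def cyclesOf {n : ℕ} (f : Fin n → Fin n) : Finset (Finset (Fin n)) :=
  (cyclicSet f).image fun x => (cyclicSet f).filter fun y => ∃ m, f^[m] x = y

/-- `T f`: the least common multiple of the cycle lengths of `f`. -/
def Tmap {n : ℕ} (f : Fin n → Fin n) : ℕ := (cyclesOf f).lcm Finset.card

/-- `B f`: the product of the cycle lengths of `f`, counted with multiplicity. -/
def Bmap {n : ℕ} (f : Fin n → Fin n) : ℕ := ∏ c ∈ cyclesOf f, c.card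

/-- `C f`: the number of cycles of `f`. -/
def Cmap {n : ℕ} (f : Fin n → Fin n) : ℕ := (cyclesOf f).card

/-- Uniform probability of the event `p` over `{0,k}`-mappings on `[n]`. -/
def zkProb (n k : ℕ) (p : (Fin n → Fin n) → Prop) : ℝ :=
  (((zkMaps n k).filter p).card : ℝ) / ((zkMaps n k).card : ℝ)

/-- Expectation of `X` under the uniform measure on `{0,k}`-mappings on `[n]`. -/
def zkExp (n k : ℕ) (X : (Fin n → Fin n) → ℝ) : ℝ :=
  (∑ f ∈ zkMaps n k, X f) / ((zkMaps n k).card : ℝ)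

/-- The standard normal cumulative distribution function. -/
def stdNormalCDF (x : ℝ) : ℝ :=
  (Real.sqrt (2 * Real.pi))⁻¹ * ∫ t in Set.Iic x, Real.exp (-t ^ 2 / 2)

/-- `M m`: the average order of a uniformly random permutation of `[m]`. -/
def Mperm (m : ℕ) : ℝ :=
  (∑ σ : Equiv.Perm (Fin m), (orderOf σ : ℝ)) / (m.factorial : ℝ)

namespace ZKMapping

theorem laplace_kernel_identity {f : ℝ → ℂ} (hf : Measurable f) {M : ℝ} (hM : ∀ u, ‖f u‖ ≤ M)
    {G : ℂ → ℂ} (hL : ∀ z : ℂ, 0 < z.re →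
      ∫ u in Set.Ioi (0 : ℝ), f u * Complex.exp (-(z * u)) = G z)
    {K : ℝ → ℂ} (hK : Integrable K) {δ : ℝ} (hδ : 0 < δ) (y : ℝ) :
    ∫ u in Set.Ioi (0 : ℝ), f u * Complex.exp (-(δ * u)) *
        ∫ t, K t * Complex.exp (-(Complex.I * t * (u - y))) =
      ∫ t, K t * Complex.exp (Complex.I * t * y) * G (δ + Complex.I * t) := by
  have h1 : Integrable (fun u : ℝ => f u * Complex.exp (-(δ * u)))
      (volume.restrict (Set.Ioi (0 : ℝ))) := by
    have h0 : Integrable (fun u : ℝ => Complex.exp (-(δ * u)))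
        (volume.restrict (Set.Ioi (0 : ℝ))) := by
      have := integrableOn_exp_mul_complex_Ioi (a := -(δ : ℂ)) (by simpa using hδ) 0
      simpa [IntegrableOn, neg_mul] using this
    exact h0.bdd_mul hf.aestronglyMeasurable (Eventually.of_forall hM)
  have h2 := h1.mul_prod hK
  have h3 : Integrable (fun p : ℝ × ℝ => f p.1 * Complex.exp (-(δ * p.1)) *
      (K p.2 * Complex.exp (-(Complex.I * p.2 * (p.1 - y)))))
      ((volume.restrict (Set.Ioi (0 : ℝ))).prod volume) := by
    have h4 := h2.bdd_mul (f := fun p : ℝ × ℝ => Complex.exp (-(Complex.I * p.2 * (p.1 - y))))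
      (c := 1)
      (Continuous.aestronglyMeasurable (by fun_prop)) (Eventually.of_forall fun p => by
        rw [Complex.norm_exp]; simp)
    refine h4.congr (Eventually.of_forall fun p => ?_)
    simp only
    ring
  simp_rw [← integral_const_mul]
  rw [integral_integral_swap h3]
  refine integral_congr_ae (Eventually.of_forall fun t => ?_)
  simp only
  rw [← hL _ (by simpa using hδ), ← integral_const_mul]
  refine integral_congr_ae (Eventually.of_forall fun u => ?_)
  simp only
  rw [show -((δ + Complex.I * t) * (u : ℂ)) = -(δ * u) + -(Complex.I * t * u) by ring,
    Complex.exp_add, show -(Complex.I * t * (u - y)) =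
      -(Complex.I * t * u) + Complex.I * t * y by ring,
    Complex.exp_add]
  ring

theorem laplace_kernel_boundary_identity {f : ℝ → ℂ} (hf : Measurable f) {M : ℝ}
    (hM : ∀ u, ‖f u‖ ≤ M)
    {G : ℂ → ℂ} (hG : ContinuousOn G {z | 0 ≤ z.re})
    (hL : ∀ z : ℂ, 0 < z.re → ∫ u in Set.Ioi (0 : ℝ), f u * Complex.exp (-(z * u)) = G z)
    {K : ℝ → ℂ} (hK : Continuous K) (hKc : HasCompactSupport K)
    (hk : Integrable fun v : ℝ => ∫ t, K t * Complex.exp (-(Complex.I * t * v))) (y : ℝ) :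
    ∫ u in Set.Ioi (0 : ℝ), f u * ∫ t, K t * Complex.exp (-(Complex.I * t * (u - y))) =
      ∫ t, K t * Complex.exp (Complex.I * t * y) * G (Complex.I * t) := by
  have hKi : Integrable K := hK.integrable_of_hasCompactSupport hKc
  have hky : Integrable fun u : ℝ => ∫ t, K t * Complex.exp (-(Complex.I * t * (u - y))) := by
    simpa using hk.comp_sub_right y
  have hlim1 : Tendsto (fun δ : ℝ => ∫ u in Set.Ioi (0 : ℝ), f u * Complex.exp (-(δ * u)) *
        ∫ t, K t * Complex.exp (-(Complex.I * t * (u - y)))) (nhdsWithin 0 (Set.Ioi 0))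
      (nhds (∫ u in Set.Ioi (0 : ℝ), f u *
        ∫ t, K t * Complex.exp (-(Complex.I * t * (u - y))))) := by
    refine tendsto_integral_filter_of_dominated_convergence
      (fun u => M * ‖∫ t, K t * Complex.exp (-(Complex.I * t * (u - y)))‖) ?_ ?_ ?_ ?_
    · refine Eventually.of_forall fun δ => ?_
      refine AEStronglyMeasurable.mul ?_ hky.aestronglyMeasurable.restrict
      exact (hf.mul (by fun_prop)).aestronglyMeasurable
    · filter_upwards [self_mem_nhdsWithin] with δ hδ
      filter_upwards [ae_restrict_mem measurableSet_Ioi] with u hu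
      rw [norm_mul, norm_mul]
      have : ‖Complex.exp (-((δ : ℂ) * u))‖ ≤ 1 := by
        rw [Complex.norm_exp]
        have : 0 ≤ δ * u := mul_nonneg (le_of_lt hδ) (le_of_lt hu)
        simpa using this
      have h0 := norm_nonneg (f u)
      gcongr
      nlinarith [hM u]
    · exact (hky.norm.const_mul M).restrict
    · refine Eventually.of_forall fun u => ?_
      have : Tendsto (fun δ : ℝ => f u * Complex.exp (-((δ : ℂ) * u)) *
        ∫ t, K t * Complex.exp (-(Complex.I * t * (u - y)))) (nhds 0)
        (nhds (f u * Complex.exp (-(((0 : ℝ) : ℂ) * u)) *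
        ∫ t, K t * Complex.exp (-(Complex.I * t * (u - y))))) :=
        Continuous.tendsto (by fun_prop) 0
      simpa using this.mono_left nhdsWithin_le_nhds
  have hlim2 : Tendsto (fun δ : ℝ => ∫ t, K t * Complex.exp (Complex.I * t * y) *
      G (δ + Complex.I * t)) (nhdsWithin 0 (Set.Ioi 0))
      (nhds (∫ t, K t * Complex.exp (Complex.I * t * y) * G (Complex.I * t))) := by
    have hcomp : IsCompact ((Set.Icc (0 : ℝ) 1) ×ˢ (tsupport K)) := isCompact_Icc.prod hKc
    have hcont : ContinuousOn (fun p : ℝ × ℝ => G (p.1 + Complex.I * p.2))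
        ((Set.Icc (0 : ℝ) 1) ×ˢ (tsupport K)) := by
      refine hG.comp (by fun_prop) ?_
      rintro ⟨a, b⟩ ⟨ha, -⟩
      simpa using ha.1
    obtain ⟨C, hC⟩ := hcomp.exists_bound_of_continuousOn hcont
    refine tendsto_integral_filter_of_dominated_convergence (fun t => ‖K t‖ * C) ?_ ?_ ?_ ?_
    · filter_upwards [self_mem_nhdsWithin] with δ hδ
      have : Continuous fun t : ℝ => G (δ + Complex.I * t) := by
        refine hG.comp_continuous (by fun_prop) fun t => ?_
        simpa using le_of_lt hδ
      exact ((hK.mul (by fun_prop)).mul this).aestronglyMeasurable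
    · filter_upwards [Ioc_mem_nhdsGT (zero_lt_one' ℝ)] with δ hδ
      refine Eventually.of_forall fun t => ?_
      by_cases ht : t ∈ tsupport K
      · have h1 := hC (δ, t) ⟨⟨hδ.1.le, hδ.2⟩, ht⟩
        rw [norm_mul, norm_mul, Complex.norm_exp]
        simp only [Complex.mul_re, Complex.I_re, Complex.ofReal_re, zero_mul, Complex.I_im,
          Complex.ofReal_im, mul_zero, sub_self, Complex.mul_im, one_mul, zero_add, Real.exp_zero,
          mul_one]
        gcongr
      · simp [image_eq_zero_of_notMem_tsupport ht]
    · exact hKi.norm.mul_const C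
    · refine Eventually.of_forall fun t => ?_
      refine Tendsto.const_mul _ ?_
      have h1 : Tendsto G (nhdsWithin (Complex.I * t) {z | 0 ≤ z.re}) (nhds (G (Complex.I * t))) :=
        hG _ (by simp)
      refine h1.comp ?_
      refine tendsto_nhdsWithin_of_tendsto_nhds_of_eventually_within _ ?_ ?_
      · have : Tendsto (fun δ : ℝ => (δ : ℂ) + Complex.I * t) (nhds 0)
          (nhds (((0 : ℝ) : ℂ) + Complex.I * t)) := Continuous.tendsto (by fun_prop) 0
        simpa using this.mono_left nhdsWithin_le_nhds
      · filter_upwards [self_mem_nhdsWithin] with δ hδ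
        simpa using le_of_lt hδ
  refine tendsto_nhds_unique hlim1 (hlim2.congr' ?_)
  filter_upwards [self_mem_nhdsWithin] with δ hδ
  exact (laplace_kernel_identity hf hM hL hKi hδ y).symm

theorem tendsto_integral_mul_kernel {f : ℝ → ℂ} (hf : Measurable f) {M : ℝ}
    (hM : ∀ u, ‖f u‖ ≤ M)
    {G : ℂ → ℂ} (hG : ContinuousOn G {z | 0 ≤ z.re})
    (hL : ∀ z : ℂ, 0 < z.re → ∫ u in Set.Ioi (0 : ℝ), f u * Complex.exp (-(z * u)) = G z)
    {K : ℝ → ℂ} (hK : Continuous K) (hKc : HasCompactSupport K)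
    (hk : Integrable fun v : ℝ => ∫ t, K t * Complex.exp (-(Complex.I * t * v))) :
    Tendsto (fun y : ℝ => ∫ u in Set.Ioi (0 : ℝ), f u *
      ∫ t, K t * Complex.exp (-(Complex.I * t * (u - y)))) atTop (nhds 0) := by
  simp_rw [laplace_kernel_boundary_identity hf hM hG hL hK hKc hk]
  have h := Real.tendsto_integral_exp_smul_cocompact (fun t : ℝ => K t * G (Complex.I * t))
  have h2 : Tendsto (fun y : ℝ => -(y / (2 * Real.pi))) atTop (cocompact ℝ) := by
    refine Tendsto.mono_right ?_ atBot_le_cocompact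
    exact tendsto_neg_atTop_atBot.comp (tendsto_id.atTop_div_const (by positivity))
  refine (h.comp h2).congr fun y => ?_
  refine integral_congr_ae (Eventually.of_forall fun t => ?_)
  simp only [Circle.smul_def, Real.fourierChar_apply, smul_eq_mul]
  rw [show ((2 * Real.pi * -(t * -(y / (2 * Real.pi))) : ℝ) : ℂ) * Complex.I = Complex.I * t * y by
    push_cast; field_simp]
  ring

/-- The normalised Chebyshev function `ψ(eᵘ) e⁻ᵘ`. -/
def psiExp (u : ℝ) : ℝ := Chebyshev.psi (Real.exp u) * Real.exp (-u)

theorem psiExp_nonneg (u : ℝ) : 0 ≤ psiExp u :=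
  mul_nonneg (Chebyshev.psi_nonneg _) (Real.exp_pos _).le

theorem psiExp_le (u : ℝ) : psiExp u ≤ Real.log 4 + 4 := by
  unfold psiExp
  rw [Real.exp_neg, mul_inv_le_iff₀ (Real.exp_pos u)]
  exact Chebyshev.psi_le_const_mul_self (Real.exp_pos u).le

theorem measurable_psiExp : Measurable psiExp :=
  (Chebyshev.psi_mono.measurable.comp Real.measurable_exp).mul
    (Real.measurable_exp.comp measurable_neg)

theorem psiExp_add_ge {u a : ℝ} (ha : 0 ≤ a) : psiExp u * Real.exp (-a) ≤ psiExp (u + a) := by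
  unfold psiExp
  rw [mul_assoc, ← Real.exp_add, neg_add]
  exact mul_le_mul_of_nonneg_right (Chebyshev.psi_mono (Real.exp_le_exp.2 (by linarith)))
    (Real.exp_pos _).le

theorem sum_vonMangoldt_isBigO :
    (fun n : ℕ => ∑ k ∈ Icc 1 n, ArithmeticFunction.vonMangoldt k) =O[atTop]
      fun n : ℕ => (n : ℝ) ^ (1 : ℝ) := by
  refine IsBigO.of_bound (Real.log 4 + 4) (Eventually.of_forall fun n => ?_)
  have h := Chebyshev.psi_le_const_mul_self (x := n) (Nat.cast_nonneg n)
  have h2 : ∑ k ∈ Icc 1 n, ArithmeticFunction.vonMangoldt k = Chebyshev.psi n := by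
    rw [Chebyshev.psi, Nat.floor_natCast]; rfl
  rw [h2, Real.norm_of_nonneg (Chebyshev.psi_nonneg _), Real.rpow_one,
    Real.norm_of_nonneg (Nat.cast_nonneg n)]
  exact h

theorem LSeries_vonMangoldt_eq_integral {z : ℂ} (hz : 0 < z.re) :
    LSeries (fun n => (ArithmeticFunction.vonMangoldt n : ℂ)) (1 + z) =
      (1 + z) * ∫ u in Set.Ioi (0 : ℝ), (psiExp u : ℂ) * Complex.exp (-(z * u)) := by
  rw [LSeries_eq_mul_integral_of_nonneg (fun n => ArithmeticFunction.vonMangoldt n) (r := 1)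
    zero_le_one (by simpa using hz) sum_vonMangoldt_isBigO
    (fun n => ArithmeticFunction.vonMangoldt_nonneg)]
  congr 1
  rw [← Real.exp_zero, ← integral_comp_exp_Ioi]
  refine setIntegral_congr_fun measurableSet_Ioi fun u _ => ?_
  have h2 : (∑ k ∈ Icc 1 ⌊Real.exp u⌋₊, ((ArithmeticFunction.vonMangoldt k : ℝ) : ℂ)) =
      (Chebyshev.psi (Real.exp u) : ℂ) := by
    rw [Chebyshev.psi]; push_cast; rfl
  simp only [h2, psiExp, Complex.real_smul]
  rw [Complex.cpow_def_of_ne_zero (by exact_mod_cast (Real.exp_pos u).ne')]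
  rw [← Complex.ofReal_log (Real.exp_pos u).le, Real.log_exp]
  push_cast
  rw [mul_left_comm, mul_assoc, ← Complex.exp_add, ← Complex.exp_add]
  congr 2
  ring

open ArithmeticFunction.vonMangoldt in
theorem integral_psiExp_sub_one {z : ℂ} (hz : 0 < z.re) :
    ∫ u in Set.Ioi (0 : ℝ), ((psiExp u : ℂ) - 1) * Complex.exp (-(z * u)) =
      (LFunctionResidueClassAux (q := 1) 1 (1 + z) - 1) / (1 + z) := by
  have h1 : (1 + z) ≠ 0 := fun h => by
    have := congrArg Complex.re h
    simp at this; linarith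
  have hz0 : z ≠ 0 := fun h => by simp [h] at hz
  have hre : (-z).re < 0 := by simpa using hz
  have hexp : IntegrableOn (fun u : ℝ => Complex.exp (-(z * u))) (Set.Ioi 0) := by
    simpa [neg_mul] using integrableOn_exp_mul_complex_Ioi hre 0
  have hi : ∫ u in Set.Ioi (0 : ℝ), Complex.exp (-(z * u)) = 1 / z := by
    have := integral_exp_mul_complex_Ioi hre 0
    simpa [neg_mul] using this
  have hpi : IntegrableOn (fun u : ℝ => (psiExp u : ℂ) * Complex.exp (-(z * u))) (Set.Ioi 0) := by
    refine hexp.bdd_mul (c := Real.log 4 + 4)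
      (Complex.measurable_ofReal.comp measurable_psiExp).aestronglyMeasurable ?_
    refine Eventually.of_forall fun u => ?_
    rw [Complex.norm_real, Real.norm_of_nonneg (psiExp_nonneg u)]
    exact psiExp_le u
  simp_rw [sub_mul, one_mul]
  rw [integral_sub hpi hexp, hi]
  have hA := eqOn_LFunctionResidueClassAux (q := 1) (a := 1) isUnit_one
    (show (1 + z) ∈ {s : ℂ | 1 < s.re} by simpa using hz)
  have hres : (fun n => ((residueClass (q := 1) 1 n : ℝ) : ℂ)) =
      fun n => (ArithmeticFunction.vonMangoldt n : ℂ) := by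
    funext n
    simp [residueClass, Subsingleton.elim (n : ZMod 1) 1]
  simp only [hres] at hA
  rw [hA, LSeries_vonMangoldt_eq_integral hz]
  simp
  field_simp
  ring

theorem tendsto_psiExp_kernel {K : ℝ → ℂ} (hK : Continuous K) (hKc : HasCompactSupport K)
    (hk : Integrable fun v : ℝ => ∫ t, K t * Complex.exp (-(Complex.I * t * v))) :
    Tendsto (fun y : ℝ => ∫ u in Set.Ioi (0 : ℝ), ((psiExp u : ℂ) - 1) *
      ∫ t, K t * Complex.exp (-(Complex.I * t * (u - y)))) atTop (nhds 0) := by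
  refine tendsto_integral_mul_kernel (M := Real.log 4 + 4 + 1)
    (G := fun z =>
      (ArithmeticFunction.vonMangoldt.LFunctionResidueClassAux (q := 1) 1 (1 + z) - 1) / (1 + z))
        ?_ ?_ ?_ (fun z hz => integral_psiExp_sub_one hz) hK hKc hk
  · exact (Complex.measurable_ofReal.comp measurable_psiExp).sub_const 1
  · intro u
    refine (norm_sub_le _ _).trans ?_
    rw [Complex.norm_real, Real.norm_of_nonneg (psiExp_nonneg u), norm_one]
    linarith [psiExp_le u]
  · refine ContinuousOn.div (ContinuousOn.sub ?_ continuousOn_const) (by fun_prop) ?_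
    · refine (ArithmeticFunction.vonMangoldt.continuousOn_LFunctionResidueClassAux (q := 1) 1).comp
          (by fun_prop) ?_
      intro z hz
      simpa using hz
    · intro z hz h
      have := congrArg Complex.re h
      simp at this hz; linarith

/-- The triangle function. -/
def tri (t : ℝ) : ℝ := max 0 (1 - |t|)

theorem continuous_tri : Continuous tri := by unfold tri; fun_prop

theorem tri_nonneg (t : ℝ) : 0 ≤ tri t := le_max_left _ _

theorem tri_neg (t : ℝ) : tri (-t) = tri t := by simp [tri]

theorem tri_eq_zero {t : ℝ} (ht : 1 ≤ |t|) : tri t = 0 := max_eq_left (by linarith)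

theorem hasCompactSupport_tri : HasCompactSupport tri :=
  HasCompactSupport.intro (K := Set.Icc (-1) 1) isCompact_Icc fun t ht => tri_eq_zero (by
    by_contra! h
    exact ht (abs_le.1 h.le))

/-- The Fejér kernel, as the Fourier transform of the triangle function. -/
def fejer (v : ℝ) : ℝ := ∫ t, tri t * Real.cos (t * v)

theorem integrable_tri : Integrable tri :=
  continuous_tri.integrable_of_hasCompactSupport hasCompactSupport_tri

theorem integrable_tri_cos (v : ℝ) : Integrable fun t => tri t * Real.cos (t * v) :=
  integrable_tri.mul_bdd (c := 1) (by fun_prop)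
    (Eventually.of_forall fun t => by simpa using Real.abs_cos_le_one _)

theorem continuous_fejer : Continuous fejer := by
  refine continuous_of_dominated (bound := tri) ?_ ?_ integrable_tri ?_
  · intro v; exact (integrable_tri_cos v).aestronglyMeasurable
  · intro v; refine Eventually.of_forall fun t => ?_
    rw [norm_mul, Real.norm_of_nonneg (tri_nonneg t)]
    exact mul_le_of_le_one_right (tri_nonneg t) (by simpa using Real.abs_cos_le_one _)
  · exact Eventually.of_forall fun t => by fun_prop

theorem fejer_eq_intervalIntegral (v : ℝ) :
    fejer v = 2 * ∫ t in (0 : ℝ)..1, (1 - t) * Real.cos (t * v) := by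
  have h1 : fejer v = ∫ t in (-1 : ℝ)..1, tri t * Real.cos (t * v) := by
    rw [intervalIntegral.integral_of_le (by norm_num), fejer]
    symm
    apply setIntegral_eq_integral_of_forall_compl_eq_zero
    intro t ht
    rw [tri_eq_zero, zero_mul]
    by_contra! h
    exact ht ⟨(abs_lt.1 h).1, (abs_lt.1 h).2.le⟩
  have hc : Continuous fun t => tri t * Real.cos (t * v) := by
    have := continuous_tri; fun_prop
  rw [h1, ← intervalIntegral.integral_add_adjacent_intervals (b := 0)
    (hc.intervalIntegrable _ _) (hc.intervalIntegrable _ _)]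
  have h2 : ∫ t in (-1 : ℝ)..0, tri t * Real.cos (t * v) =
      ∫ t in (0 : ℝ)..1, tri t * Real.cos (t * v) := by
    have := intervalIntegral.integral_comp_neg (a := 0) (b := 1)
      (fun t => tri t * Real.cos (t * v))
    rw [neg_zero] at this
    rw [← this]
    refine intervalIntegral.integral_congr fun t _ => ?_
    simp [tri_neg]
  rw [h2, ← two_mul]
  congr 1
  refine intervalIntegral.integral_congr fun t ht => ?_
  rw [Set.uIcc_of_le zero_le_one] at ht
  simp only [tri]
  rw [abs_of_nonneg ht.1, max_eq_right (by linarith [ht.2])]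

theorem fejer_eq {v : ℝ} (hv : v ≠ 0) : fejer v = 2 * (1 - Real.cos v) / v ^ 2 := by
  rw [fejer_eq_intervalIntegral]
  have h : ∀ t ∈ Set.uIcc (0 : ℝ) 1, HasDerivAt
      (fun t => (1 - t) * (Real.sin (t * v) / v) - Real.cos (t * v) / v ^ 2)
      ((1 - t) * Real.cos (t * v)) t := by
    intro t _
    have h1 : HasDerivAt (fun t : ℝ => t * v) v t := by simpa using (hasDerivAt_id t).mul_const v
    have h2 : HasDerivAt (fun t : ℝ => 1 - t) (-1) t := by
      simpa using (hasDerivAt_id t).const_sub 1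
    refine ((h2.mul (h1.sin.div_const v)).sub (h1.cos.div_const (v ^ 2))).congr_deriv ?_
    field_simp
    ring
  rw [intervalIntegral.integral_eq_sub_of_hasDerivAt h (by
    apply Continuous.intervalIntegrable; fun_prop)]
  simp
  ring

theorem fejer_nonneg (v : ℝ) : 0 ≤ fejer v := by
  rcases eq_or_ne v 0 with rfl | hv
  · simp only [fejer, mul_zero, Real.cos_zero, mul_one]
    exact integral_nonneg tri_nonneg
  · rw [fejer_eq hv]
    have := Real.cos_le_one v
    have : 0 ≤ 1 - Real.cos v := by linarith
    positivity

theorem fejer_zero : fejer 0 = 1 := by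
  rw [fejer_eq_intervalIntegral]
  simp only [mul_zero, Real.cos_zero, mul_one]
  rw [intervalIntegral.integral_sub (by simp) (by simp)]
  simp
  norm_num

theorem integrable_fejer : Integrable fejer := by
  obtain ⟨C, hC⟩ : ∃ C, ∀ v, fejer v ≤ C := ⟨∫ t, tri t, fun v =>
    integral_mono (integrable_tri_cos v) integrable_tri fun t =>
      mul_le_of_le_one_right (tri_nonneg t) (Real.cos_le_one _)⟩
  have hC0 : 0 ≤ C := (fejer_nonneg 0).trans (hC 0)
  refine (integrable_inv_one_add_sq.const_mul (C + 4)).mono'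
    continuous_fejer.aestronglyMeasurable (Eventually.of_forall fun v => ?_)
  rw [Real.norm_of_nonneg (fejer_nonneg v), ← div_eq_mul_inv, le_div_iff₀ (by positivity)]
  rcases eq_or_ne v 0 with rfl | hv
  · simpa using (hC 0).trans (by linarith)
  · have h1 : fejer v * v ^ 2 ≤ 4 := by
      rw [fejer_eq hv, div_mul_cancel₀ _ (by positivity)]
      linarith [Real.neg_one_le_cos v]
    linarith [hC v]

theorem integral_fejer_pos : 0 < ∫ v, fejer v :=
  integral_pos_of_integrable_nonneg_nonzero continuous_fejer integrable_fejer fejer_nonneg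
    (x := 0) (by rw [fejer_zero]; exact one_ne_zero)

theorem integral_tri_exp (v : ℝ) :
    ∫ t, (tri t : ℂ) * Complex.exp (-(Complex.I * t * v)) = (fejer v : ℂ) := by
  have hi : Integrable fun t => tri t * Real.sin (t * v) :=
    integrable_tri.mul_bdd (c := 1) (by fun_prop)
      (Eventually.of_forall fun t => by simpa using Real.abs_sin_le_one _)
  have h0 : ∫ t, tri t * Real.sin (t * v) = 0 := by
    have h := integral_neg_eq_self (fun t => tri t * Real.sin (t * v)) volume
    simp only [tri_neg, neg_mul, Real.sin_neg, mul_neg] at h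
    rw [integral_neg] at h
    linarith
  have h2 : ∀ t : ℝ, (tri t : ℂ) * Complex.exp (-(Complex.I * t * v)) =
      ((tri t * Real.cos (t * v) : ℝ) : ℂ) - ((tri t * Real.sin (t * v) : ℝ) : ℂ) * Complex.I := by
    intro t
    rw [show -(Complex.I * t * v) = ((-(t * v) : ℝ) : ℂ) * Complex.I by push_cast; ring,
      Complex.exp_mul_I]
    push_cast
    rw [Complex.cos_neg, Complex.sin_neg]
    ring
  simp_rw [h2]
  rw [integral_sub (integrable_tri_cos v).ofReal (hi.ofReal.mul_const _), integral_mul_const,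
    integral_complex_ofReal, integral_complex_ofReal, h0]
  simp [fejer]

theorem integral_tri_div_exp {c : ℝ} (hc : 0 < c) (v : ℝ) :
    ∫ t, (tri (t / c) : ℂ) * Complex.exp (-(Complex.I * t * v)) =
      ((c * fejer (c * v) : ℝ) : ℂ) := by
  have h := Measure.integral_comp_div (fun t : ℝ =>
    (tri t : ℂ) * Complex.exp (-(Complex.I * t * (c * v : ℝ)))) c
  rw [integral_tri_exp, abs_of_pos hc] at h
  rw [Complex.real_smul] at h
  rw [Complex.ofReal_mul, ← h]
  refine integral_congr_ae (Eventually.of_forall fun t => ?_)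
  have : (c : ℂ) ≠ 0 := by exact_mod_cast hc.ne'
  simp only
  congr 3
  push_cast
  field_simp

theorem integral_comp_fejer {c : ℝ} (hc : 0 < c) : ∫ u, c * fejer (c * u) = ∫ v, fejer v := by
  rw [integral_const_mul, Measure.integral_comp_mul_left, abs_of_pos (inv_pos.2 hc), smul_eq_mul,
    mul_inv_cancel_left₀ hc.ne']

theorem integrable_comp_fejer {c : ℝ} (hc : 0 < c) (y : ℝ) :
    Integrable fun u => c * fejer (c * (u - y)) :=
  ((integrable_fejer.comp_mul_left' hc.ne').comp_sub_right y).const_mul c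

theorem tendsto_integral_psiExp_fejer {c : ℝ} (hc : 0 < c) :
    Tendsto (fun y : ℝ => ∫ u in Set.Ioi (0 : ℝ), psiExp u * (c * fejer (c * (u - y)))) atTop
      (nhds (∫ v, fejer v)) := by
  have hcont : Continuous fun t : ℝ => (tri (t / c) : ℂ) := by
    have := continuous_tri; fun_prop
  have hcs : HasCompactSupport fun t : ℝ => (tri (t / c) : ℂ) := by
    refine HasCompactSupport.intro (K := Set.Icc (-c) c) isCompact_Icc fun t ht => ?_
    rw [tri_eq_zero, Complex.ofReal_zero]
    rw [abs_div, abs_of_pos hc, le_div_iff₀ hc, one_mul]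
    by_contra! h
    exact ht (abs_le.1 h.le)
  have h := tendsto_psiExp_kernel hcont hcs (by
    simp_rw [integral_tri_div_exp hc]
    exact ((integrable_fejer.comp_mul_left' hc.ne').const_mul c).ofReal)
  have hre := (Complex.continuous_re.tendsto 0).comp h
  have key : ∀ y : ℝ, (∫ u in Set.Ioi (0 : ℝ), ((psiExp u : ℂ) - 1) *
      ∫ t, (tri (t / c) : ℂ) * Complex.exp (-(Complex.I * t * (u - y)))) =
      ((∫ u in Set.Ioi (0 : ℝ), (psiExp u - 1) * (c * fejer (c * (u - y))) : ℝ) : ℂ) := by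
    intro y
    rw [← integral_complex_ofReal]
    refine integral_congr_ae (Eventually.of_forall fun u => ?_)
    have := integral_tri_div_exp hc (u - y)
    push_cast at this ⊢
    simp only [this]
  have hI : ∀ y, Integrable fun u => psiExp u * (c * fejer (c * (u - y))) := fun y =>
    (integrable_comp_fejer hc y).bdd_mul (c := Real.log 4 + 4)
      measurable_psiExp.aestronglyMeasurable (Eventually.of_forall fun u => by
        rw [Real.norm_of_nonneg (psiExp_nonneg u)]; exact psiExp_le u)
  have h0 : Tendsto (fun y : ℝ => ∫ u in Set.Ioi (0 : ℝ), (c * fejer (c * (u - y)))) atTop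
      (nhds (∫ v, fejer v)) := by
    have h1 : ∀ y : ℝ, ∫ u in Set.Ioi (0 : ℝ), (c * fejer (c * (u - y))) =
        ∫ u in Set.Ioi (-y), c * fejer (c * u) := by
      intro y
      rw [← integral_indicator measurableSet_Ioi, ← integral_indicator measurableSet_Ioi,
        ← integral_sub_right_eq_self ((Set.Ioi (-y)).indicator _) y]
      refine integral_congr_ae (Eventually.of_forall fun u => ?_)
      simp [Set.indicator_apply]
    simp_rw [h1]
    rw [← integral_comp_fejer hc]
    have hI : Integrable fun u => c * fejer (c * u) := by simpa using integrable_comp_fejer hc 0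
    exact (aecover_Ioi tendsto_neg_atTop_atBot).integral_tendsto_of_countably_generated hI
  have h3 := hre.add h0
  simp only [Complex.zero_re, zero_add] at h3
  refine h3.congr fun y => ?_
  simp only [Function.comp_apply, key, Complex.ofReal_re]
  rw [← integral_add]
  · refine integral_congr_ae (Eventually.of_forall fun u => ?_)
    simp only; ring
  · refine Integrable.integrableOn ?_
    refine ((hI y).sub (integrable_comp_fejer hc y)).congr (Eventually.of_forall fun u => ?_)
    simp only [Pi.sub_apply]
    ring
  · exact (integrable_comp_fejer hc y).integrableOn

theorem integrable_psiExp_fejer {c : ℝ} (hc : 0 < c) (y : ℝ) :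
    Integrable fun u => psiExp u * (c * fejer (c * (u - y))) :=
  (integrable_comp_fejer hc y).bdd_mul (c := Real.log 4 + 4)
    measurable_psiExp.aestronglyMeasurable (Eventually.of_forall fun u => by
      rw [Real.norm_of_nonneg (psiExp_nonneg u)]; exact psiExp_le u)

theorem setIntegral_comp_fejer {c a : ℝ} (hc : 0 < c) (ha : 0 < a) (y : ℝ) :
    ∫ u in Set.Ioc (y - a) (y + a), c * fejer (c * (u - y)) =
      ∫ v in -(c * a)..c * a, fejer v := by
  rw [← intervalIntegral.integral_of_le (by linarith)]
  simp_rw [mul_sub]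
  rw [intervalIntegral.integral_const_mul, intervalIntegral.integral_comp_mul_sub _ hc.ne',
    smul_eq_mul, mul_inv_cancel_left₀ hc.ne']
  congr 1 <;> ring

theorem psiExp_mul_le {c a y : ℝ} (hc : 0 < c) (ha : 0 < a) (hy : 0 < y) :
    psiExp y * Real.exp (-(2 * a)) * ∫ v in -(c * a)..c * a, fejer v ≤
      ∫ u in Set.Ioi (0 : ℝ), psiExp u * (c * fejer (c * (u - (y + a)))) := by
  rw [← setIntegral_comp_fejer hc ha (y + a), ← integral_const_mul]
  calc _ ≤ ∫ u in Set.Ioc (y + a - a) (y + a + a), psiExp u * (c * fejer (c * (u - (y + a)))) := by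
        refine setIntegral_mono_on ((integrable_comp_fejer hc _).const_mul _).integrableOn
          (integrable_psiExp_fejer hc _).integrableOn measurableSet_Ioc fun u hu => ?_
        refine mul_le_mul_of_nonneg_right ?_ (mul_nonneg hc.le (fejer_nonneg _))
        have h := psiExp_add_ge (u := y) (a := u - y) (by linarith [hu.1])
        rw [add_sub_cancel] at h
        refine le_trans (mul_le_mul_of_nonneg_left ?_ (psiExp_nonneg y)) h
        exact Real.exp_le_exp.2 (by linarith [hu.2])
    _ ≤ _ := by
        refine setIntegral_mono_set (integrable_psiExp_fejer hc _).integrableOn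
          (Eventually.of_forall fun u => mul_nonneg (psiExp_nonneg u)
            (mul_nonneg hc.le (fejer_nonneg _))) (LE.le.eventuallyLE ?_)
        intro u hu
        have := hu.1
        simp only [Set.mem_Ioi]; linarith

theorem integral_psiExp_le {c a y : ℝ} (hc : 0 < c) (ha : 0 < a) :
    ∫ u in Set.Ioi (0 : ℝ), psiExp u * (c * fejer (c * (u - (y - a)))) ≤
      psiExp y * Real.exp (2 * a) * (∫ v in -(c * a)..c * a, fejer v) +
        (Real.log 4 + 4) * ((∫ v, fejer v) - ∫ v in -(c * a)..c * a, fejer v) := by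
  have hI := integrable_psiExp_fejer hc (y - a)
  have hk := integrable_comp_fejer hc (y - a)
  have hkn : ∀ u, 0 ≤ c * fejer (c * (u - (y - a))) := fun u => mul_nonneg hc.le (fejer_nonneg _)
  have htot : ∫ u, c * fejer (c * (u - (y - a))) = ∫ v, fejer v := by
    rw [← integral_comp_fejer hc]
    exact integral_sub_right_eq_self (fun u => c * fejer (c * u)) (y - a)
  set S := Set.Ioc (y - a - a) (y - a + a) with hS
  have hm : MeasurableSet S := measurableSet_Ioc
  have hset : ∫ u in S, c * fejer (c * (u - (y - a))) = ∫ v in -(c * a)..c * a, fejer v :=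
    setIntegral_comp_fejer hc ha (y - a)
  have hcompl : ∫ u in Sᶜ, c * fejer (c * (u - (y - a))) =
      (∫ v, fejer v) - ∫ v in -(c * a)..c * a, fejer v := by
    have := integral_add_compl hm hk
    linarith
  rw [← hcompl, ← hset, ← integral_const_mul, ← integral_const_mul]
  calc _ ≤ ∫ u, psiExp u * (c * fejer (c * (u - (y - a)))) :=
        setIntegral_le_integral hI
          (Eventually.of_forall fun u => mul_nonneg (psiExp_nonneg u) (hkn u))
    _ = _ := (integral_add_compl hm hI).symm
    _ ≤ _ := by
        refine add_le_add ?_ ?_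
        · refine setIntegral_mono_on hI.integrableOn (hk.const_mul _).integrableOn hm fun u hu => ?_
          refine mul_le_mul_of_nonneg_right ?_ (hkn u)
          have h := psiExp_add_ge (u := u) (a := y - u) (by linarith [hu.2])
          rw [add_sub_cancel] at h
          calc psiExp u = psiExp u * Real.exp (-(y - u)) * Real.exp (y - u) := by
                rw [mul_assoc, ← Real.exp_add]; simp
            _ ≤ psiExp y * Real.exp (y - u) := mul_le_mul_of_nonneg_right h (Real.exp_pos _).le
            _ ≤ _ := mul_le_mul_of_nonneg_left (Real.exp_le_exp.2 (by linarith [hu.1]))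
                (psiExp_nonneg y)
        · refine setIntegral_mono_on hI.integrableOn (hk.const_mul _).integrableOn hm.compl
            fun u _ => ?_
          exact mul_le_mul_of_nonneg_right (psiExp_le u) (hkn u)

theorem tendsto_psiExp : Tendsto psiExp atTop (nhds 1) := by
  set J := ∫ v, fejer v with hJ
  have hJpos : 0 < J := integral_fejer_pos
  set Jr : ℝ → ℝ := fun s => ∫ v in -s..s, fejer v with hJr
  have hlim : Tendsto Jr atTop (nhds J) :=
    intervalIntegral_tendsto_integral integrable_fejer tendsto_neg_atTop_atBot tendsto_id
  have hinv : Tendsto (fun s : ℝ => 1 / s) atTop (nhds 0) := by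
    simpa using tendsto_inv_atTop_zero (𝕜 := ℝ)
  have hexp : Tendsto (fun s : ℝ => Real.exp (2 * (1 / s))) atTop (nhds 1) := by
    have := (Real.continuous_exp.tendsto _).comp (hinv.const_mul 2)
    simpa [Function.comp_def] using this
  have hU : Tendsto (fun s => (J + 1 / s) * Real.exp (2 * (1 / s)) / Jr s) atTop (nhds 1) := by
    have := ((hinv.const_add J).mul hexp).div hlim hJpos.ne'
    simpa [hJpos.ne', Pi.div_def] using this
  have hL : Tendsto (fun s => (J - 1 / s - (Real.log 4 + 4) * (J - Jr s)) /
      (Real.exp (2 * (1 / s)) * Jr s)) atTop (nhds 1) := by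
    have := (((hinv.const_sub J).sub ((hlim.const_sub J).const_mul (Real.log 4 + 4)))).div
      (hexp.mul hlim) (by simpa using hJpos.ne')
    simpa [hJpos.ne', Pi.div_def] using this
  have hJrpos : ∀ᶠ s in atTop, 0 < Jr s := hlim.eventually_const_lt hJpos
  have hshift : ∀ a : ℝ, Tendsto (fun y : ℝ => y + a) atTop atTop := fun a =>
    tendsto_atTop_add_const_right _ _ tendsto_id
  rw [tendsto_order]
  constructor
  · intro b hb
    obtain ⟨s, hs1, hs2, hs0⟩ := ((hL.eventually_const_lt hb).and
      (hJrpos.and (eventually_gt_atTop 0))).exists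
    have hs' : 0 < 1 / s := by positivity
    have h := (tendsto_integral_psiExp_fejer (c := s ^ 2) (by positivity)).comp (hshift (-(1 / s)))
    filter_upwards [h.eventually_const_lt (show J - 1 / s < J by linarith)] with y hy
    have h2 := integral_psiExp_le (c := s ^ 2) (a := 1 / s) (y := y) (by positivity) hs'
    rw [show s ^ 2 * (1 / s) = s by field_simp] at h2
    refine hs1.trans ?_
    rw [div_lt_iff₀ (by positivity)]
    simp only [Function.comp_apply, ← sub_eq_add_neg] at hy
    have h3 : ∫ v in -s..s, fejer v = Jr s := rfl
    rw [h3, ← hJ] at h2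
    linarith
  · intro b hb
    obtain ⟨s, hs1, hs2, hs0⟩ := ((hU.eventually_lt_const hb).and
      (hJrpos.and (eventually_gt_atTop 0))).exists
    have hs' : 0 < 1 / s := by positivity
    have h := (tendsto_integral_psiExp_fejer (c := s ^ 2) (by positivity)).comp (hshift (1 / s))
    filter_upwards [h.eventually_lt_const (show J < J + 1 / s by linarith),
      eventually_gt_atTop 0] with y hy hy0
    have h2 := psiExp_mul_le (c := s ^ 2) (a := 1 / s) (y := y) (by positivity) hs' hy0
    rw [show s ^ 2 * (1 / s) = s by field_simp] at h2
    refine lt_of_le_of_lt ?_ hs1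
    rw [le_div_iff₀ hs2]
    simp only [Function.comp_apply] at hy
    have h3 : ∫ v in -s..s, fejer v = Jr s := rfl
    rw [h3] at h2
    have h4 := h2.trans hy.le
    calc psiExp y * Jr s =
          (psiExp y * Real.exp (-(2 * (1 / s))) * Jr s) * Real.exp (2 * (1 / s)) := by
          rw [mul_right_comm (psiExp y), mul_assoc _ (Real.exp _), ← Real.exp_add]; simp
      _ ≤ _ := mul_le_mul_of_nonneg_right h4 (Real.exp_pos _).le

theorem tendsto_psi_div : Tendsto (fun x => Chebyshev.psi x / x) atTop (nhds 1) := by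
  refine (tendsto_psiExp.comp Real.tendsto_log_atTop).congr' ?_
  filter_upwards [eventually_gt_atTop 0] with x hx
  simp [psiExp, Real.exp_log hx, Real.exp_neg, div_eq_mul_inv]

theorem tendsto_theta_div : Tendsto (fun x => Chebyshev.theta x / x) atTop (nhds 1) := by
  have h : Tendsto (fun x => (Chebyshev.psi x - Chebyshev.theta x) / x) atTop (nhds 0) := by
    have := Chebyshev.isBigO_psi_sub_theta_sqrt.trans_isLittleO
      (show Real.sqrt =o[atTop] (fun x : ℝ => x) by
        refine (isLittleO_iff_tendsto' ?_).2 ?_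
        · filter_upwards [eventually_gt_atTop 0] with x hx h0
          exact absurd h0 hx.ne'
        · simp_rw [Real.sqrt_div_self]
          exact Real.tendsto_sqrt_atTop.inv_tendsto_atTop)
    exact this.tendsto_div_nhds_zero
  have h2 := tendsto_psi_div.sub h
  rw [sub_zero] at h2
  exact h2.congr fun x => by ring

/-- The prime number theorem. -/
theorem tendsto_primeCounting_mul_log_div :
    Tendsto (fun x : ℝ => (Nat.primeCounting ⌊x⌋₊ : ℝ) * Real.log x / x) atTop (nhds 1) := by
  have h := Chebyshev.primeCounting_sub_theta_div_log_isBigO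
  have h1 : Tendsto (fun x : ℝ => ((Nat.primeCounting ⌊x⌋₊ : ℝ) -
      Chebyshev.theta x / Real.log x) * Real.log x / x) atTop (nhds 0) := by
    have hb : (fun x : ℝ => ((Nat.primeCounting ⌊x⌋₊ : ℝ) -
        Chebyshev.theta x / Real.log x) * Real.log x / x) =O[atTop] fun x => 1 / Real.log x := by
      refine (h.mul (isBigO_refl (fun x => Real.log x / x) atTop)).congr' ?_ ?_
      · exact Eventually.of_forall fun x => by simp only [mul_div_assoc]
      · filter_upwards [eventually_gt_atTop 1] with x hx
        have := Real.log_pos hx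
        field_simp
    refine hb.trans_tendsto ?_
    simpa [Pi.inv_def] using Real.tendsto_log_atTop.inv_tendsto_atTop
  have h2 := h1.add tendsto_theta_div
  rw [zero_add] at h2
  refine h2.congr' ?_
  filter_upwards [eventually_gt_atTop 1] with x hx
  have := Real.log_pos hx
  field_simp
  ring

/-- `ell u = ∑_{j ≥ 1} e^{-uj} / j`. -/
def ell (u : ℝ) : ℝ := -Real.log (1 - Real.exp (-u))

theorem one_sub_exp_neg_pos {u : ℝ} (hu : 0 < u) : 0 < 1 - Real.exp (-u) := by
  have : Real.exp (-u) < 1 := by simpa using hu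
  linarith

theorem ell_pos {u : ℝ} (hu : 0 < u) : 0 < ell u := by
  have := Real.log_neg (one_sub_exp_neg_pos hu) (by linarith [Real.exp_pos (-u)])
  unfold ell; linarith

theorem exp_neg_ell {u : ℝ} (hu : 0 < u) : Real.exp (-ell u) = 1 - Real.exp (-u) := by
  rw [ell, neg_neg, Real.exp_log (one_sub_exp_neg_pos hu)]

theorem ell_ell {u : ℝ} (hu : 0 < u) : ell (ell u) = u := by
  rw [ell, exp_neg_ell hu]; simp

theorem ell_le_ell {u v : ℝ} (hu : 0 < u) (huv : u ≤ v) : ell v ≤ ell u := by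
  unfold ell
  have h : Real.exp (-v) ≤ Real.exp (-u) := Real.exp_le_exp.2 (by linarith)
  have := Real.log_le_log (one_sub_exp_neg_pos hu)
    (show 1 - Real.exp (-u) ≤ 1 - Real.exp (-v) by linarith)
  linarith

theorem le_ell_iff {u w : ℝ} (hu : 0 < u) (hw : 0 < w) : w ≤ ell u ↔ u ≤ ell w := by
  constructor
  · intro h
    simpa [ell_ell hu] using ell_le_ell hw h
  · intro h
    simpa [ell_ell hw] using ell_le_ell hu h

theorem one_sub_exp_neg_inv {u : ℝ} (hu : 0 < u) :
    (1 - Real.exp (-u))⁻¹ = 1 + (Real.exp u - 1)⁻¹ := by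
  have h1 : 0 < Real.exp u - 1 := by linarith [Real.add_one_lt_exp hu.ne']
  have h2 := one_sub_exp_neg_pos hu
  rw [Real.exp_neg] at *
  have := Real.exp_pos u
  field_simp
  ring

theorem ell_le_inv_exp_sub_one {u : ℝ} (hu : 0 < u) : ell u ≤ (Real.exp u - 1)⁻¹ := by
  have h := Real.log_le_sub_one_of_pos (inv_pos.2 (one_sub_exp_neg_pos hu))
  rw [Real.log_inv, one_sub_exp_neg_inv hu] at h
  unfold ell; linarith

theorem ell_le_inv {u : ℝ} (hu : 0 < u) : ell u ≤ u⁻¹ := by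
  refine (ell_le_inv_exp_sub_one hu).trans (inv_anti₀ hu ?_)
  linarith [Real.add_one_le_exp u]

theorem ell_le_two_div_sq {u : ℝ} (hu : 0 < u) : ell u ≤ 2 / u ^ 2 := by
  refine (ell_le_inv_exp_sub_one hu).trans ?_
  rw [← inv_div]
  refine inv_anti₀ (by positivity) ?_
  have := Real.quadratic_le_exp_of_nonneg hu.le
  linarith

theorem ell_le_two_mul_rpow {u : ℝ} (hu : 0 < u) : ell u ≤ 2 * u ^ (-(1 / 2) : ℝ) := by
  have h1 : 0 < Real.exp u - 1 := by linarith [Real.add_one_lt_exp hu.ne']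
  have hs := inv_pos.2 (one_sub_exp_neg_pos hu)
  have h := Real.log_le_sub_one_of_pos (Real.sqrt_pos.2 hs)
  rw [Real.log_sqrt hs.le, Real.log_inv] at h
  have h2 : Real.sqrt (1 - Real.exp (-u))⁻¹ ≤ 1 + u ^ (-(1 / 2) : ℝ) := by
    rw [one_sub_exp_neg_inv hu, Real.rpow_neg hu.le, ← Real.sqrt_eq_rpow, ← Real.sqrt_inv]
    have h3 : (Real.exp u - 1)⁻¹ ≤ u⁻¹ := inv_anti₀ hu (by linarith [Real.add_one_le_exp u])
    have h4 := Real.sq_sqrt (inv_pos.2 hu).le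
    have h5 := Real.sqrt_nonneg u⁻¹
    refine Real.sqrt_le_iff.2 ⟨by linarith, by nlinarith⟩
  unfold ell; linarith

theorem exp_sub_one_ge {y : ℝ} (hy : 0 ≤ y) : y * Real.exp (y / 2) ≤ Real.exp y - 1 := by
  have h := Real.self_le_sinh_iff.2 (show 0 ≤ y / 2 by linarith)
  rw [Real.sinh_eq] at h
  have h2 : Real.exp y = Real.exp (y / 2) * Real.exp (y / 2) := by rw [← Real.exp_add]; ring_nf
  have h3 : Real.exp (-(y / 2)) * Real.exp (y / 2) = 1 := by rw [← Real.exp_add]; simp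
  have h4 := Real.exp_pos (y / 2)
  nlinarith

/-- The integrand `log log (e / (1 - e^{-u}))`. -/
def phi (u : ℝ) : ℝ := Real.log (Real.log (Real.exp 1 / (1 - Real.exp (-u))))

theorem phi_eq {u : ℝ} (hu : 0 < u) : phi u = Real.log (1 + ell u) := by
  rw [phi, Real.log_div (Real.exp_pos 1).ne' (one_sub_exp_neg_pos hu).ne', Real.log_exp]
  rfl

theorem phi_pos {u : ℝ} (hu : 0 < u) : 0 < phi u := by
  rw [phi_eq hu]
  exact Real.log_pos (by linarith [ell_pos hu])

/-- The inverse function of `phi`. -/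
def phiInv (y : ℝ) : ℝ := ell (Real.exp y - 1)

theorem exp_sub_one_pos {y : ℝ} (hy : 0 < y) : 0 < Real.exp y - 1 := by
  linarith [Real.add_one_lt_exp hy.ne']

theorem phiInv_pos {y : ℝ} (hy : 0 < y) : 0 < phiInv y := ell_pos (exp_sub_one_pos hy)

theorem le_phi_iff {u y : ℝ} (hu : 0 < u) (hy : 0 < y) : y ≤ phi u ↔ u ≤ phiInv y := by
  rw [phi_eq hu, Real.le_log_iff_exp_le (by linarith [ell_pos hu]), phiInv,
    ← le_ell_iff hu (exp_sub_one_pos hy)]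
  constructor <;> intro h <;> linarith

theorem measurable_ell : Measurable ell := by unfold ell; fun_prop

theorem measurable_phi : Measurable phi := by unfold phi; fun_prop

theorem measurable_phiInv : Measurable phiInv := by unfold phiInv; have := measurable_ell; fun_prop

/-- An integrable majorant for `phiInv` and its square root. -/
def phiInvBound (y : ℝ) : ℝ := y ^ (-(1 / 2) : ℝ) * Real.exp (-(1 / 4) * y ^ (1 : ℝ))

theorem integrableOn_phiInvBound : IntegrableOn phiInvBound (Set.Ioi 0) :=
  integrableOn_rpow_mul_exp_neg_mul_rpow (by norm_num) one_pos (by norm_num)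

theorem rpow_exp_sub_one_le {y : ℝ} (hy : 0 < y) :
    (Real.exp y - 1) ^ (-(1 / 2) : ℝ) ≤ phiInvBound y := by
  have h := exp_sub_one_ge hy.le
  have h1 : 0 < y * Real.exp (y / 2) := by positivity
  refine (Real.rpow_le_rpow_of_nonpos h1 h (by norm_num)).trans (le_of_eq ?_)
  rw [Real.mul_rpow hy.le (Real.exp_pos _).le, ← Real.exp_mul, phiInvBound, Real.rpow_one]
  ring_nf

theorem phiInv_le {y : ℝ} (hy : 0 < y) : phiInv y ≤ 2 * phiInvBound y :=
  (ell_le_two_mul_rpow (exp_sub_one_pos hy)).trans (by linarith [rpow_exp_sub_one_le hy])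

theorem sqrt_phiInv_le {y : ℝ} (hy : 0 < y) : Real.sqrt (phiInv y) ≤ phiInvBound y := by
  refine le_trans ?_ (rpow_exp_sub_one_le hy)
  rw [Real.rpow_neg (exp_sub_one_pos hy).le, ← Real.sqrt_eq_rpow, ← Real.sqrt_inv]
  exact Real.sqrt_le_sqrt (ell_le_inv (exp_sub_one_pos hy))

theorem integrableOn_phiInv : IntegrableOn phiInv (Set.Ioi 0) := by
  refine (integrableOn_phiInvBound.const_mul 2).mono' measurable_phiInv.aestronglyMeasurable ?_
  refine (ae_restrict_iff' measurableSet_Ioi).2 (Eventually.of_forall fun y hy => ?_)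
  rw [Real.norm_of_nonneg (phiInv_pos hy).le]
  exact phiInv_le hy

theorem integral_phiInv_eq :
    ∫ y in Set.Ioi (0 : ℝ), phiInv y = ∫ u in Set.Ioi (0 : ℝ), phi u := by
  have h0 : ∀ᵐ u ∂(volume.restrict (Set.Ioi (0 : ℝ))), 0 ≤ phi u :=
    (ae_restrict_iff' measurableSet_Ioi).2 (Eventually.of_forall fun y hy => (phi_pos hy).le)
  have h1 : ∀ᵐ u ∂(volume.restrict (Set.Ioi (0 : ℝ))), 0 ≤ phiInv u :=
    (ae_restrict_iff' measurableSet_Ioi).2 (Eventually.of_forall fun y hy => (phiInv_pos hy).le)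
  rw [integral_eq_lintegral_of_nonneg_ae h0 measurable_phi.aestronglyMeasurable,
    integral_eq_lintegral_of_nonneg_ae h1 measurable_phiInv.aestronglyMeasurable,
    lintegral_eq_lintegral_meas_le _ h0 measurable_phi.aemeasurable]
  congr 1
  refine setLIntegral_congr_fun measurableSet_Ioi fun y hy => ?_
  rw [Measure.restrict_apply' measurableSet_Ioi]
  have : {a | y ≤ phi a} ∩ Set.Ioi 0 = Set.Ioc 0 (phiInv y) := by
    ext u
    constructor
    · rintro ⟨h, hu⟩
      exact ⟨hu, (le_phi_iff hu hy).1 h⟩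
    · rintro ⟨hu, h⟩
      exact ⟨(le_phi_iff hu hy).2 h, hu⟩
  rw [this, Real.volume_Ioc, sub_zero]

theorem integral_phi_pos : 0 < ∫ u in Set.Ioi (0 : ℝ), phi u := by
  rw [← integral_phiInv_eq, setIntegral_pos_iff_support_of_nonneg_ae]
  · have : Set.Ioi (0 : ℝ) ⊆ Function.support phiInv ∩ Set.Ioi 0 := fun y hy =>
      ⟨(phiInv_pos hy).ne', hy⟩
    refine lt_of_lt_of_le ?_ (measure_mono this)
    simp
  · exact (ae_restrict_iff' measurableSet_Ioi).2
        (Eventually.of_forall fun y hy => (phiInv_pos hy).le)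
  · exact integrableOn_phiInv

theorem primeCounting_le_self (m : ℕ) : Nat.primeCounting m ≤ m := by
  rw [← Nat.primesLE_card_eq_primeCounting, Nat.primesLE_eq_filter_Icc_one]
  simpa using Finset.card_filter_le (Icc 1 m) Nat.Prime

theorem primeCounting_floor_le {x : ℝ} (hx : 0 ≤ x) : (Nat.primeCounting ⌊x⌋₊ : ℝ) ≤ x :=
  (Nat.cast_le.2 (primeCounting_le_self _)).trans (Nat.floor_le hx)

theorem exists_primeCounting_mul_log_le :
    ∃ C : ℝ, 0 ≤ C ∧ ∀ x : ℝ, 1 ≤ x → (Nat.primeCounting ⌊x⌋₊ : ℝ) * Real.log x ≤ C * x := by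
  obtain ⟨X, hX⟩ := eventually_atTop.1
    (tendsto_primeCounting_mul_log_div.eventually_le_const (show (1 : ℝ) < 2 by norm_num))
  refine ⟨max 2 (Real.log X), le_max_of_le_left two_pos.le, fun x hx => ?_⟩
  have hx0 : 0 < x := by linarith
  rcases le_total X x with h | h
  · have := (div_le_iff₀ hx0).1 (hX x h)
    exact this.trans (mul_le_mul_of_nonneg_right (le_max_left _ _) hx0.le)
  · rw [mul_comm]
    refine mul_le_mul ((Real.log_le_log hx0 h).trans (le_max_right _ _))
      (primeCounting_floor_le hx0.le) (Nat.cast_nonneg _) (le_max_of_le_left two_pos.le)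

/-- Domination of the rescaled prime counting function. -/
theorem exists_mul_log_primeCounting_le :
    ∃ C : ℝ, 0 ≤ C ∧ ∀ a t : ℝ, 0 < a → 0 < t → t < 1 →
      t * Real.log (1 / t) * (Nat.primeCounting ⌊a / t⌋₊ : ℝ) ≤ C * a + 4 * Real.sqrt a := by
  obtain ⟨C, hC, h⟩ := exists_primeCounting_mul_log_le
  refine ⟨2 * C, by positivity, fun a t ha ht ht1 => ?_⟩
  have hL : 0 < Real.log (1 / t) := Real.log_pos (by rw [lt_div_iff₀ ht]; linarith)
  have hx : 0 < a / t := by positivity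
  have hq : 1 ≤ 1 / t := by rw [le_div_iff₀ ht]; linarith
  rcases le_total (Real.sqrt (1 / t)) (a / t) with hc | hc
  · have h1 : 1 ≤ a / t := le_trans (by simpa using Real.sqrt_le_sqrt hq) hc
    have h2 := Real.log_le_log (Real.sqrt_pos.2 (by positivity)) hc
    rw [Real.log_sqrt (by positivity)] at h2
    have h3 := h _ h1
    have h4 : (Nat.primeCounting ⌊a / t⌋₊ : ℝ) * (Real.log (1 / t) / 2) ≤ C * (a / t) :=
      (mul_le_mul_of_nonneg_left h2 (Nat.cast_nonneg _)).trans h3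
    have h5 : t * (C * (a / t)) = C * a := by field_simp
    have h6 := mul_le_mul_of_nonneg_left h4 ht.le
    have := Real.sqrt_nonneg a
    nlinarith
  · have h1 := primeCounting_floor_le hx.le
    have h2 : Real.log (1 / t) ≤ 4 * Real.sqrt (Real.sqrt (1 / t)) := by
      have h3 := Real.log_le_sub_one_of_pos (x := Real.sqrt (Real.sqrt (1 / t))) (by positivity)
      rw [Real.log_sqrt (by positivity), Real.log_sqrt (by positivity)] at h3
      linarith
    have h3 : a / t ≤ Real.sqrt (Real.sqrt (1 / t)) * Real.sqrt (a / t) := by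
      rw [← Real.sqrt_mul (Real.sqrt_nonneg _)]
      refine Real.le_sqrt_of_sq_le ?_
      nlinarith
    have h4 : t * Real.log (1 / t) * (Nat.primeCounting ⌊a / t⌋₊ : ℝ) ≤
        t * (4 * Real.sqrt (Real.sqrt (1 / t))) *
          (Real.sqrt (Real.sqrt (1 / t)) * Real.sqrt (a / t)) := by
      have := h1.trans h3
      gcongr
    refine h4.trans ?_
    have h5 : Real.sqrt (Real.sqrt (1 / t)) * Real.sqrt (Real.sqrt (1 / t)) = Real.sqrt (1 / t) :=
      Real.mul_self_sqrt (Real.sqrt_nonneg _)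
    have h6 : Real.sqrt (1 / t) * Real.sqrt (a / t) = Real.sqrt a / t := by
      rw [← Real.sqrt_mul (by positivity), show 1 / t * (a / t) = a / t ^ 2 by field_simp,
        Real.sqrt_div ha.le, Real.sqrt_sq ht.le]
    calc _ = 4 * t *
          ((Real.sqrt (Real.sqrt (1 / t)) * Real.sqrt (Real.sqrt (1 / t))) * Real.sqrt (a / t)) := by
            ring
      _ = 4 * t * (Real.sqrt a / t) := by rw [h5, h6]
      _ = 4 * Real.sqrt a := by field_simp
      _ ≤ _ := by have : 0 ≤ 2 * C * a := by positivity
                  linarith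

theorem tendsto_mul_log_primeCounting {a : ℝ} (ha : 0 < a) :
    Tendsto (fun t : ℝ => t * Real.log (1 / t) * (Nat.primeCounting ⌊a / t⌋₊ : ℝ))
      (nhdsWithin 0 (Set.Ioi 0)) (nhds a) := by
  have hinv : Tendsto (fun t : ℝ => 1 / t) (nhdsWithin 0 (Set.Ioi 0)) atTop := by
    simpa using tendsto_inv_nhdsGT_zero (𝕜 := ℝ)
  have hx : Tendsto (fun t : ℝ => a / t) (nhdsWithin 0 (Set.Ioi 0)) atTop := by
    have := hinv.const_mul_atTop ha
    simpa [div_eq_mul_inv] using this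
  have h1 := tendsto_primeCounting_mul_log_div.comp hx
  have hlog := Real.tendsto_log_atTop.comp hinv
  have h2 : Tendsto (fun t : ℝ => Real.log (a / t) / Real.log (1 / t))
      (nhdsWithin 0 (Set.Ioi 0)) (nhds 1) := by
    have h3 : Tendsto (fun t : ℝ => Real.log a / Real.log (1 / t) + 1)
        (nhdsWithin 0 (Set.Ioi 0)) (nhds (0 + 1)) :=
      ((tendsto_const_nhds (x := Real.log a)).div_atTop hlog).add tendsto_const_nhds
    rw [zero_add] at h3
    refine h3.congr' ?_
    filter_upwards [hlog.eventually_gt_atTop 0, self_mem_nhdsWithin] with t ht ht0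
    have ht0' : (0 : ℝ) < t := ht0
    simp only [Function.comp_apply] at ht
    rw [show a / t = a * (1 / t) by ring, Real.log_mul ha.ne' (by positivity)]
    field_simp
  have h4 := (h1.div h2 one_ne_zero).const_mul a
  rw [div_one, mul_one] at h4
  refine h4.congr' ?_
  filter_upwards [hlog.eventually_gt_atTop 0, hx.eventually_gt_atTop 1, self_mem_nhdsWithin]
    with t ht hxt ht0
  have ht0' : (0 : ℝ) < t := ht0
  simp only [Function.comp_apply, Pi.div_apply] at ht ⊢
  have := Real.log_pos hxt
  field_simp

/-- The sum of `phi (p t)` over primes `p`. -/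
def primeSum (t : ℝ) : ℝ := ∑' p : Nat.Primes, phi (p * t)

theorem phi_prime_nonneg {t : ℝ} (ht : 0 < t) (p : Nat.Primes) : 0 ≤ phi (p * t) :=
  (phi_pos (mul_pos (Nat.cast_pos.2 p.2.pos) ht)).le

instance : MeasurableSpace Nat.Primes := ⊤

instance : DiscreteMeasurableSpace Nat.Primes := ⟨fun _ => trivial⟩

theorem count_primes_le (m : ℕ) :
    Measure.count {p : Nat.Primes | (p : ℕ) ≤ m} = (Nat.primeCounting m : ENNReal) := by
  have hinj : Function.Injective (fun p : Nat.Primes => (p : ℕ)) := fun p q h => Subtype.ext h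
  rw [Measure.count_apply (Set.to_countable _).measurableSet, ← hinj.encard_image]
  have : ((fun p : Nat.Primes => (p : ℕ)) '' {p : Nat.Primes | (p : ℕ) ≤ m}) =
      ((Nat.primesLE m : Finset ℕ) : Set ℕ) := by
    ext q
    simp only [Set.mem_image, Finset.mem_coe, Nat.mem_primesLE]
    constructor
    · rintro ⟨p, hp, rfl⟩; exact ⟨hp, p.2⟩
    · rintro ⟨h1, h2⟩; exact ⟨⟨q, h2⟩, h1, rfl⟩
  rw [this, Set.encard_coe_eq_coe_finsetCard, Nat.primesLE_card_eq_primeCounting]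
  simp

theorem tsum_ofReal_phi {t : ℝ} (ht : 0 < t) :
    ∑' p : Nat.Primes, ENNReal.ofReal (phi (p * t)) =
      ∫⁻ y in Set.Ioi (0 : ℝ), ENNReal.ofReal (Nat.primeCounting ⌊phiInv y / t⌋₊ : ℝ) := by
  rw [← lintegral_count, lintegral_eq_lintegral_meas_le _
    (Eventually.of_forall fun p => phi_prime_nonneg ht p) (measurable_of_countable _).aemeasurable]
  refine setLIntegral_congr_fun measurableSet_Ioi fun y hy => ?_
  have : {p : Nat.Primes | y ≤ phi (p * t)} = {p : Nat.Primes | (p : ℕ) ≤ ⌊phiInv y / t⌋₊} := by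
    ext p
    have hp : (0 : ℝ) < (p : ℕ) := Nat.cast_pos.2 p.2.pos
    simp only [Set.mem_ofPred_eq]
    rw [le_phi_iff (mul_pos hp ht) hy, Nat.le_floor_iff (div_nonneg (phiInv_pos hy).le ht.le),
      le_div_iff₀ ht]
  simp only [this, count_primes_le, ENNReal.ofReal_natCast]

theorem measurable_primeCounting_phiInv (t : ℝ) :
    Measurable fun y => (Nat.primeCounting ⌊phiInv y / t⌋₊ : ℝ) :=
  (measurable_of_countable (fun m : ℕ => (Nat.primeCounting m : ℝ))).comp
    (Nat.measurable_floor.comp (measurable_phiInv.div_const t))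

theorem exists_bound_primeCounting_phiInv :
    ∃ C : ℝ, ∀ t : ℝ, 0 < t → t < 1 → ∀ᵐ y ∂(volume.restrict (Set.Ioi (0 : ℝ))),
      ‖t * Real.log (1 / t) * (Nat.primeCounting ⌊phiInv y / t⌋₊ : ℝ)‖ ≤ C * phiInvBound y := by
  obtain ⟨C, hC, h⟩ := exists_mul_log_primeCounting_le
  refine ⟨2 * C + 4, fun t ht ht1 =>
    (ae_restrict_iff' measurableSet_Ioi).2 (Eventually.of_forall fun y hy => ?_)⟩
  have hL : 0 < Real.log (1 / t) := Real.log_pos (by rw [lt_div_iff₀ ht]; linarith)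
  rw [Real.norm_of_nonneg (by positivity)]
  have h1 := mul_le_mul_of_nonneg_left (phiInv_le hy) hC
  have h2 := sqrt_phiInv_le hy
  linarith [h _ t (phiInv_pos hy) ht ht1]

theorem integrableOn_primeCounting_phiInv {t : ℝ} (ht : 0 < t) (ht1 : t < 1) :
    IntegrableOn (fun y => (Nat.primeCounting ⌊phiInv y / t⌋₊ : ℝ)) (Set.Ioi 0) := by
  obtain ⟨C, h⟩ := exists_bound_primeCounting_phiInv
  have hL : 0 < Real.log (1 / t) := Real.log_pos (by rw [lt_div_iff₀ ht]; linarith)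
  have h1 : IntegrableOn (fun y => t * Real.log (1 / t) * (Nat.primeCounting ⌊phiInv y / t⌋₊ : ℝ))
      (Set.Ioi 0) := (integrableOn_phiInvBound.const_mul C).mono'
    ((measurable_primeCounting_phiInv t).const_mul _).aestronglyMeasurable (h t ht ht1)
  refine (h1.const_mul (t * Real.log (1 / t))⁻¹).congr (Eventually.of_forall fun y => ?_)
  exact inv_mul_cancel_left₀ (by positivity) _

theorem hasSum_phi {t : ℝ} (ht : 0 < t) (ht1 : t < 1) :
    HasSum (fun p : Nat.Primes => phi (p * t))
      (∫ y in Set.Ioi (0 : ℝ), (Nat.primeCounting ⌊phiInv y / t⌋₊ : ℝ)) := by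
  have hi := integrableOn_primeCounting_phiInv ht ht1
  have h1 := ofReal_integral_eq_lintegral_ofReal hi
    (Eventually.of_forall fun y => Nat.cast_nonneg _)
  rw [← tsum_ofReal_phi ht] at h1
  have hne : ∑' p : Nat.Primes, ENNReal.ofReal (phi (p * t)) ≠ ⊤ := by
    rw [← h1]; exact ENNReal.ofReal_ne_top
  have h2 := ENNReal.hasSum_toReal hne
  rw [← ENNReal.tsum_toReal_eq (ENNReal.ne_top_of_tsum_ne_top hne), ← h1,
    ENNReal.toReal_ofReal (integral_nonneg fun y => Nat.cast_nonneg _)] at h2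
  simpa only [ENNReal.toReal_ofReal (phi_prime_nonneg ht _)] using h2

theorem summable_phi {t : ℝ} (ht : 0 < t) (ht1 : t < 1) :
    Summable (fun p : Nat.Primes => phi (p * t)) := (hasSum_phi ht ht1).summable

theorem tendsto_primeSum :
    Tendsto (fun t : ℝ => t * Real.log (1 / t) * primeSum t) (nhdsWithin 0 (Set.Ioi 0))
      (nhds (∫ u in Set.Ioi (0 : ℝ), phi u)) := by
  obtain ⟨C, h⟩ := exists_bound_primeCounting_phiInv
  have hev : ∀ᶠ t : ℝ in nhdsWithin 0 (Set.Ioi 0), 0 < t ∧ t < 1 :=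
    Ioo_mem_nhdsGT one_pos
  rw [← integral_phiInv_eq]
  have := tendsto_integral_filter_of_dominated_convergence
    (l := nhdsWithin (0 : ℝ) (Set.Ioi 0)) (μ := volume.restrict (Set.Ioi (0 : ℝ)))
    (F := fun t y => t * Real.log (1 / t) * (Nat.primeCounting ⌊phiInv y / t⌋₊ : ℝ))
    (f := phiInv) (fun y => C * phiInvBound y)
    (Eventually.of_forall fun t =>
      ((measurable_primeCounting_phiInv t).const_mul _).aestronglyMeasurable)
    (hev.mono fun t ht => h t ht.1 ht.2) (integrableOn_phiInvBound.const_mul C)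
    ((ae_restrict_iff' measurableSet_Ioi).2 (Eventually.of_forall fun y hy =>
      tendsto_mul_log_primeCounting (phiInv_pos hy)))
  refine this.congr' (hev.mono fun t ht => ?_)
  simp only [integral_const_mul, primeSum, (hasSum_phi ht.1 ht.2).tsum_eq]

section Counting

variable {n k : ℕ}

theorem mem_zkMaps {f : Fin n → Fin n} : f ∈ zkMaps n k ↔ IsZKMap k f := by simp [zkMaps]

theorem isZKMap_comp_left {f : Fin n → Fin n} (hf : IsZKMap k f) (τ : Equiv.Perm (Fin n)) :
    IsZKMap k (τ ∘ f) := by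
  intro y
  have : (Finset.univ.filter fun x => (τ ∘ f) x = y) =
      Finset.univ.filter fun x => f x = τ.symm y := by
    ext x; simp [Equiv.eq_symm_apply]
  rw [this]
  exact hf _

theorem isZKMap_comp_right {f : Fin n → Fin n} (hf : IsZKMap k f) (τ : Equiv.Perm (Fin n)) :
    IsZKMap k (f ∘ τ) := by
  intro y
  have : (Finset.univ.filter fun x => (f ∘ τ) x = y).card =
      (Finset.univ.filter fun x => f x = y).card := by
    refine Finset.card_bij (fun x _ => τ x) ?_ ?_ ?_
    · simp
    · simp
    · intro b hb
      exact ⟨τ.symm b, by simpa using hb, by simp⟩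
  rw [this]
  exact hf _

theorem mem_cyclicSet {f : Fin n → Fin n} {x : Fin n} :
    x ∈ cyclicSet f ↔ x ∈ Function.periodicPts f := by
  simp only [cyclicSet, Finset.mem_filter, Finset.mem_univ, true_and]
  rfl

theorem coe_cyclicSet (f : Fin n → Fin n) :
    (cyclicSet f : Set (Fin n)) = Function.periodicPts f := by
  ext x; exact mem_cyclicSet

theorem subset_cyclicSet {f : Fin n → Fin n} {S : Finset (Fin n)} (hS : ∀ x ∈ S, f x ∈ S)
    (hinj : Set.InjOn f S) : S ⊆ cyclicSet f := by
  intro x hx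
  have hm : Set.MapsTo f S S := hS
  have h1 : Function.Injective hm.restrict := hm.restrict_inj.2 hinj
  have h2 := h1.mem_periodicPts (⟨x, hx⟩ : (S : Set (Fin n)))
  rw [mem_cyclicSet]
  obtain ⟨m, hm0, hp⟩ := h2
  exact ⟨m, hm0, hp.map (g := Subtype.val) fun y => rfl⟩

theorem injOn_cyclicSet (f : Fin n → Fin n) : Set.InjOn f (cyclicSet f) := by
  rw [coe_cyclicSet]; exact (Function.bijOn_periodicPts f).injOn

theorem apply_mem_cyclicSet {f : Fin n → Fin n} {x : Fin n} (hx : x ∈ cyclicSet f) :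
    f x ∈ cyclicSet f := by
  rw [mem_cyclicSet] at *
  exact (Function.bijOn_periodicPts f).mapsTo hx

theorem perm_apply_mem {τ : Equiv.Perm (Fin n)} {S : Finset (Fin n)} (hτ : ∀ x, x ∉ S → τ x = x)
    {x : Fin n} (hx : x ∈ S) : τ x ∈ S := by
  by_contra h
  have := τ.injective (hτ _ h)
  rw [this] at h
  exact h hx

theorem cyclicSet_subset_comp_left {f : Fin n → Fin n} {τ : Equiv.Perm (Fin n)}
    (hτ : ∀ x, x ∉ cyclicSet f → τ x = x) : cyclicSet f ⊆ cyclicSet (τ ∘ f) :=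
  subset_cyclicSet (fun _ hx => perm_apply_mem hτ (apply_mem_cyclicSet hx))
    (τ.injective.comp_injOn (injOn_cyclicSet f))

theorem cyclicSet_comp_left {f : Fin n → Fin n} {τ : Equiv.Perm (Fin n)}
    (hτ : ∀ x, x ∉ cyclicSet f → τ x = x) : cyclicSet (τ ∘ f) = cyclicSet f := by
  have h := cyclicSet_subset_comp_left hτ
  refine Finset.Subset.antisymm ?_ h
  have h2 : ∀ x, x ∉ cyclicSet (τ ∘ f) → τ⁻¹ x = x := fun x hx => by
    rw [Equiv.Perm.inv_eq_iff_eq]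
    exact (hτ x fun h' => hx (h h')).symm
  have h3 := cyclicSet_subset_comp_left h2
  have h4 : (τ⁻¹ : Equiv.Perm (Fin n)) ∘ (τ ∘ f) = f := by funext x; simp
  rwa [h4] at h3

/-- The `{0,k}`-mappings agreeing with `σ` on `S`. -/
def zkExt (k : ℕ) (S : Finset (Fin n)) (σ : Equiv.Perm (Fin n)) : Finset (Fin n → Fin n) :=
  (zkMaps n k).filter fun f => ∀ x ∈ S, f x = σ x

theorem mem_zkExt {S : Finset (Fin n)} {σ : Equiv.Perm (Fin n)} {f : Fin n → Fin n} :
    f ∈ zkExt k S σ ↔ IsZKMap k f ∧ ∀ x ∈ S, f x = σ x := by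
  simp [zkExt, mem_zkMaps]

/-- The number of `{0,k}`-mappings fixing `S` pointwise. -/
def fixCount (k : ℕ) (S : Finset (Fin n)) : ℕ := (zkExt k S 1).card

theorem mem_zkExt_one {S : Finset (Fin n)} {f : Fin n → Fin n} :
    f ∈ zkExt k S 1 ↔ IsZKMap k f ∧ ∀ x ∈ S, f x = x := by
  simp [mem_zkExt]

theorem card_filter_comp_left (s t : Finset (Fin n → Fin n)) (τ : Equiv.Perm (Fin n))
    (h : ∀ f, f ∈ s ↔ τ ∘ f ∈ t) : s.card = t.card := by
  refine Finset.card_bij (fun f _ => τ ∘ f) (fun f hf => (h f).1 hf) ?_ ?_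
  · intro f _ g _ hfg
    funext x
    exact τ.injective (congrFun hfg x)
  · intro g hg
    have : τ ∘ (τ.symm ∘ g) = g := by funext x; simp
    exact ⟨τ.symm ∘ g, (h _).2 (by rwa [this]), this⟩

theorem isZKMap_comp_left_iff {f : Fin n → Fin n} (τ : Equiv.Perm (Fin n)) :
    IsZKMap k (τ ∘ f) ↔ IsZKMap k f := by
  refine ⟨fun h => ?_, fun h => isZKMap_comp_left h τ⟩
  have := isZKMap_comp_left h τ⁻¹
  rwa [show (τ⁻¹ : Equiv.Perm (Fin n)) ∘ (τ ∘ f) = f by funext x; simp] at this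

theorem isZKMap_comp_right_iff {f : Fin n → Fin n} (τ : Equiv.Perm (Fin n)) :
    IsZKMap k (f ∘ τ) ↔ IsZKMap k f := by
  refine ⟨fun h => ?_, fun h => isZKMap_comp_right h τ⟩
  have := isZKMap_comp_right h τ⁻¹
  rwa [show (f ∘ τ) ∘ (τ⁻¹ : Equiv.Perm (Fin n)) = f by funext x; simp] at this

theorem card_zkExt (S : Finset (Fin n)) (σ : Equiv.Perm (Fin n)) :
    (zkExt k S σ).card = fixCount k S := by
  refine (card_filter_comp_left _ _ σ fun f => ?_).symm
  simp [mem_zkExt, isZKMap_comp_left_iff]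

theorem card_filter_apply_eq {S : Finset (Fin n)} {x y : Fin n} (hx : x ∉ S) (hy : y ∉ S) :
    ((zkExt k S 1).filter fun f => f x = y).card = fixCount k (insert x S) := by
  refine card_filter_comp_left _ _ (Equiv.swap x y) fun f => ?_
  rw [Finset.mem_filter, mem_zkExt_one, mem_zkExt_one, isZKMap_comp_left_iff, and_assoc]
  refine and_congr_right fun _ => ?_
  simp only [Finset.mem_insert, forall_eq_or_imp, Function.comp_apply, Equiv.swap_apply_eq_iff,
    Equiv.swap_apply_left]
  rw [and_comm]
  refine and_congr_right fun _ => forall₂_congr fun z hz => ?_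
  rw [Equiv.swap_apply_of_ne_of_ne (ne_of_mem_of_not_mem hz hx) (ne_of_mem_of_not_mem hz hy)]

theorem card_filter_apply_notMem {S : Finset (Fin n)} {x : Fin n} (hx : x ∉ S) :
    ((zkExt k S 1).filter fun f => f x ∉ S).card = (n - S.card) * fixCount k (insert x S) := by
  have h := Finset.card_eq_sum_card_fiberwise (s := (zkExt k S 1).filter fun f => f x ∉ S)
    (t := Sᶜ) (f := fun f => f x) (by intro f hf; simpa using (Finset.mem_filter.1 hf).2)
  rw [h]
  have : ∀ y ∈ Sᶜ, (((zkExt k S 1).filter fun f => f x ∉ S).filter fun f => f x = y).card =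
      fixCount k (insert x S) := by
    intro y hy
    rw [← card_filter_apply_eq hx (Finset.mem_compl.1 hy), Finset.filter_filter]
    congr 1
    refine Finset.filter_congr fun f _ => ?_
    refine ⟨fun h => h.2, fun h => ⟨?_, h⟩⟩
    rw [h]; exact Finset.mem_compl.1 hy
  rw [Finset.sum_congr rfl this, Finset.sum_const, Finset.card_compl, Fintype.card_fin, smul_eq_mul]

theorem card_filter_apply_notMem_congr {S : Finset (Fin n)} {x y : Fin n} (hx : x ∉ S)
    (hy : y ∉ S) : ((zkExt k S 1).filter fun f => f x ∉ S).card =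
      ((zkExt k S 1).filter fun f => f y ∉ S).card := by
  have hmem : ∀ f : Fin n → Fin n, f ∈ zkExt k S 1 → f ∘ Equiv.swap x y ∈ zkExt k S 1 := by
    intro f hf
    rw [mem_zkExt_one] at *
    refine ⟨(isZKMap_comp_right_iff _).2 hf.1, fun z hz => ?_⟩
    rw [Function.comp_apply, Equiv.swap_apply_of_ne_of_ne (ne_of_mem_of_not_mem hz hx)
      (ne_of_mem_of_not_mem hz hy), hf.2 z hz]
  refine Finset.card_nbij' (fun f => f ∘ Equiv.swap x y) (fun f => f ∘ Equiv.swap x y) ?_ ?_ ?_ ?_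
  · intro f hf
    simp only [Finset.coe_filter, Set.mem_ofPred_eq] at hf ⊢
    exact ⟨hmem f hf.1, by simpa using hf.2⟩
  · intro f hf
    simp only [Finset.coe_filter, Set.mem_ofPred_eq] at hf ⊢
    exact ⟨hmem f hf.1, by simpa using hf.2⟩
  · intro f _; funext z; simp
  · intro f _; funext z; simp

theorem card_preimage_add {S : Finset (Fin n)} {f : Fin n → Fin n}
    (hf : f ∈ zkExt k S 1) :
    (Sᶜ.filter fun x => f x ∉ S).card + k * S.card = n := by
  rw [mem_zkExt_one] at hf
  have h1 : (Finset.univ.filter fun x => f x ∈ S).card = k * S.card := by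
    rw [Finset.card_eq_sum_card_fiberwise (t := S) (f := f) (by intro x hx; simpa using hx)]
    rw [Finset.sum_congr rfl (g := fun _ => k), Finset.sum_const, smul_eq_mul, mul_comm]
    intro y hy
    have : ((Finset.univ.filter fun x => f x ∈ S).filter fun x => f x = y) =
        Finset.univ.filter fun x => f x = y := by
      ext x
      simp only [Finset.mem_filter, Finset.mem_univ, true_and]
      exact ⟨fun h => h.2, fun h => ⟨h ▸ hy, h⟩⟩
    rw [this]
    rcases hf.1 y with h | h
    · exfalso
      have : y ∈ (Finset.univ.filter fun x => f x = y) := by simp [hf.2 y hy]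
      rw [Finset.card_eq_zero.1 h] at this
      simp at this
    · exact h
  have h2 : (Sᶜ.filter fun x => f x ∉ S) = Finset.univ.filter fun x => ¬ f x ∈ S := by
    ext x
    simp only [Finset.mem_filter, Finset.mem_compl, Finset.mem_univ, true_and,
      and_iff_right_iff_imp]
    intro h hx
    exact h (by rw [hf.2 x hx]; exact hx)
  rw [h2, ← h1, add_comm, Finset.card_filter_add_card_filter_not]
  simp

theorem fixCount_insert {S : Finset (Fin n)} {x : Fin n} (hx : x ∉ S) :
    ((n : ℝ) - S.card) ^ 2 * fixCount k (insert x S) = ((n : ℝ) - k * S.card) * fixCount k S := by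
  have hle : S.card ≤ n := by simpa using Finset.card_le_univ S
  have h1 : ∑ y ∈ Sᶜ, ((zkExt k S 1).filter fun f => f y ∉ S).card =
      ∑ f ∈ zkExt k S 1, (Sᶜ.filter fun y => f y ∉ S).card := by
    simp_rw [Finset.card_filter]
    exact Finset.sum_comm
  have h2 : ∑ y ∈ Sᶜ, ((zkExt k S 1).filter fun f => f y ∉ S).card =
      (n - S.card) * ((n - S.card) * fixCount k (insert x S)) := by
    rw [Finset.sum_congr rfl (g := fun _ => (n - S.card) * fixCount k (insert x S))]
    · rw [Finset.sum_const, Finset.card_compl, Fintype.card_fin, smul_eq_mul]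
    · intro y hy
      rw [card_filter_apply_notMem_congr (Finset.mem_compl.1 hy) hx, card_filter_apply_notMem hx]
  have h3 : (∑ f ∈ zkExt k S 1, ((Sᶜ.filter fun y => f y ∉ S).card : ℝ)) =
      ((n : ℝ) - k * S.card) * fixCount k S := by
    rw [Finset.sum_congr rfl (g := fun _ => ((n : ℝ) - k * S.card))]
    · rw [Finset.sum_const, nsmul_eq_mul, mul_comm]; rfl
    · intro f hf
      have := card_preimage_add hf
      rw [eq_sub_iff_add_eq]
      exact_mod_cast this
  rw [← h3]
  have h4 := h2.symm.trans h1
  have h5 : (((n - S.card) * ((n - S.card) * fixCount k (insert x S)) : ℕ) : ℝ) =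
      ((n : ℝ) - S.card) ^ 2 * fixCount k (insert x S) := by
    push_cast [Nat.cast_sub hle]; ring
  rw [← h5, h4]
  push_cast
  rfl

/-- The ratio `∏_{i < L} (n - k i) / (n - i)`. -/
def fixRatio (n k L : ℕ) : ℝ := ∏ i ∈ range L, ((n : ℝ) - k * i) / ((n : ℝ) - i)

theorem descFactorial_mul_fixCount (S : Finset (Fin n)) :
    (n.descFactorial S.card : ℝ) * fixCount k S = (zkMaps n k).card * fixRatio n k S.card := by
  induction S using Finset.induction_on with
  | empty => simp [fixCount, fixRatio, zkExt]
  | insert x S hx ih =>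
    have hlt : S.card < n := by
      have := Finset.card_le_univ (insert x S)
      rw [Finset.card_insert_of_notMem hx, Fintype.card_fin] at this
      omega
    have hpos : (0 : ℝ) < (n : ℝ) - S.card := by
      rw [sub_pos]; exact_mod_cast hlt
    rw [Finset.card_insert_of_notMem hx, Nat.descFactorial_succ, fixRatio, Finset.prod_range_succ,
      ← fixRatio, ← mul_assoc, ← ih, Nat.cast_mul, Nat.cast_sub hlt.le]
    have h := fixCount_insert (k := k) hx
    field_simp
    linear_combination (n.descFactorial S.card : ℝ) * h

theorem card_zkMaps_pos {r : ℕ} (hk : 0 < k) (hn : n = k * r) : 0 < (zkMaps n k).card := by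
  subst hn
  refine Finset.card_pos.2 ⟨fun x => ⟨x / k, lt_of_le_of_lt (Nat.div_le_self _ _) x.2⟩, ?_⟩
  rw [mem_zkMaps]
  intro y
  by_cases hy : (y : ℕ) < r
  · right
    have : (Finset.univ.filter fun x : Fin (k * r) =>
        (⟨x / k, lt_of_le_of_lt (Nat.div_le_self _ _) x.2⟩ : Fin (k * r)) = y).card =
          (Finset.range k).card := by
      symm
      refine Finset.card_bij (fun i hi => ⟨k * y + i, ?_⟩) ?_ ?_ ?_
      · have h1 := Finset.mem_range.1 hi
        calc k * y + i < k * y + k := by omega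
          _ = k * (y + 1) := by ring
          _ ≤ k * r := Nat.mul_le_mul_left _ hy
      · intro i hi
        have h1 := Finset.mem_range.1 hi
        simp only [Finset.mem_filter, Finset.mem_univ, true_and, Fin.ext_iff]
        rw [Nat.mul_add_div hk, Nat.div_eq_of_lt h1, add_zero]
      · intro i _ j _ h
        simpa [Fin.ext_iff] using h
      · intro x hx
        simp only [Finset.mem_filter, Finset.mem_univ, true_and, Fin.ext_iff] at hx
        refine ⟨x % k, Finset.mem_range.2 (Nat.mod_lt _ hk), ?_⟩
        simp only [Fin.ext_iff]
        rw [← hx]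
        exact Nat.div_add_mod _ _
    rw [this, Finset.card_range]
  · left
    rw [Finset.card_eq_zero, Finset.filter_eq_empty_iff]
    intro x _ h
    apply hy
    rw [← h]
    exact Nat.div_lt_of_lt_mul x.2

/-- The `{0,k}`-mappings agreeing with `σ` on `S` whose set of cyclic nodes is exactly `S`. -/
def zkExact (k : ℕ) (S : Finset (Fin n)) (σ : Equiv.Perm (Fin n)) : Finset (Fin n → Fin n) :=
  (zkExt k S σ).filter fun f => cyclicSet f = S

theorem card_zkExact {S : Finset (Fin n)} {σ : Equiv.Perm (Fin n)} (hσ : ∀ x, x ∉ S → σ x = x) :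
    (zkExact k S σ).card = (zkExact k S 1).card := by
  refine (card_filter_comp_left _ _ σ fun f => ?_).symm
  simp only [zkExact, Finset.mem_filter, mem_zkExt, isZKMap_comp_left_iff, Function.comp_apply,
    EmbeddingLike.apply_eq_iff_eq, Equiv.Perm.coe_one, id]
  refine and_congr_right fun _ => ?_
  constructor
  · intro h; rw [← h, cyclicSet_comp_left (by rwa [h])]
  · intro h
    have hσ' : ∀ x, x ∉ cyclicSet (σ ∘ f) → σ⁻¹ x = x := fun x hx => by
      rw [Equiv.Perm.inv_eq_iff_eq]; exact (hσ x (h ▸ hx)).symm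
    have := cyclicSet_comp_left hσ'
    rw [← h, ← this]
    congr 1; funext x; simp

theorem cyclicSet_superset {S : Finset (Fin n)} {f : Fin n → Fin n} (hf : f ∈ zkExt k S 1) :
    S ⊆ cyclicSet f := fun x hx =>
  mem_cyclicSet.2 ⟨1, one_pos, by
    rw [Function.IsPeriodicPt, Function.IsFixedPt, Function.iterate_one,
      (mem_zkExt_one.1 hf).2 x hx]⟩

theorem sum_card_filter_fixed {S S' : Finset (Fin n)} (hSS : S ⊆ S') (hne : S ≠ S') :
    ∑ x ∈ Sᶜ, (((zkExt k S 1).filter fun f => cyclicSet f = S').filter fun f => f x = x).card =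
      ((zkExt k S 1).filter fun f => cyclicSet f = S').card := by
  set E := (zkExt k S 1).filter fun f => cyclicSet f = S' with hE
  have hmemE : ∀ {f : Fin n → Fin n}, f ∈ E ↔
      (IsZKMap k f ∧ ∀ x ∈ S, f x = x) ∧ cyclicSet f = S' := by
    intro f; rw [hE, Finset.mem_filter, mem_zkExt_one]
  have hdpos : 0 < (S' \ S).card := Finset.card_pos.2 (Finset.sdiff_nonempty.2 fun h =>
    hne (Finset.Subset.antisymm hSS h))
  have hfix : ∀ x ∈ S' \ S, (S' \ S).card * (E.filter fun f => f x = x).card = E.card := by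
    intro x hx
    rw [Finset.mem_sdiff] at hx
    rw [Finset.card_eq_sum_card_fiberwise (s := E) (t := S' \ S) (f := fun f => f x)]
    · rw [Finset.sum_congr rfl (g := fun _ => (E.filter fun f => f x = x).card), Finset.sum_const,
        smul_eq_mul]
      intro y hy
      rw [Finset.mem_sdiff] at hy
      have hsw : ∀ z, z ∉ S' → Equiv.swap x y z = z := fun z hz =>
        Equiv.swap_apply_of_ne_of_ne (fun h => hz (h ▸ hx.1)) (fun h => hz (h ▸ hy.1))
      have hcyc : ∀ f : Fin n → Fin n, cyclicSet f = S' → cyclicSet (Equiv.swap x y ∘ f) = S' :=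
        fun f hf => by rw [cyclicSet_comp_left (by rwa [hf]), hf]
      refine card_filter_comp_left _ _ (Equiv.swap x y) fun f => ?_
      rw [Finset.mem_filter (s := E), Finset.mem_filter (s := E), hmemE, hmemE,
        isZKMap_comp_left_iff]
      refine and_congr (and_congr (and_congr_right fun _ => forall₂_congr fun z hz => ?_) ?_) ?_
      · rw [Function.comp_apply, Equiv.swap_apply_eq_iff,
          Equiv.swap_apply_of_ne_of_ne (ne_of_mem_of_not_mem hz hx.2)
            (ne_of_mem_of_not_mem hz hy.2)]
      · refine ⟨hcyc f, fun h => ?_⟩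
        have := hcyc _ h
        rwa [show Equiv.swap x y ∘ (Equiv.swap x y ∘ f) = f by funext z; simp] at this
      · rw [Function.comp_apply, Equiv.swap_apply_eq_iff, Equiv.swap_apply_left]
    · intro f hf
      have hf' := hmemE.1 hf
      have hxc : x ∈ cyclicSet f := by rw [hf'.2]; exact hx.1
      simp only [Finset.coe_sdiff, Set.mem_sdiff, Finset.mem_coe]
      refine ⟨by have := apply_mem_cyclicSet hxc; rwa [hf'.2] at this, fun h => hx.2 ?_⟩
      have h2 := injOn_cyclicSet f (apply_mem_cyclicSet hxc) hxc (hf'.1.2 _ h)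
      rwa [h2] at h
  have hsub : S' \ S ⊆ Sᶜ := fun x hx => by simpa using (Finset.mem_sdiff.1 hx).2
  rw [← Finset.sum_subset hsub]
  · apply Nat.eq_of_mul_eq_mul_left hdpos
    rw [Finset.mul_sum, Finset.sum_congr rfl hfix, Finset.sum_const, smul_eq_mul]
  · intro x hx hx'
    rw [Finset.card_eq_zero, Finset.filter_eq_empty_iff]
    intro f hf hfx
    apply hx'
    rw [Finset.mem_sdiff]
    refine ⟨?_, by simpa using hx⟩
    rw [← (hmemE.1 hf).2, mem_cyclicSet]
    exact ⟨1, one_pos, hfx⟩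

theorem fixCount_eq (S : Finset (Fin n)) :
    fixCount k S = (zkExact k S 1).card + ∑ x ∈ Sᶜ, fixCount k (insert x S) := by
  have h1 : ∀ x ∈ Sᶜ, fixCount k (insert x S) = ((zkExt k S 1).filter fun f => f x = x).card :=
    fun x hx => (card_filter_apply_eq (Finset.mem_compl.1 hx) (Finset.mem_compl.1 hx)).symm
  have h2 : ∀ x ∈ Sᶜ, ((zkExt k S 1).filter fun f => f x = x).card =
      ∑ S' : Finset (Fin n),
        (((zkExt k S 1).filter fun f => cyclicSet f = S').filter fun f => f x = x).card := by
    intro x _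
    rw [Finset.card_eq_sum_card_fiberwise (t := Finset.univ) (f := cyclicSet) (by intro; simp)]
    refine Finset.sum_congr rfl fun S' _ => ?_
    rw [Finset.filter_comm]
  rw [Finset.sum_congr rfl h1, Finset.sum_congr rfl h2, Finset.sum_comm, fixCount,
    Finset.card_eq_sum_card_fiberwise (s := zkExt k S 1) (t := Finset.univ) (f := cyclicSet)
      (by intro; simp), ← Finset.add_sum_erase _ _ (Finset.mem_univ S),
    ← Finset.add_sum_erase (a := S) _ (fun S' => ∑ x ∈ Sᶜ, _) (Finset.mem_univ S)]
  have hS : ∑ x ∈ Sᶜ, (((zkExt k S 1).filter fun f => cyclicSet f = S).filter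
      fun f => f x = x).card = 0 := by
    refine Finset.sum_eq_zero fun x hx => ?_
    rw [Finset.card_eq_zero, Finset.filter_eq_empty_iff]
    intro f hf hfx
    rw [Finset.mem_filter] at hf
    apply Finset.mem_compl.1 hx
    rw [← hf.2, mem_cyclicSet]
    exact ⟨1, one_pos, hfx⟩
  rw [hS, zero_add]
  congr 1
  refine Finset.sum_congr rfl fun S' hS' => ?_
  by_cases hsub : S ⊆ S'
  · exact (sum_card_filter_fixed hsub (Finset.ne_of_mem_erase hS').symm).symm
  · have : ((zkExt k S 1).filter fun f => cyclicSet f = S') = ∅ := by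
      rw [Finset.filter_eq_empty_iff]
      intro f hf h
      exact hsub (h ▸ cyclicSet_superset hf)
    simp [this]

theorem card_zkExact_one {S : Finset (Fin n)} (hS : S.card < n) :
    ((zkExact k S 1).card : ℝ) = fixCount k S * (((k : ℝ) - 1) * S.card / (n - S.card)) := by
  have h := fixCount_eq (k := k) S
  have hpos : (0 : ℝ) < (n : ℝ) - S.card := by rw [sub_pos]; exact_mod_cast hS
  have h2 : (∑ x ∈ Sᶜ, (fixCount k (insert x S) : ℝ)) =
      ((n : ℝ) - k * S.card) / (n - S.card) * fixCount k S := by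
    rw [Finset.sum_congr rfl (g := fun _ =>
      ((n : ℝ) - k * S.card) / (n - S.card) ^ 2 * fixCount k S)]
    · rw [Finset.sum_const, Finset.card_compl, Fintype.card_fin, nsmul_eq_mul, Nat.cast_sub hS.le]
      field_simp
    · intro x hx
      have := fixCount_insert (k := k) (Finset.mem_compl.1 hx)
      field_simp
      linarith
  have h3 : (fixCount k S : ℝ) = (zkExact k S 1).card +
      ∑ x ∈ Sᶜ, (fixCount k (insert x S) : ℝ) := by
    exact_mod_cast h
  rw [h2] at h3
  have h4 : ((zkExact k S 1).card : ℝ) =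
      fixCount k S - ((n : ℝ) - k * S.card) / (n - S.card) * fixCount k S := by linarith
  rw [h4]
  field_simp
  ring

end Counting

section CycleEmbeddings

variable {n k : ℕ} {ι : Type*} {l : ι → ℕ}

/-- The permutation rotating each of the blocks `Fin (l i)`. -/
def blockRotate (l : ι → ℕ) : Equiv.Perm (Σ i, Fin (l i)) :=
  Equiv.sigmaCongrRight fun i => finRotate (l i)

theorem blockRotate_apply (z : Σ i, Fin (l i)) : blockRotate l z = ⟨z.1, finRotate (l z.1) z.2⟩ :=
  rfl

theorem val_finRotate {m : ℕ} (j : Fin m) : (finRotate m j : ℕ) = (j + 1) % m := by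
  cases m with
  | zero => exact j.elim0
  | succ m =>
    rw [finRotate_apply, Fin.val_add, Fin.val_one']
    simp

variable [Fintype ι]

/-- The embeddings which identify block `i` with a cycle of `f` of length `l i`. -/
def cycleEmb (f : Fin n → Fin n) (l : ι → ℕ) : Finset ((Σ i, Fin (l i)) ↪ Fin n) :=
  Finset.univ.filter fun e => ∀ z, f (e z) = e (blockRotate l z)

theorem mem_cycleEmb {f : Fin n → Fin n} {e : (Σ i, Fin (l i)) ↪ Fin n} :
    e ∈ cycleEmb f l ↔ ∀ z, f (e z) = e (blockRotate l z) := by simp [cycleEmb]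

/-- The elements of `cycleEmb f l` that exhaust the cyclic nodes of `f`. -/
def cycleEmbExact (f : Fin n → Fin n) (l : ι → ℕ) : Finset ((Σ i, Fin (l i)) ↪ Fin n) :=
  (cycleEmb f l).filter fun e => cyclicSet f = Finset.univ.map e

/-- The permutation of `Fin n` rotating the blocks along `e`. -/
def rotateAlong (e : (Σ i, Fin (l i)) ↪ Fin n) : Equiv.Perm (Fin n) :=
  (blockRotate l).viaFintypeEmbedding e

theorem mem_zkExt_rotateAlong {f : Fin n → Fin n} {e : (Σ i, Fin (l i)) ↪ Fin n} :
    f ∈ zkExt k (Finset.univ.map e) (rotateAlong e) ↔ f ∈ zkMaps n k ∧ e ∈ cycleEmb f l := by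
  rw [zkExt, Finset.mem_filter, mem_cycleEmb]
  refine and_congr_right fun _ => ?_
  rw [Finset.forall_mem_map]
  simp only [Finset.mem_univ, rotateAlong, Equiv.Perm.viaFintypeEmbedding_apply_image,
    forall_true_left]

theorem rotateAlong_apply_of_notMem {e : (Σ i, Fin (l i)) ↪ Fin n} {x : Fin n}
    (hx : x ∉ Finset.univ.map e) : rotateAlong e x = x :=
  Equiv.Perm.viaFintypeEmbedding_apply_notMem_range _ _ (by simpa using hx)

theorem sum_card_cycleEmb :
    ∑ f ∈ zkMaps n k, (cycleEmb f l).card =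
      ∑ e : (Σ i, Fin (l i)) ↪ Fin n, fixCount k (Finset.univ.map e) := by
  simp_rw [cycleEmb, Finset.card_filter]
  rw [Finset.sum_comm]
  refine Finset.sum_congr rfl fun e _ => ?_
  rw [← Finset.card_filter, ← card_zkExt _ (rotateAlong e)]
  congr 1
  ext f
  rw [mem_zkExt_rotateAlong, Finset.mem_filter, mem_cycleEmb]

theorem sum_card_cycleEmbExact :
    ∑ f ∈ zkMaps n k, (cycleEmbExact f l).card =
      ∑ e : (Σ i, Fin (l i)) ↪ Fin n, (zkExact k (Finset.univ.map e) 1).card := by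
  simp_rw [cycleEmbExact, cycleEmb, Finset.filter_filter, Finset.card_filter]
  rw [Finset.sum_comm]
  refine Finset.sum_congr rfl fun e _ => ?_
  rw [← Finset.card_filter,
    ← card_zkExact (σ := rotateAlong e) fun x hx => rotateAlong_apply_of_notMem hx]
  congr 1
  ext f
  rw [zkExact, Finset.mem_filter, Finset.mem_filter, mem_zkExt_rotateAlong, mem_cycleEmb, and_assoc]

theorem card_blocks : Fintype.card (Σ i, Fin (l i)) = ∑ i, l i := by simp

theorem card_map_univ (e : (Σ i, Fin (l i)) ↪ Fin n) : (Finset.univ.map e).card = ∑ i, l i := by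
  simp

theorem fixRatio_eq_zero {r L : ℕ} (hn : n = k * r) (hL : r < L) : fixRatio n k L = 0 := by
  refine Finset.prod_eq_zero (Finset.mem_range.2 hL) ?_
  rw [hn]; push_cast; simp

theorem fixRatio_nonneg {r : ℕ} (hk : 0 < k) (hn : n = k * r) (L : ℕ) : 0 ≤ fixRatio n k L := by
  rcases lt_or_ge r L with h | h
  · rw [fixRatio_eq_zero hn h]
  refine Finset.prod_nonneg fun i hi => ?_
  have hi' : i ≤ r := (Finset.mem_range.1 hi).le.trans h
  have h1 : k * i ≤ n := hn ▸ Nat.mul_le_mul_left _ hi'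
  have h2 : i ≤ n := le_trans (Nat.le_mul_of_pos_left _ hk) h1
  have h1' : (k : ℝ) * i ≤ n := by exact_mod_cast h1
  have h2' : (i : ℝ) ≤ n := by exact_mod_cast h2
  exact div_nonneg (by linarith) (by linarith)

theorem sum_fixCount_embedding (h : ∑ i, l i ≤ n) :
    ∑ e : (Σ i, Fin (l i)) ↪ Fin n, (fixCount k (Finset.univ.map e) : ℝ) =
      (zkMaps n k).card * fixRatio n k (∑ i, l i) := by
  have hpos : (0 : ℝ) < n.descFactorial (∑ i, l i) := by
    exact_mod_cast Nat.descFactorial_pos.2 h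
  have h1 : ∀ e : (Σ i, Fin (l i)) ↪ Fin n, (fixCount k (Finset.univ.map e) : ℝ) =
      (zkMaps n k).card * fixRatio n k (∑ i, l i) / n.descFactorial (∑ i, l i) := fun e => by
    rw [eq_div_iff hpos.ne', mul_comm]
    have := descFactorial_mul_fixCount (k := k) (Finset.univ.map e)
    rwa [card_map_univ] at this
  rw [Finset.sum_congr rfl fun e _ => h1 e, Finset.sum_const, Finset.card_univ,
    Fintype.card_embedding_eq, Fintype.card_fin, card_blocks, nsmul_eq_mul,
    mul_div_cancel₀ _ hpos.ne']

theorem sum_card_cycleEmb_eq {r : ℕ} (hk : 0 < k) (hn : n = k * r) :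
    (∑ f ∈ zkMaps n k, ((cycleEmb f l).card : ℝ)) =
      (zkMaps n k).card * fixRatio n k (∑ i, l i) := by
  have h0 : (∑ f ∈ zkMaps n k, ((cycleEmb f l).card : ℝ)) =
      ∑ e : (Σ i, Fin (l i)) ↪ Fin n, (fixCount k (Finset.univ.map e) : ℝ) := by
    exact_mod_cast sum_card_cycleEmb
  rw [h0]
  rcases le_or_gt (∑ i, l i) n with h | h
  · exact sum_fixCount_embedding h
  · have : IsEmpty ((Σ i, Fin (l i)) ↪ Fin n) := by
      rw [← Fintype.card_eq_zero_iff, Fintype.card_embedding_eq, Fintype.card_fin, card_blocks]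
      exact Nat.descFactorial_eq_zero_iff_lt.2 h
    rw [fixRatio_eq_zero hn (lt_of_le_of_lt (hn ▸ Nat.le_mul_of_pos_left _ hk) h)]
    simp

theorem le_sum_card_cycleEmbExact {r : ℕ} (hk : 2 ≤ k) (hr : 0 < r) (hn : n = k * r) :
    (zkMaps n k).card * (fixRatio n k (∑ i, l i) * (((k : ℝ) - 1) * (∑ i, l i : ℕ) / n)) ≤
      ∑ f ∈ zkMaps n k, ((cycleEmbExact f l).card : ℝ) := by
  have hrn : r < n := by rw [hn]; nlinarith
  rcases lt_or_ge (∑ i, l i) n with h | h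
  · have h0 : (∑ f ∈ zkMaps n k, ((cycleEmbExact f l).card : ℝ)) =
        ∑ e : (Σ i, Fin (l i)) ↪ Fin n, ((zkExact k (Finset.univ.map e) 1).card : ℝ) := by
      exact_mod_cast sum_card_cycleEmbExact
    have h1 : ∀ e : (Σ i, Fin (l i)) ↪ Fin n, ((zkExact k (Finset.univ.map e) 1).card : ℝ) =
        fixCount k (Finset.univ.map e) *
          (((k : ℝ) - 1) * (∑ i, l i : ℕ) / (n - (∑ i, l i : ℕ))) := fun e => by
      rw [card_zkExact_one (by rwa [card_map_univ]), card_map_univ]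
    rw [h0, Finset.sum_congr rfl fun e _ => h1 e, ← Finset.sum_mul, sum_fixCount_embedding h.le,
      mul_assoc]
    have hk' : (2 : ℝ) ≤ k := by exact_mod_cast hk
    have hL : (0 : ℝ) < (n : ℝ) - (∑ i, l i : ℕ) := by
      rw [sub_pos]; exact_mod_cast h
    refine mul_le_mul_of_nonneg_left (mul_le_mul_of_nonneg_left ?_
      (fixRatio_nonneg (by omega) hn _)) (Nat.cast_nonneg _)
    refine div_le_div_of_nonneg_left (mul_nonneg (by linarith) (Nat.cast_nonneg _)) hL ?_
    have : (0 : ℝ) ≤ (∑ i, l i : ℕ) := Nat.cast_nonneg _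
    linarith
  · rw [fixRatio_eq_zero hn (hrn.trans_le h)]
    simp only [zero_mul, mul_zero]
    positivity

theorem cycleEmb_apply {f : Fin n → Fin n} {e : (Σ i, Fin (l i)) ↪ Fin n} (he : e ∈ cycleEmb f l)
    (i : ι) (j : Fin (l i)) (m : ℕ) :
    f^[m] (e ⟨i, j⟩) = e ⟨i, ⟨(j + m) % l i, Nat.mod_lt _ j.pos⟩⟩ := by
  induction m with
  | zero => simp [Nat.mod_eq_of_lt j.2]
  | succ m ih =>
    rw [Function.iterate_succ_apply', ih, mem_cycleEmb.1 he, blockRotate_apply]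
    congr 2
    ext
    rw [val_finRotate]
    simp [add_assoc]

theorem minimalPeriod_cycleEmb {f : Fin n → Fin n} {e : (Σ i, Fin (l i)) ↪ Fin n}
    (he : e ∈ cycleEmb f l) (z : Σ i, Fin (l i)) : Function.minimalPeriod f (e z) = l z.1 := by
  obtain ⟨i, j⟩ := z
  have h : ∀ m, Function.IsPeriodicPt f m (e ⟨i, j⟩) ↔ l i ∣ m := by
    intro m
    rw [Function.IsPeriodicPt, Function.IsFixedPt, cycleEmb_apply he, e.apply_eq_iff_eq]
    simp only [Sigma.mk.injEq, heq_eq_eq, true_and, Fin.ext_iff]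
    rw [← Nat.modEq_zero_iff_dvd]
    constructor
    · intro h
      refine Nat.ModEq.add_left_cancel' (j : ℕ) ?_
      rw [Nat.ModEq, h, add_zero, Nat.mod_eq_of_lt j.2]
    · intro h
      have := Nat.ModEq.add_left (j : ℕ) h
      rwa [Nat.ModEq, add_zero, Nat.mod_eq_of_lt j.2] at this
  refine Nat.dvd_antisymm ?_ ?_
  · exact ((h _).2 dvd_rfl).minimalPeriod_dvd
  · exact (h _).1 (Function.isPeriodicPt_minimalPeriod _ _)

/-- An element of `cycleEmb f l` is determined by the images of the base points of the blocks. -/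
theorem cycleEmb_ext {f : Fin n → Fin n} {e e' : (Σ i, Fin (l i)) ↪ Fin n} (he : e ∈ cycleEmb f l)
    (he' : e' ∈ cycleEmb f l) (h : ∀ i (hi : 0 < l i), e ⟨i, ⟨0, hi⟩⟩ = e' ⟨i, ⟨0, hi⟩⟩) :
    e = e' := by
  ext ⟨i, j⟩
  have h1 := cycleEmb_apply he i ⟨0, j.pos⟩ j
  have h2 := cycleEmb_apply he' i ⟨0, j.pos⟩ j
  simp only [zero_add, Nat.mod_eq_of_lt j.2] at h1 h2
  rw [← h1, ← h2, h]

theorem prod_card_le_card_cycleEmb {f : Fin n → Fin n} {A : ι → Finset (Fin n)}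
    (h0 : ∀ i, l i = 0 → (A i).card ≤ 1)
    (h1 : ∀ i, l i ≠ 0 → ∀ x ∈ A i, Function.minimalPeriod f x = l i)
    (h2 : ∀ i j, l i ≠ 0 → l j ≠ 0 → ∀ x ∈ A i, ∀ y ∈ A j, ∀ a b, f^[a] x = f^[b] y → i = j) :
    ∏ i, (A i).card ≤ (cycleEmb f l).card := by
  rw [← Fintype.card_piFinset]
  have hemb : ∀ y ∈ Fintype.piFinset A,
      Function.Injective fun z : Σ i, Fin (l i) => f^[z.2] (y z.1) := by
    intro y hy ⟨i, a⟩ ⟨j, b⟩ hab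
    rw [Fintype.mem_piFinset] at hy
    obtain rfl := h2 i j a.pos.ne' b.pos.ne' _ (hy i) _ (hy j) _ _ hab
    have hp := h1 i a.pos.ne' _ (hy i)
    have := Function.iterate_injOn_Iio_minimalPeriod (f := f) (x := y i)
      (by rw [Set.mem_Iio, hp]; exact a.2) (by rw [Set.mem_Iio, hp]; exact b.2) hab
    exact congrArg _ (Fin.ext this)
  rw [← Finset.card_attach]
  refine Finset.card_le_card_of_injOn (fun y => ⟨_, hemb y.1 y.2⟩) ?_ ?_
  · rintro ⟨y, hy⟩ -
    rw [Fintype.mem_piFinset] at hy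
    rw [Finset.mem_coe, mem_cycleEmb]
    rintro ⟨i, j⟩
    simp only [Function.Embedding.coeFn_mk, blockRotate_apply, val_finRotate]
    have hm := Function.iterate_mod_minimalPeriod_eq (f := f) (x := y i) (n := j + 1)
    rw [h1 i j.pos.ne' _ (hy i)] at hm
    rw [← Function.iterate_succ_apply' f]
    exact hm.symm
  · rintro ⟨y, hy⟩ - ⟨y', hy'⟩ - h
    rw [Fintype.mem_piFinset] at hy hy'
    ext i : 2
    rcases Nat.eq_zero_or_pos (l i) with hi | hi
    · exact Finset.card_le_one.1 (h0 i hi) _ (hy i) _ (hy' i)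
    · exact DFunLike.congr_fun h ⟨i, ⟨0, hi⟩⟩

end CycleEmbeddings

section Cycles

variable {n : ℕ} {f : Fin n → Fin n}

/-- The orbit of `x` under `f`, intersected with the cyclic nodes. -/
def cycleOf (f : Fin n → Fin n) (x : Fin n) : Finset (Fin n) :=
  (cyclicSet f).filter fun y => ∃ m, f^[m] x = y

theorem mem_cyclesOf {c : Finset (Fin n)} :
    c ∈ cyclesOf f ↔ ∃ x ∈ cyclicSet f, cycleOf f x = c := by
  simp only [cyclesOf, Finset.mem_image]; rfl

theorem iterate_mem_cyclicSet {x : Fin n} (hx : x ∈ cyclicSet f) (m : ℕ) :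
    f^[m] x ∈ cyclicSet f := by
  induction m with
  | zero => exact hx
  | succ m ih => rw [Function.iterate_succ_apply']; exact apply_mem_cyclicSet ih

theorem exists_iterate_symm {x : Fin n} (hx : x ∈ cyclicSet f) (m : ℕ) :
    ∃ m', f^[m'] (f^[m] x) = x := by
  have hp := Function.minimalPeriod_pos_of_mem_periodicPts (mem_cyclicSet.1 hx)
  refine ⟨Function.minimalPeriod f x * m - m, ?_⟩
  rw [← Function.iterate_add_apply, Nat.sub_add_cancel (Nat.le_mul_of_pos_left _ hp)]
  exact (Function.isPeriodicPt_minimalPeriod f x).mul_const m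

theorem mem_cycleOf_self {x : Fin n} (hx : x ∈ cyclicSet f) : x ∈ cycleOf f x :=
  Finset.mem_filter.2 ⟨hx, 0, rfl⟩

theorem cycleOf_iterate {x : Fin n} (hx : x ∈ cyclicSet f) (m : ℕ) :
    cycleOf f (f^[m] x) = cycleOf f x := by
  refine Finset.filter_congr fun y _ => ?_
  constructor
  · rintro ⟨a, rfl⟩
    exact ⟨a + m, Function.iterate_add_apply f a m x⟩
  · rintro ⟨a, rfl⟩
    obtain ⟨m', hm'⟩ := exists_iterate_symm hx m
    exact ⟨a + m', by rw [Function.iterate_add_apply, hm']⟩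

theorem cycleOf_eq_of_mem {c : Finset (Fin n)} (hc : c ∈ cyclesOf f) {x : Fin n} (hx : x ∈ c) :
    x ∈ cyclicSet f ∧ cycleOf f x = c := by
  obtain ⟨y, hy, rfl⟩ := mem_cyclesOf.1 hc
  obtain ⟨h1, m, rfl⟩ := Finset.mem_filter.1 hx
  exact ⟨h1, cycleOf_iterate hy m⟩

theorem eq_of_iterate_eq {c c' : Finset (Fin n)} (hc : c ∈ cyclesOf f) (hc' : c' ∈ cyclesOf f)
    {x y : Fin n} (hx : x ∈ c) (hy : y ∈ c') {a b : ℕ} (h : f^[a] x = f^[b] y) : c = c' := by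
  obtain ⟨h1, rfl⟩ := cycleOf_eq_of_mem hc hx
  obtain ⟨h2, rfl⟩ := cycleOf_eq_of_mem hc' hy
  rw [← cycleOf_iterate h1 a, h, cycleOf_iterate h2]

theorem card_cycleOf {x : Fin n} (hx : x ∈ cyclicSet f) :
    (cycleOf f x).card = Function.minimalPeriod f x := by
  have : cycleOf f x = (Finset.range (Function.minimalPeriod f x)).image fun m => f^[m] x := by
    ext y
    simp only [cycleOf, Finset.mem_filter, Finset.mem_image, Finset.mem_range]
    constructor
    · rintro ⟨-, m, rfl⟩
      exact ⟨m % Function.minimalPeriod f x, Nat.mod_lt _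
        (Function.minimalPeriod_pos_of_mem_periodicPts (mem_cyclicSet.1 hx)),
        Function.iterate_mod_minimalPeriod_eq⟩
    · rintro ⟨m, -, rfl⟩
      exact ⟨iterate_mem_cyclicSet hx m, m, rfl⟩
  rw [this, Finset.card_image_of_injOn, Finset.card_range]
  rw [Finset.coe_range]
  exact Function.iterate_injOn_Iio_minimalPeriod

theorem minimalPeriod_of_mem {c : Finset (Fin n)} (hc : c ∈ cyclesOf f) {x : Fin n} (hx : x ∈ c) :
    Function.minimalPeriod f x = c.card := by
  obtain ⟨h1, rfl⟩ := cycleOf_eq_of_mem hc hx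
  exact (card_cycleOf h1).symm

theorem card_pos_of_mem_cyclesOf {c : Finset (Fin n)} (hc : c ∈ cyclesOf f) : 0 < c.card := by
  obtain ⟨x, hx, rfl⟩ := mem_cyclesOf.1 hc
  exact Finset.card_pos.2 ⟨x, mem_cycleOf_self hx⟩

theorem minimalPeriod_dvd_Tmap {x : Fin n} (hx : x ∈ cyclicSet f) :
    Function.minimalPeriod f x ∣ Tmap f := by
  rw [← card_cycleOf hx]
  exact Finset.dvd_lcm (mem_cyclesOf.2 ⟨x, hx, rfl⟩)

theorem Tmap_pos (f : Fin n → Fin n) : 0 < Tmap f := by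
  rw [Nat.pos_iff_ne_zero, Tmap, Ne, Finset.lcm_eq_zero_iff]
  rintro ⟨c, hc, h⟩
  exact (card_pos_of_mem_cyclesOf hc).ne' h

theorem prod_gcd_of_coprime {κ : Type*} (s : Finset κ) (d : κ → ℕ) (v : ℕ)
    (h : ∀ i ∈ s, ∀ j ∈ s, i ≠ j → (d i).Coprime (d j)) :
    ∏ i ∈ s, v.gcd (d i) = v.gcd (∏ i ∈ s, d i) := by
  induction s using Finset.induction_on with
  | empty => simp
  | insert x s hx ih =>
    rw [Finset.prod_insert hx, Finset.prod_insert hx, ih fun i hi j hj =>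
      h i (Finset.mem_insert_of_mem hi) j (Finset.mem_insert_of_mem hj), Nat.Coprime.gcd_mul]
    exact Nat.Coprime.prod_right fun i hi => h x (Finset.mem_insert_self _ _) i
      (Finset.mem_insert_of_mem hi) (ne_of_mem_of_not_mem hi hx).symm

/-- A least common multiple is a product of pairwise coprime divisors. -/
theorem exists_coprime_prod_eq_lcm {κ : Type*} (s : Finset κ) (a : κ → ℕ)
    (ha : ∀ i ∈ s, a i ≠ 0) :
    ∃ d : κ → ℕ, (∀ i ∈ s, d i ∣ a i) ∧
      (∀ i ∈ s, ∀ j ∈ s, i ≠ j → (d i).Coprime (d j)) ∧ ∏ i ∈ s, d i = s.lcm a := by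
  induction s using Finset.induction_on with
  | empty => exact ⟨fun _ => 1, by simp⟩
  | insert x s hx ih =>
    obtain ⟨d, hd, hcop, hprod⟩ := ih fun i hi => ha i (Finset.mem_insert_of_mem hi)
    have hax : a x ≠ 0 := ha x (Finset.mem_insert_self _ _)
    have hL : s.lcm a ≠ 0 := by
      rw [Ne, Finset.lcm_eq_zero_iff]
      rintro ⟨i, hi, h⟩
      exact ha i (Finset.mem_insert_of_mem hi) h
    set u := Nat.factorizationLCMLeft (a x) (s.lcm a) with hu
    set v := Nat.factorizationLCMRight (a x) (s.lcm a) with hv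
    have huv : u.Coprime v := Nat.coprime_factorizationLCMLeft_factorizationLCMRight _ _
    have hmul : u * v = (a x).lcm (s.lcm a) :=
      Nat.factorizationLCMLeft_mul_factorizationLCMRight hax hL
    have hvd : v ∣ ∏ i ∈ s, d i := hprod ▸ Nat.factorizationLCMRight_dvd_right _ _
    have hne : ∀ i ∈ s, i ≠ x := fun i hi => ne_of_mem_of_not_mem hi hx
    have hvprod : ∏ i ∈ s, v.gcd (d i) = v := by
      rw [prod_gcd_of_coprime _ _ _ hcop]
      exact Nat.gcd_eq_left hvd
    refine ⟨fun i => if i = x then u else v.gcd (d i), ?_, ?_, ?_⟩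
    · intro i hi
      rcases Finset.mem_insert.1 hi with rfl | hi
      · simp only [if_true]
        exact Nat.factorizationLCMLeft_dvd_left _ _
      · simp only [hne i hi, if_false]
        exact (Nat.gcd_dvd_right _ _).trans (hd i hi)
    · intro i hi j hj hij
      by_cases hix : i = x
      · have hjx : j ≠ x := fun h => hij (hix.trans h.symm)
        simp only [if_pos hix, if_neg hjx]
        exact huv.coprime_dvd_right (Nat.gcd_dvd_left _ _)
      · have hi' := Finset.mem_of_mem_insert_of_ne hi hix
        by_cases hjx : j = x
        · simp only [if_neg hix, if_pos hjx]
          exact huv.symm.coprime_dvd_left (Nat.gcd_dvd_left _ _)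
        · have hj' := Finset.mem_of_mem_insert_of_ne hj hjx
          simp only [if_neg hix, if_neg hjx]
          exact ((hcop i hi' j hj' hij).coprime_dvd_left (Nat.gcd_dvd_right _ _)).coprime_dvd_right
            (Nat.gcd_dvd_right _ _)
    · rw [Finset.prod_insert hx, Finset.lcm_insert, if_pos rfl]
      rw [Finset.prod_congr rfl fun i hi => if_neg (hne i hi), hvprod, hmul]
      rfl

end Cycles

section UpperBound

variable {n k : ℕ}

/-- Pairs `(d, l)` with `d ∣ l`, `1 ≤ l ≤ n` and `p` the least prime factor of `d`. -/
def divPairs (n p : ℕ) : Finset (ℕ × ℕ) :=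
  (Finset.Icc 1 n ×ˢ Finset.Icc 1 n).filter fun q => q.1.minFac = p ∧ q.1 ∣ q.2

/-- The weight `d / l` of a pair `(d, l)`, with weight `1` when `l = 0`. -/
def pairWeight (q : ℕ × ℕ) : ℝ := if q.2 = 0 then 1 else (q.1 : ℝ) / q.2

theorem pairWeight_nonneg (q : ℕ × ℕ) : 0 ≤ pairWeight q := by
  rw [pairWeight]; split_ifs <;> positivity

theorem Tmap_le_sum {f : Fin n → Fin n} (hn : 0 < n) {P : Finset ℕ}
    (hP : ∀ p, p.Prime → p ≤ n → p ∈ P) :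
    (Tmap f : ℝ) ≤ ∑ q ∈ Fintype.piFinset fun p : P => insert (1, 0) (divPairs n p),
      (∏ p, pairWeight (q p)) * (cycleEmb f fun p => (q p).2).card := by
  obtain ⟨d, hd, hcop, hprod⟩ := exists_coprime_prod_eq_lcm (cyclesOf f) Finset.card
    fun c hc => (card_pos_of_mem_cyclesOf hc).ne'
  have hle : ∀ c ∈ cyclesOf f, d c ≤ n ∧ c.card ≤ n := fun c hc => by
    have : c.card ≤ n := by simpa using Finset.card_le_univ c
    exact ⟨(Nat.le_of_dvd (card_pos_of_mem_cyclesOf hc) (hd c hc)).trans this, this⟩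
  have hdpos : ∀ c ∈ cyclesOf f, 0 < d c := fun c hc =>
    Nat.pos_of_dvd_of_pos (hd c hc) (card_pos_of_mem_cyclesOf hc)
  -- a cycle is selected by the prime `p` when `p` is the least prime factor of its divisor
  let sel : ℕ → Finset (Fin n) → Prop := fun p c => c ∈ cyclesOf f ∧ d c ≠ 1 ∧ (d c).minFac = p
  have hsel : ∀ {p c c'}, sel p c → sel p c' → c = c' := by
    rintro p c c' ⟨h1, h2, h3⟩ ⟨h1', h2', h3'⟩
    by_contra hne
    have hdvd := Nat.dvd_gcd (h3 ▸ Nat.minFac_dvd (d c)) (h3' ▸ Nat.minFac_dvd (d c'))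
    rw [hcop c h1 c' h1' hne, Nat.dvd_one] at hdvd
    exact h2 (Nat.minFac_eq_one_iff.1 (h3.trans hdvd))
  let q : P → ℕ × ℕ := fun p => if h : ∃ c, sel p c then (d h.choose, h.choose.card) else (1, 0)
  let A : P → Finset (Fin n) := fun p => if h : ∃ c, sel p c then h.choose else {⟨0, hn⟩}
  have hq1 : ∀ {p : P} {c}, sel p c → q p = (d c, c.card) ∧ A p = c := by
    intro p c hc
    have hex : ∃ c, sel p c := ⟨c, hc⟩
    have := hsel hex.choose_spec hc
    simp only [q, A, dif_pos hex, this, and_self]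
  have hq0 : ∀ {p : P}, (¬ ∃ c, sel p c) → q p = (1, 0) ∧ A p = {⟨0, hn⟩} := by
    intro p hp
    simp only [q, A, dif_neg hp, and_self]
  clear_value q A
  have hmem : q ∈ Fintype.piFinset fun p : P => insert (1, 0) (divPairs n p) := by
    rw [Fintype.mem_piFinset]
    intro p
    by_cases hp : ∃ c, sel p c
    · obtain ⟨c, hc⟩ := hp
      rw [(hq1 hc).1, Finset.mem_insert, divPairs, Finset.mem_filter, Finset.mem_product,
        Finset.mem_Icc, Finset.mem_Icc]
      exact Or.inr ⟨⟨⟨hdpos c hc.1, (hle c hc.1).1⟩, ⟨card_pos_of_mem_cyclesOf hc.1,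
        (hle c hc.1).2⟩⟩, hc.2.2, hd c hc.1⟩
    · rw [(hq0 hp).1]; exact Finset.mem_insert_self _ _
  have hcard : ∏ p, (A p).card ≤ (cycleEmb f fun p => (q p).2).card := by
    have hcyc : ∀ p, (q p).2 ≠ 0 → ∃ c, sel p c := fun p hp => by
      by_contra h
      exact hp (by rw [(hq0 h).1])
    refine prod_card_le_card_cycleEmb ?_ ?_ ?_
    · intro p hp
      have hp' : ¬ ∃ c, sel p c := by
        rintro ⟨c, hc⟩
        rw [(hq1 hc).1] at hp
        exact (card_pos_of_mem_cyclesOf hc.1).ne' hp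
      rw [(hq0 hp').2, Finset.card_singleton]
    · intro p hp x hx
      obtain ⟨c, hc⟩ := hcyc p hp
      rw [(hq1 hc).2] at hx
      rw [(hq1 hc).1, minimalPeriod_of_mem hc.1 hx]
    · intro p p' hp hp' x hx y hy a b hab
      obtain ⟨c, hc⟩ := hcyc p hp
      obtain ⟨c', hc'⟩ := hcyc p' hp'
      rw [(hq1 hc).2] at hx
      rw [(hq1 hc').2] at hy
      obtain rfl := eq_of_iterate_eq hc.1 hc'.1 hx hy hab
      exact Subtype.ext (hc.2.2.symm.trans hc'.2.2)
  have hw : ∀ p, pairWeight (q p) * (A p).card = (q p).1 := by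
    intro p
    by_cases hp : ∃ c, sel p c
    · obtain ⟨c, hc⟩ := hp
      have h0 := (card_pos_of_mem_cyclesOf hc.1).ne'
      have h0' : (c.card : ℝ) ≠ 0 := by exact_mod_cast h0
      rw [(hq1 hc).1, (hq1 hc).2, pairWeight, if_neg h0]
      exact div_mul_cancel₀ _ h0'
    · rw [(hq0 hp).1, (hq0 hp).2]
      simp [pairWeight]
  have hT : Tmap f = ∏ p, (q p).1 := by
    rw [Tmap, ← hprod]
    have hsel' : ∀ {c} (hc : c ∈ cyclesOf f) (h1 : d c ≠ 1), ∃ p : P, sel p c := fun hc h1 =>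
      ⟨⟨_, hP _ (Nat.minFac_prime h1) ((Nat.minFac_le (hdpos _ hc)).trans (hle _ hc).1)⟩,
        hc, h1, rfl⟩
    refine Finset.prod_bij_ne_one (fun c hc h1 => (hsel' hc h1).choose) ?_ ?_ ?_ ?_
    · intro _ _ _; exact Finset.mem_univ _
    · intro c hc h1 c' hc' h1' h
      have h2 := (hsel' hc h1).choose_spec
      rw [h] at h2
      exact hsel h2 (hsel' hc' h1').choose_spec
    · intro p _ hp
      have hex : ∃ c, sel p c := by
        by_contra h
        exact hp (by rw [(hq0 h).1])
      obtain ⟨c, hc⟩ := hex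
      refine ⟨c, hc.1, hc.2.1, ?_⟩
      exact Subtype.ext ((hsel' hc.1 hc.2.1).choose_spec.2.2.symm.trans hc.2.2)
    · intro c hc h1
      rw [(hq1 (hsel' hc h1).choose_spec).1]
  calc (Tmap f : ℝ) = (∏ p, pairWeight (q p)) * (∏ p, (A p).card : ℕ) := by
        rw [hT, Nat.cast_prod, Nat.cast_prod, ← Finset.prod_mul_distrib]
        exact Finset.prod_congr rfl fun p _ => (hw p).symm
    _ ≤ (∏ p, pairWeight (q p)) * (cycleEmb f fun p => (q p).2).card := by
        gcongr
        exact Finset.prod_nonneg fun p _ => pairWeight_nonneg _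
    _ ≤ _ := Finset.single_le_sum
        (f := fun q : P → ℕ × ℕ =>
          (∏ p, pairWeight (q p)) * ((cycleEmb f fun p => (q p).2).card : ℝ))
        (fun q _ => mul_nonneg (Finset.prod_nonneg fun p _ => pairWeight_nonneg _)
          (Nat.cast_nonneg _)) hmem

theorem zkExp_Tmap_le {r : ℕ} (hk : 0 < k) (hr : 0 < r) (hn : n = k * r) {P : Finset ℕ}
    (hP : ∀ p, p.Prime → p ≤ n → p ∈ P) {t C : ℝ}
    (hC : ∀ L : ℕ, fixRatio n k L ≤ C * Real.exp (-(t * L))) :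
    zkExp n k (fun f => (Tmap f : ℝ)) ≤
      C * ∏ p ∈ P, (1 + ∑ q ∈ divPairs n p, (q.1 : ℝ) / q.2 * Real.exp (-(t * q.2))) := by
  have hn0 : 0 < n := hn ▸ Nat.mul_pos hk hr
  have hc : (0 : ℝ) < (zkMaps n k).card := by exact_mod_cast card_zkMaps_pos hk hn
  rw [zkExp, div_le_iff₀ hc]
  calc ∑ f ∈ zkMaps n k, (Tmap f : ℝ)
      ≤ ∑ f ∈ zkMaps n k, ∑ q ∈ Fintype.piFinset fun p : P => insert (1, 0) (divPairs n p),
        (∏ p, pairWeight (q p)) * (cycleEmb f fun p => (q p).2).card :=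
        Finset.sum_le_sum fun f _ => Tmap_le_sum hn0 hP
    _ = ∑ q ∈ Fintype.piFinset fun p : P => insert (1, 0) (divPairs n p),
        (∏ p, pairWeight (q p)) * ((zkMaps n k).card * fixRatio n k (∑ p, (q p).2)) := by
        rw [Finset.sum_comm]
        refine Finset.sum_congr rfl fun q _ => ?_
        rw [← Finset.mul_sum, sum_card_cycleEmb_eq hk hn]
    _ ≤ ∑ q ∈ Fintype.piFinset fun p : P => insert (1, 0) (divPairs n p),
        (C * (zkMaps n k).card) * ∏ p, (pairWeight (q p) * Real.exp (-(t * (q p).2))) := by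
        refine Finset.sum_le_sum fun q _ => ?_
        rw [Finset.prod_mul_distrib, ← Real.exp_sum, Finset.sum_neg_distrib, ← Finset.mul_sum]
        have h1 := hC (∑ p, (q p).2)
        have h2 : 0 ≤ ∏ p, pairWeight (q p) := Finset.prod_nonneg fun p _ => pairWeight_nonneg _
        push_cast at h1
        calc _ ≤ (∏ p, pairWeight (q p)) * ((zkMaps n k).card *
              (C * Real.exp (-(t * ∑ p, ((q p).2 : ℝ))))) := by gcongr
          _ = _ := by ring
    _ = _ := by
        rw [← Finset.mul_sum, ← Finset.prod_univ_sum (fun p : P => insert (1, 0) (divPairs n p))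
          (fun _ x => pairWeight x * Real.exp (-(t * x.2))),
          Finset.prod_coe_sort P (fun p => ∑ x ∈ insert (1, 0) (divPairs n p),
            pairWeight x * Real.exp (-(t * x.2))), mul_right_comm]
        congr 2
        refine Finset.prod_congr rfl fun p _ => ?_
        rw [Finset.sum_insert (by simp [divPairs])]
        congr 1
        · simp [pairWeight]
        · refine Finset.sum_congr rfl fun x hx => ?_
          have : x.2 ≠ 0 := by
            have := (Finset.mem_Icc.1 (Finset.mem_product.1 (Finset.mem_filter.1 hx).1).2).1
            omega
          rw [pairWeight, if_neg this]

end UpperBound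

section LowerBound

variable {n k : ℕ}

theorem mem_cycleEmbExact {ι : Type*} [Fintype ι] {l : ι → ℕ} {f : Fin n → Fin n}
    {e : (Σ i, Fin (l i)) ↪ Fin n} :
    e ∈ cycleEmbExact f l ↔ e ∈ cycleEmb f l ∧ cyclicSet f = Finset.univ.map e := by
  simp [cycleEmbExact]

theorem card_cycleEmbExact_le {ι : Type*} [Fintype ι] {l : ι → ℕ} (hn : 0 < n)
    (hl : ∀ i j, l i ≠ 0 → l i = l j → i = j) (f : Fin n → Fin n) :
    (cycleEmbExact f l).card ≤ ∏ i, if l i = 0 then 1 else l i := by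
  rcases Finset.eq_empty_or_nonempty (cycleEmbExact f l) with h | ⟨e₀, he₀⟩
  · simp [h]
  rw [mem_cycleEmbExact] at he₀
  let B : ι → Finset (Fin n) := fun i =>
    if l i = 0 then {⟨0, hn⟩} else Finset.univ.image fun a : Fin (l i) => e₀ ⟨i, a⟩
  have hB : ∏ i, (B i).card ≤ ∏ i, if l i = 0 then 1 else l i := by
    refine Finset.prod_le_prod' fun i _ => ?_
    simp only [B]
    split_ifs
    · simp
    · exact Finset.card_image_le.trans (by simp)
  refine le_trans ?_ hB
  rw [← Fintype.card_piFinset]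
  refine Finset.card_le_card_of_injOn
    (fun e i => if h : 0 < l i then e ⟨i, ⟨0, h⟩⟩ else ⟨0, hn⟩) ?_ ?_
  · intro e he
    rw [Finset.mem_coe, mem_cycleEmbExact] at he
    rw [Finset.mem_coe, Fintype.mem_piFinset]
    intro i
    simp only [B]
    rcases Nat.eq_zero_or_pos (l i) with h | h
    · simp [h]
    · rw [dif_pos h, if_neg h.ne', Finset.mem_image]
      have h1 : e ⟨i, ⟨0, h⟩⟩ ∈ cyclicSet f := by rw [he.2]; simp
      rw [he₀.2, Finset.mem_map] at h1
      obtain ⟨⟨i', a⟩, -, ha⟩ := h1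
      have h2 := minimalPeriod_cycleEmb he₀.1 ⟨i', a⟩
      rw [ha, minimalPeriod_cycleEmb he.1] at h2
      obtain rfl := hl _ _ h.ne' h2
      exact ⟨a, Finset.mem_univ _, ha⟩
  · intro e he e' he' hee
    rw [Finset.mem_coe, mem_cycleEmbExact] at he he'
    refine cycleEmb_ext he.1 he'.1 fun i hi => ?_
    have := congrFun hee i
    simpa only [dif_pos hi] using this

theorem eq_of_mul_prime_eq {p p' j j' : ℕ} (hp : p.Prime) (hp' : p'.Prime) (hj0 : j ≠ 0)
    (hj : j < p) (hj' : j' < p') (h : j * p = j' * p') : p = p' := by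
  have hj0' : j' ≠ 0 := by
    rintro rfl
    rw [zero_mul] at h
    exact (Nat.mul_ne_zero hj0 hp.ne_zero) h
  by_contra hne
  have h1 : p ∣ j' := by
    have : p ∣ j' * p' := h ▸ Dvd.intro_left _ rfl
    exact (hp.dvd_mul.1 this).resolve_right fun h => hne ((Nat.prime_dvd_prime_iff_eq hp hp').1 h)
  have h2 : p' ∣ j := by
    have : p' ∣ j * p := h ▸ Dvd.intro_left _ rfl
    exact (hp'.dvd_mul.1 this).resolve_right fun h =>
      hne ((Nat.prime_dvd_prime_iff_eq hp' hp).1 h).symm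
  have h3 := Nat.le_of_dvd (Nat.pos_of_ne_zero hj0') h1
  have h4 := Nat.le_of_dvd (Nat.pos_of_ne_zero hj0) h2
  omega

/-- The weight `1 / j`, with weight `1` when `j = 0`. -/
def invWeight (j : ℕ) : ℝ := if j = 0 then 1 else (j : ℝ)⁻¹

theorem invWeight_nonneg (j : ℕ) : 0 ≤ invWeight j := by
  rw [invWeight]; split_ifs <;> positivity

theorem le_Tmap {f : Fin n → Fin n} (hn : 0 < n) {P : Finset ℕ} (hP : ∀ p ∈ P, p.Prime) :
    ∑ j ∈ Fintype.piFinset fun p : P => Finset.range p,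
      (∏ p, invWeight (j p)) * (cycleEmbExact f fun p => j p * p).card ≤ (Tmap f : ℝ) := by
  have hkey : ∀ j ∈ Fintype.piFinset fun p : P => Finset.range p,
      ∀ j' ∈ Fintype.piFinset fun p : P => Finset.range p,
      ∀ e ∈ cycleEmbExact f fun p => j p * p, ∀ e' ∈ cycleEmbExact f fun p => j' p * p,
      ∀ p, j p ≠ 0 → j' p = j p := by
    intro j hj j' hj' e he e' he' p hp
    simp only [Fintype.mem_piFinset, Finset.mem_range] at hj hj'
    rw [mem_cycleEmbExact] at he he'
    have hpp := hP p p.2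
    have h0 : 0 < j p * p := Nat.mul_pos (Nat.pos_of_ne_zero hp) hpp.pos
    have h1 : e ⟨p, ⟨0, h0⟩⟩ ∈ cyclicSet f := by rw [he.2]; simp
    rw [he'.2, Finset.mem_map] at h1
    obtain ⟨⟨p', a⟩, -, ha⟩ := h1
    have h2 := minimalPeriod_cycleEmb he'.1 ⟨p', a⟩
    rw [ha, minimalPeriod_cycleEmb he.1] at h2
    obtain rfl := Subtype.ext
      (eq_of_mul_prime_eq hpp (hP p' p'.2) hp (hj p) (hj' p') h2)
    exact (Nat.eq_of_mul_eq_mul_right hpp.pos h2).symm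
  by_cases hex : ∃ j ∈ Fintype.piFinset fun p : P => Finset.range p,
      (cycleEmbExact f fun p => j p * p).Nonempty
  swap
  · rw [Finset.sum_eq_zero]
    · exact Nat.cast_nonneg _
    · intro j hj
      have : (cycleEmbExact f fun p => j p * p) = ∅ :=
        Finset.not_nonempty_iff_eq_empty.1 fun h => hex ⟨j, hj, h⟩
      simp [this]
  obtain ⟨j, hj, e, he⟩ := hex
  rw [Finset.sum_eq_single_of_mem j hj]
  swap
  · intro j' hj' hne
    have : (cycleEmbExact f fun p => j' p * p) = ∅ := by
      refine Finset.not_nonempty_iff_eq_empty.1 ?_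
      rintro ⟨e', he'⟩
      refine hne (funext fun p => ?_)
      by_cases hp : j p = 0
      · by_contra hp'
        exact hp' (hkey j' hj' j hj e' he' e he p (fun h => hp' (h.trans hp.symm))).symm
      · exact hkey j hj j' hj' e he e' he' p hp
    simp [this]
  have hj2 := hj
  simp only [Fintype.mem_piFinset, Finset.mem_range] at hj2
  have hcard := card_cycleEmbExact_le (l := fun p : P => j p * p) hn (fun p p' hp hpp => by
    refine Subtype.ext (eq_of_mul_prime_eq (hP p p.2) (hP p' p'.2) ?_ (hj2 p) (hj2 p') hpp)
    exact left_ne_zero_of_mul hp) f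
  have hdvd : ∏ p : P, (if j p = 0 then 1 else (p : ℕ)) ∣ Tmap f := by
    refine Finset.prod_dvd_of_isRelPrime ?_ fun p _ => ?_
    · intro p _ p' _ hne
      rw [Function.onFun, ← Nat.coprime_iff_isRelPrime]
      have := (Nat.coprime_primes (hP p p.2) (hP p' p'.2)).2 fun h => hne (Subtype.ext h)
      split_ifs <;> first | exact this | simp
    · split_ifs with hp
      · exact one_dvd _
      · rw [mem_cycleEmbExact] at he
        have h0 : 0 < j p * p := Nat.mul_pos (Nat.pos_of_ne_zero hp) (hP p p.2).pos
        have h1 : e ⟨p, ⟨0, h0⟩⟩ ∈ cyclicSet f := by rw [he.2]; simp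
        have h2 := minimalPeriod_dvd_Tmap h1
        rw [minimalPeriod_cycleEmb he.1] at h2
        exact (Dvd.intro_left _ rfl).trans h2
  calc (∏ p, invWeight (j p)) * ((cycleEmbExact f fun p => j p * p).card : ℝ)
      ≤ (∏ p, invWeight (j p)) * ((∏ p : P, if j p * p = 0 then 1 else j p * p : ℕ) : ℝ) := by
        gcongr
        exact Finset.prod_nonneg fun p _ => invWeight_nonneg _
    _ = ((∏ p : P, (if j p = 0 then 1 else (p : ℕ)) : ℕ) : ℝ) := by
        rw [Nat.cast_prod, Nat.cast_prod, ← Finset.prod_mul_distrib]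
        refine Finset.prod_congr rfl fun p _ => ?_
        have hpp := (hP p p.2).ne_zero
        by_cases hp : j p = 0
        · simp [hp, invWeight]
        · have : (j p : ℝ) ≠ 0 := by exact_mod_cast hp
          simp [hp, hpp, invWeight]
    _ ≤ Tmap f := by exact_mod_cast Nat.le_of_dvd (Tmap_pos f) hdvd

theorem le_zkExp_Tmap {r : ℕ} (hk : 2 ≤ k) (hr : 0 < r) (hn : n = k * r) {P : Finset ℕ}
    (hP : ∀ p ∈ P, p.Prime) :
    ∑ j ∈ Fintype.piFinset fun p : P => Finset.range p, (∏ p, invWeight (j p)) *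
      (fixRatio n k (∑ p, j p * p) * (((k : ℝ) - 1) * (∑ p, j p * p : ℕ) / n)) ≤
      zkExp n k (fun f => (Tmap f : ℝ)) := by
  have hk0 : 0 < k := by omega
  have hn0 : 0 < n := hn ▸ Nat.mul_pos hk0 hr
  have hc : (0 : ℝ) < (zkMaps n k).card := by exact_mod_cast card_zkMaps_pos hk0 hn
  rw [zkExp, le_div_iff₀ hc]
  calc _ = ∑ j ∈ Fintype.piFinset fun p : P => Finset.range p, (∏ p, invWeight (j p)) *
        ((zkMaps n k).card * (fixRatio n k (∑ p, j p * p) *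
          (((k : ℝ) - 1) * (∑ p, j p * p : ℕ) / n))) := by
        rw [Finset.sum_mul]
        exact Finset.sum_congr rfl fun j _ => by ring
    _ ≤ ∑ j ∈ Fintype.piFinset fun p : P => Finset.range p, (∏ p, invWeight (j p)) *
        ∑ f ∈ zkMaps n k, ((cycleEmbExact f fun p => j p * p).card : ℝ) := by
        refine Finset.sum_le_sum fun j _ => mul_le_mul_of_nonneg_left
          (le_sum_card_cycleEmbExact hk hr hn) (Finset.prod_nonneg fun p _ => invWeight_nonneg _)
    _ = ∑ f ∈ zkMaps n k, ∑ j ∈ Fintype.piFinset fun p : P => Finset.range p,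
        (∏ p, invWeight (j p)) * ((cycleEmbExact f fun p => j p * p).card : ℝ) := by
        rw [Finset.sum_comm]
        exact Finset.sum_congr rfl fun j _ => by rw [Finset.mul_sum]
    _ ≤ _ := Finset.sum_le_sum fun f _ => le_Tmap hn0 hP

end LowerBound

section FixRatio

variable {n k r : ℕ}

theorem sum_range_cast_id (L : ℕ) : ∑ i ∈ range L, (i : ℝ) = L * (L - 1) / 2 := by
  induction L with
  | zero => simp
  | succ L ih => rw [Finset.sum_range_succ, ih]; push_cast; ring

theorem fixRatio_le_exp (hk : 2 ≤ k) (hr : 0 < r) (hn : n = k * r) (L : ℕ) :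
    fixRatio n k L ≤ Real.exp (-((k - 1) / n * (L * (L - 1) / 2))) := by
  rcases lt_or_ge r L with h | h
  · rw [fixRatio_eq_zero hn h]; exact (Real.exp_pos _).le
  rw [← sum_range_cast_id, Finset.mul_sum, ← Finset.sum_neg_distrib, Real.exp_sum]
  have hk' : (2 : ℝ) ≤ k := by exact_mod_cast hk
  have hr' : (0 : ℝ) < r := by exact_mod_cast hr
  have hn' : (n : ℝ) = k * r := by exact_mod_cast hn
  refine Finset.prod_le_prod (fun i hi => ?_) fun i hi => ?_
  all_goals
    have hi' : i + 1 ≤ r := (Finset.mem_range.1 hi).trans_le h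
    have hi'' : (i : ℝ) + 1 ≤ r := by exact_mod_cast hi'
    have hi0 : (0 : ℝ) ≤ i := Nat.cast_nonneg i
    have h1 : (0 : ℝ) < n - k * i := by rw [hn']; nlinarith
    have h2 : (0 : ℝ) < (n : ℝ) - i := by nlinarith
  · exact div_nonneg h1.le h2.le
  · have hn0 : (0 : ℝ) < n := by linarith
    have h3 : ((n : ℝ) - k * i) / (n - i) ≤ -((k - 1) / n * i) + 1 := by
      rw [div_le_iff₀ h2]
      have : (-(((k : ℝ) - 1) / n * i) + 1) * (n - i) =
          n - k * i + (k - 1) * i ^ 2 / n := by field_simp; ring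
      rw [this]
      have : 0 ≤ ((k : ℝ) - 1) * i ^ 2 / n :=
        div_nonneg (mul_nonneg (by linarith) (sq_nonneg _)) hn0.le
      linarith
    exact h3.trans (Real.add_one_le_exp _)

theorem fixRatio_le_exp_linear (hk : 2 ≤ k) (hr : 0 < r) (hn : n = k * r) {N : ℝ}
    (hN : N = n / (k - 1)) (t : ℝ) (L : ℕ) :
    fixRatio n k L ≤ Real.exp (N * (t + 1 / (2 * N)) ^ 2 / 2) * Real.exp (-(t * L)) := by
  refine (fixRatio_le_exp hk hr hn L).trans ?_
  rw [← Real.exp_add]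
  have hk' : (2 : ℝ) ≤ k := by exact_mod_cast hk
  have hn0 : (0 : ℝ) < n := by rw [hn]; push_cast; positivity
  have hk1 : (0 : ℝ) < (k : ℝ) - 1 := by linarith
  have hN0 : 0 < N := hN ▸ div_pos hn0 hk1
  have h1 : ((k : ℝ) - 1) / n = 1 / N := by rw [hN, one_div_div]
  rw [h1]
  refine Real.exp_le_exp.2 ?_
  have h2 : N * (t + 1 / (2 * N)) ^ 2 / 2 + -(t * L) - -(1 / N * (L * (L - 1) / 2)) =
      (N * (t + 1 / (2 * N)) - L) ^ 2 / (2 * N) := by field_simp; ring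
  have h3 : 0 ≤ (N * (t + 1 / (2 * N)) - L) ^ 2 / (2 * N) := by positivity
  linarith

theorem exp_le_fixRatio (hk : 2 ≤ k) (hr : 0 < r) (hn : n = k * r) {N η : ℝ}
    (hN : N = n / (k - 1)) (hη0 : 0 ≤ η) (hη : η < 1) {L : ℕ} (hL : (L : ℝ) ≤ η / 2 * N) :
    Real.exp (-((L : ℝ) ^ 2 / (2 * N * (1 - η)))) ≤ fixRatio n k L := by
  have hk' : (2 : ℝ) ≤ k := by exact_mod_cast hk
  have hr' : (0 : ℝ) < r := by exact_mod_cast hr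
  have hn' : (n : ℝ) = k * r := by exact_mod_cast hn
  have hn0 : (0 : ℝ) < n := by rw [hn']; positivity
  have hk1 : (0 : ℝ) < (k : ℝ) - 1 := by linarith
  have hN0 : 0 < N := hN ▸ div_pos hn0 hk1
  have hnN : (n : ℝ) = (k - 1) * N := by rw [hN]; field_simp
  have hNr : N ≤ 2 * r := by
    rw [hN, div_le_iff₀ hk1, hn']; nlinarith
  have hLr : (L : ℝ) ≤ η * r := by nlinarith
  have h1 : Real.exp (-((L : ℝ) ^ 2 / (2 * N * (1 - η)))) ≤
      Real.exp (∑ i ∈ range L, -(i / (N * (1 - η)))) := by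
    rw [Finset.sum_neg_distrib, ← Finset.sum_div, sum_range_cast_id]
    refine Real.exp_le_exp.2 (neg_le_neg ?_)
    have : 0 < N * (1 - η) := mul_pos hN0 (by linarith)
    rw [div_le_div_iff₀ this (by nlinarith)]
    have hL0 : (0 : ℝ) ≤ L := Nat.cast_nonneg L
    nlinarith [mul_nonneg hL0 this.le]
  refine h1.trans ?_
  rw [Real.exp_sum]
  refine Finset.prod_le_prod (fun i _ => (Real.exp_pos _).le) fun i hi => ?_
  have hiL : (i : ℝ) ≤ L := by exact_mod_cast (Finset.mem_range.1 hi).le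
  have hi0 : (0 : ℝ) ≤ i := Nat.cast_nonneg i
  have hA : (n : ℝ) * (1 - η) ≤ n - k * i := by
    have : (k : ℝ) * i ≤ k * (η * r) := by gcongr; linarith
    rw [hn']; linarith
  have hA0 : 0 < (n : ℝ) * (1 - η) := mul_pos hn0 (by linarith)
  have hA1 : 0 < (n : ℝ) - k * i := hA0.trans_le hA
  have hB : 0 < (n : ℝ) - i := by nlinarith
  have h2 : Real.exp (-(i / (N * (1 - η)))) ≤ Real.exp (-((k - 1) * i / (n - k * i))) := by
    refine Real.exp_le_exp.2 (neg_le_neg ?_)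
    rw [div_le_div_iff₀ hA1 (mul_pos hN0 (by linarith))]
    have : ((k : ℝ) - 1) * i * (N * (1 - η)) = i * (n * (1 - η)) := by rw [hnN]; ring
    rw [this]
    gcongr
  refine h2.trans ?_
  rw [Real.exp_neg, inv_le_comm₀ (Real.exp_pos _) (div_pos hA1 hB), inv_div]
  have h3 : ((n : ℝ) - i) / (n - k * i) = (k - 1) * i / (n - k * i) + 1 := by
    rw [div_add_one hA1.ne']; ring
  rw [h3]
  exact Real.add_one_le_exp _

end FixRatio

section PrimeProducts

theorem hasSum_ell {u : ℝ} (hu : 0 < u) :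
    HasSum (fun i : ℕ => Real.exp (-(u * ((i : ℝ) + 1))) / ((i : ℝ) + 1)) (ell u) := by
  have h1 : |Real.exp (-u)| < 1 := by
    rw [abs_of_pos (Real.exp_pos _), Real.exp_lt_one_iff]; linarith
  have := Real.hasSum_pow_div_log_of_abs_lt_one h1
  refine this.congr_fun fun i => ?_
  rw [← Real.exp_nat_mul]
  push_cast
  congr 2
  ring

theorem sum_Ico_exp_div_le_ell {u : ℝ} (hu : 0 < u) (m : ℕ) :
    ∑ i ∈ Finset.Ico 1 m, Real.exp (-(u * (i : ℝ))) / (i : ℝ) ≤ ell u := by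
  have h := hasSum_ell hu
  rw [← h.tsum_eq, Finset.sum_Ico_eq_sum_range]
  refine le_trans (le_of_eq ?_) (h.summable.sum_le_tsum (Finset.range (m - 1))
    fun i _ => by positivity)
  refine Finset.sum_congr rfl fun i _ => ?_
  push_cast
  rw [add_comm (1 : ℝ)]

theorem sum_Ico_inv_sq_le {p m : ℕ} (hp : 1 ≤ p) :
    ∑ i ∈ Finset.Ico p m, ((i : ℝ) ^ 2)⁻¹ ≤ 2 / p := by
  have h : Finset.Ico p m = Finset.Ioo (p - 1) m := by ext; simp; omega
  have h2 := sum_Ioo_inv_sq_le (α := ℝ) (p - 1) m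
  rw [Nat.cast_sub hp, Nat.cast_one, sub_add_cancel] at h2
  rwa [h]

theorem exp_neg_le_two_div_sq {u : ℝ} (hu : 0 < u) : Real.exp (-u) ≤ 2 / u ^ 2 := by
  rw [Real.exp_neg, inv_le_comm₀ (Real.exp_pos _) (by positivity), inv_div]
  have := Real.quadratic_le_exp_of_nonneg hu.le
  linarith

theorem ell_le_sum_Ico_add {t : ℝ} (ht : 0 < t) {p : ℕ} (hp : 1 ≤ p) :
    ell (p * t) ≤ ∑ i ∈ Finset.Ico 1 p, Real.exp (-(p * t * (i : ℝ))) / (i : ℝ) +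
      4 / (t ^ 2 * (p : ℝ) ^ 3) := by
  have hp0 : (0 : ℝ) < p := by exact_mod_cast hp
  have hu : 0 < p * t := by positivity
  refine le_of_tendsto (hasSum_ell hu).tendsto_sum_nat ?_
  filter_upwards [Filter.eventually_ge_atTop p] with m hm
  have h1 : ∑ i ∈ Finset.range m, Real.exp (-(p * t * ((i : ℝ) + 1))) / ((i : ℝ) + 1) =
      ∑ i ∈ Finset.Ico 1 (m + 1), Real.exp (-(p * t * (i : ℝ))) / (i : ℝ) := by
    rw [Finset.sum_Ico_eq_sum_range, Nat.add_sub_cancel]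
    refine Finset.sum_congr rfl fun i _ => ?_
    push_cast
    rw [add_comm (1 : ℝ)]
  rw [h1, ← Finset.sum_Ico_consecutive _ hp (show p ≤ m + 1 by omega)]
  gcongr
  calc ∑ i ∈ Finset.Ico p (m + 1), Real.exp (-(p * t * (i : ℝ))) / (i : ℝ)
      ≤ ∑ i ∈ Finset.Ico p (m + 1), 2 / (p * t) ^ 2 * ((i : ℝ) ^ 2)⁻¹ := by
        refine Finset.sum_le_sum fun i hi => ?_
        have hi1 : (1 : ℝ) ≤ i := by exact_mod_cast hp.trans (Finset.mem_Ico.1 hi).1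
        have h2 := exp_neg_le_two_div_sq (u := p * t * (i : ℝ)) (by positivity)
        calc _ ≤ Real.exp (-(p * t * (i : ℝ))) := div_le_self (Real.exp_pos _).le hi1
          _ ≤ _ := h2
          _ = _ := by rw [mul_pow]; field_simp
    _ = 2 / (p * t) ^ 2 * ∑ i ∈ Finset.Ico p (m + 1), ((i : ℝ) ^ 2)⁻¹ := by rw [Finset.mul_sum]
    _ ≤ 2 / (p * t) ^ 2 * (2 / p) := by
        gcongr
        exact sum_Ico_inv_sq_le hp
    _ = 4 / (t ^ 2 * (p : ℝ) ^ 3) := by field_simp; ring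

theorem sum_divPairs_le {t : ℝ} (ht : 0 < t) {n p : ℕ} (hp : p.Prime) :
    ∑ q ∈ divPairs n p, (q.1 : ℝ) / q.2 * Real.exp (-(t * q.2)) ≤
      ell (p * t) + 4 / (t ^ 2 * (p : ℝ) ^ 3) := by
  have hp0 : (0 : ℝ) < p := by exact_mod_cast hp.pos
  -- parametrize `d = p * m` and `l = d * i`
  have h1 : divPairs n p ⊆ ((insert 1 (Finset.Ico p (n + 1))) ×ˢ Finset.Ico 1 (n + 1)).image
      fun x : ℕ × ℕ => (p * x.1, p * x.1 * x.2) := by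
    rintro ⟨d, l⟩ hq
    simp only [divPairs, Finset.mem_filter, Finset.mem_product, Finset.mem_Icc] at hq
    obtain ⟨⟨⟨hd1, hdn⟩, hl1, hln⟩, hmin, i, rfl⟩ := hq
    obtain ⟨m, rfl⟩ : p ∣ d := hmin ▸ Nat.minFac_dvd d
    have hm0 : 0 < m := Nat.pos_of_mul_pos_left hd1
    have hi0 : 0 < i := Nat.pos_of_mul_pos_left hl1
    refine Finset.mem_image.2 ⟨(m, i), ?_, rfl⟩
    simp only [Finset.mem_product, Finset.mem_insert, Finset.mem_Ico]
    refine ⟨?_, hi0, ?_⟩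
    · by_cases hm : m = 1
      · exact Or.inl hm
      · refine Or.inr ⟨?_, ?_⟩
        · have h2 : (p * m).minFac ≤ m.minFac :=
            Nat.minFac_le_of_dvd (Nat.minFac_prime hm).two_le
              ((Nat.minFac_dvd m).trans (Dvd.intro_left _ rfl))
          rw [hmin] at h2
          exact h2.trans (Nat.minFac_le hm0)
        · exact Nat.lt_succ_of_le ((Nat.le_mul_of_pos_left _ hp.pos).trans hdn)
    · exact Nat.lt_succ_of_le ((Nat.le_mul_of_pos_left _ hd1).trans hln)
  have h2 : ∀ m ∈ insert 1 (Finset.Ico p (n + 1)), 0 < m := by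
    intro m hm
    rcases Finset.mem_insert.1 hm with rfl | hm
    · exact one_pos
    · exact hp.pos.trans_le (Finset.mem_Ico.1 hm).1
  calc ∑ q ∈ divPairs n p, (q.1 : ℝ) / q.2 * Real.exp (-(t * q.2))
      ≤ ∑ q ∈ ((insert 1 (Finset.Ico p (n + 1))) ×ˢ Finset.Ico 1 (n + 1)).image
          (fun x : ℕ × ℕ => (p * x.1, p * x.1 * x.2)), (q.1 : ℝ) / q.2 * Real.exp (-(t * q.2)) :=
        Finset.sum_le_sum_of_subset_of_nonneg h1 fun q _ _ => by positivity
    _ ≤ ∑ x ∈ (insert 1 (Finset.Ico p (n + 1))) ×ˢ Finset.Ico 1 (n + 1),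
          ((p * x.1 : ℕ) : ℝ) / (p * x.1 * x.2 : ℕ) * Real.exp (-(t * (p * x.1 * x.2 : ℕ))) :=
        Finset.sum_image_le_of_nonneg fun _ _ => by positivity
    _ = ∑ m ∈ insert 1 (Finset.Ico p (n + 1)), ∑ i ∈ Finset.Ico 1 (n + 1),
          Real.exp (-(p * m * t * (i : ℝ))) / (i : ℝ) := by
        rw [Finset.sum_product]
        refine Finset.sum_congr rfl fun m hm => Finset.sum_congr rfl fun i hi => ?_
        have hm0 : (m : ℝ) ≠ 0 := by exact_mod_cast (h2 m hm).ne'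
        have hi0 : (i : ℝ) ≠ 0 := by
          exact_mod_cast (Nat.one_le_iff_ne_zero.1 (Finset.mem_Ico.1 hi).1)
        push_cast
        rw [show t * ((p : ℝ) * m * i) = p * m * t * i by ring]
        field_simp
    _ ≤ ∑ m ∈ insert 1 (Finset.Ico p (n + 1)), ell (p * m * t) := by
        refine Finset.sum_le_sum fun m hm => sum_Ico_exp_div_le_ell ?_ _
        have hm0 : (0 : ℝ) < m := by exact_mod_cast h2 m hm
        positivity
    _ = ell (p * t) + ∑ m ∈ Finset.Ico p (n + 1), ell (p * m * t) := by
        rw [Finset.sum_insert (by simp only [Finset.mem_Ico]; have := hp.two_le; omega)]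
        simp
    _ ≤ ell (p * t) + ∑ m ∈ Finset.Ico p (n + 1), 2 / (p * t) ^ 2 * ((m : ℝ) ^ 2)⁻¹ := by
        gcongr with m hm
        have hm0 : (0 : ℝ) < m := by exact_mod_cast hp.pos.trans_le (Finset.mem_Ico.1 hm).1
        refine (ell_le_two_div_sq (by positivity)).trans_eq ?_
        field_simp
    _ ≤ ell (p * t) + 2 / (p * t) ^ 2 * (2 / p) := by
        rw [← Finset.mul_sum]
        gcongr
        exact sum_Ico_inv_sq_le hp.one_lt.le
    _ = _ := by congr 1; field_simp; ring

theorem log_one_add_le_rpow {y : ℝ} (hy : 0 ≤ y) :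
    Real.log (1 + y) ≤ 7 / 2 * y ^ ((2 : ℝ) / 5) := by
  rcases le_or_gt y 1 with h | h
  · have h1 := Real.log_le_sub_one_of_pos (show 0 < 1 + y by linarith)
    have h2 : y ^ (1 : ℝ) ≤ y ^ ((2 : ℝ) / 5) :=
      Real.rpow_le_rpow_of_exponent_ge' hy h (by norm_num) (by norm_num)
    rw [Real.rpow_one] at h2
    linarith
  · have h1 : Real.log (1 + y) ≤ Real.log 2 + Real.log y := by
      rw [← Real.log_mul (by norm_num) (by linarith)]
      exact Real.log_le_log (by linarith) (by linarith)
    have h2 := Real.log_le_rpow_div hy (show (0 : ℝ) < 2 / 5 by norm_num)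
    have h3 : 1 ≤ y ^ ((2 : ℝ) / 5) := Real.one_le_rpow h.le (by norm_num)
    have h4 := Real.log_two_lt_d9
    linarith

/-- The constant in the bound for the contribution of the error terms. -/
def errConst : ℝ := 7 / 2 * 4 ^ ((2 : ℝ) / 5) * ∑' p : ℕ, (p : ℝ) ^ (-(6 : ℝ) / 5)

theorem sum_log_one_add_le {t : ℝ} (ht : 0 < t) {P : Finset ℕ} (hP : ∀ p ∈ P, p.Prime) :
    ∑ p ∈ P, Real.log (1 + 4 / (t ^ 2 * (p : ℝ) ^ 3)) ≤ errConst * t ^ (-(4 : ℝ) / 5) := by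
  have hs : Summable fun p : ℕ => (p : ℝ) ^ (-(6 : ℝ) / 5) :=
    Real.summable_nat_rpow.2 (by norm_num)
  calc ∑ p ∈ P, Real.log (1 + 4 / (t ^ 2 * (p : ℝ) ^ 3))
      ≤ ∑ p ∈ P, 7 / 2 * 4 ^ ((2 : ℝ) / 5) * t ^ (-(4 : ℝ) / 5) * (p : ℝ) ^ (-(6 : ℝ) / 5) := by
        refine Finset.sum_le_sum fun p hp => ?_
        have hp0 : (0 : ℝ) < p := by exact_mod_cast (hP p hp).pos
        refine (log_one_add_le_rpow (by positivity)).trans_eq ?_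
        rw [Real.div_rpow (by norm_num) (by positivity), Real.mul_rpow (by positivity)
          (by positivity), ← Real.rpow_natCast, ← Real.rpow_natCast, ← Real.rpow_mul ht.le,
          ← Real.rpow_mul hp0.le, neg_div, neg_div, Real.rpow_neg ht.le, Real.rpow_neg hp0.le]
        norm_num
        field_simp
    _ = 7 / 2 * 4 ^ ((2 : ℝ) / 5) * t ^ (-(4 : ℝ) / 5) * ∑ p ∈ P, (p : ℝ) ^ (-(6 : ℝ) / 5) := by
        rw [Finset.mul_sum]
    _ ≤ 7 / 2 * 4 ^ ((2 : ℝ) / 5) * t ^ (-(4 : ℝ) / 5) * ∑' p : ℕ, (p : ℝ) ^ (-(6 : ℝ) / 5) := by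
        gcongr
        exact hs.sum_le_tsum _ fun p _ => by positivity
    _ = _ := by rw [errConst]; ring

theorem sum_phi_le_primeSum {t : ℝ} (ht : 0 < t) (ht1 : t < 1) {P : Finset ℕ}
    (hP : ∀ p ∈ P, p.Prime) : ∑ p ∈ P, phi (p * t) ≤ primeSum t := by
  have h := Summable.sum_le_tsum (f := fun p : Nat.Primes => phi (p * t))
    (show Finset Nat.Primes from P.subtype Nat.Prime) (fun p _ => phi_prime_nonneg ht p)
    (summable_phi ht ht1)
  refine le_trans (le_of_eq ?_) h
  exact (Finset.sum_subtype_of_mem (fun p : ℕ => phi (p * t)) hP).symm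

theorem log_prod_divPairs_le {t : ℝ} (ht : 0 < t) (ht1 : t < 1) {P : Finset ℕ}
    (hP : ∀ p ∈ P, p.Prime) (n : ℕ) :
    ∏ p ∈ P, (1 + ∑ q ∈ divPairs n p, (q.1 : ℝ) / q.2 * Real.exp (-(t * q.2))) ≤
      Real.exp (primeSum t + errConst * t ^ (-(4 : ℝ) / 5)) := by
  calc ∏ p ∈ P, (1 + ∑ q ∈ divPairs n p, (q.1 : ℝ) / q.2 * Real.exp (-(t * q.2)))
      ≤ ∏ p ∈ P, Real.exp (phi (p * t) + Real.log (1 + 4 / (t ^ 2 * (p : ℝ) ^ 3))) := by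
        refine Finset.prod_le_prod (fun p _ => by positivity) fun p hp => ?_
        have hp0 : (0 : ℝ) < p := by exact_mod_cast (hP p hp).pos
        have hu : 0 < p * t := by positivity
        have he := ell_pos hu
        have h4 : 0 < 4 / (t ^ 2 * (p : ℝ) ^ 3) := by positivity
        rw [Real.exp_add, phi_eq hu, Real.exp_log (by linarith), Real.exp_log (by linarith)]
        have := sum_divPairs_le ht (n := n) (hP p hp)
        nlinarith
    _ = Real.exp (∑ p ∈ P, phi (p * t) +
          ∑ p ∈ P, Real.log (1 + 4 / (t ^ 2 * (p : ℝ) ^ 3))) := by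
        rw [← Finset.sum_add_distrib, Real.exp_sum]
    _ ≤ _ := Real.exp_le_exp.2 (add_le_add (sum_phi_le_primeSum ht ht1 hP)
        (sum_log_one_add_le ht hP))

theorem sum_range_invWeight (p : ℕ) (hp : 1 ≤ p) (s : ℝ) :
    ∑ j ∈ Finset.range p, invWeight j * Real.exp (-(s * (j * p : ℕ))) =
      1 + ∑ i ∈ Finset.Ico 1 p, Real.exp (-(p * s * (i : ℝ))) / (i : ℝ) := by
  rw [Finset.range_eq_Ico, Finset.sum_eq_sum_Ico_succ_bot hp]
  congr 1
  · simp [invWeight]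
  · refine Finset.sum_congr rfl fun i hi => ?_
    have : i ≠ 0 := Nat.one_le_iff_ne_zero.1 (Finset.mem_Ico.1 hi).1
    rw [invWeight, if_neg this, div_eq_inv_mul]
    push_cast
    ring_nf

/-- The generating function of the selections in the lower bound. -/
def selGen (P : Finset ℕ) (s : ℝ) : ℝ :=
  ∑ j ∈ Fintype.piFinset fun p : P => Finset.range p,
    (∏ p, invWeight (j p)) * Real.exp (-(s * (∑ p, j p * p : ℕ)))

theorem selGen_eq {P : Finset ℕ} (hP : ∀ p ∈ P, p.Prime) (s : ℝ) :
    selGen P s =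
      ∏ p ∈ P, (1 + ∑ i ∈ Finset.Ico 1 p, Real.exp (-(p * s * (i : ℝ))) / (i : ℝ)) := by
  rw [← Finset.prod_congr rfl fun p hp => sum_range_invWeight p (hP p hp).one_lt.le s,
    ← Finset.prod_coe_sort P (fun p => ∑ j ∈ Finset.range p,
      invWeight j * Real.exp (-(s * (j * p : ℕ)))), Finset.prod_univ_sum, selGen]
  refine Finset.sum_congr rfl fun j _ => ?_
  rw [Finset.prod_mul_distrib, ← Real.exp_sum, Finset.sum_neg_distrib, ← Finset.mul_sum]
  push_cast
  rfl

theorem selGen_le {s : ℝ} (hs : 0 < s) (hs1 : s < 1) {P : Finset ℕ} (hP : ∀ p ∈ P, p.Prime) :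
    selGen P s ≤ Real.exp (primeSum s) := by
  rw [selGen_eq hP]
  refine le_trans ?_ (Real.exp_le_exp.2 (sum_phi_le_primeSum hs hs1 hP))
  rw [Real.exp_sum]
  refine Finset.prod_le_prod (fun p _ => by positivity) fun p hp => ?_
  have hp0 : (0 : ℝ) < p := by exact_mod_cast (hP p hp).pos
  have hu : 0 < p * s := by positivity
  have he := ell_pos hu
  rw [phi_eq hu, Real.exp_log (by linarith)]
  have := sum_Ico_exp_div_le_ell hu p
  linarith

theorem le_selGen {s : ℝ} (hs : 0 < s) {P : Finset ℕ} (hP : ∀ p ∈ P, p.Prime) :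
    Real.exp (∑ p ∈ P, phi (p * s) - errConst * s ^ (-(4 : ℝ) / 5)) ≤ selGen P s := by
  have h1 : ∑ p ∈ P, phi (p * s) - errConst * s ^ (-(4 : ℝ) / 5) ≤
      ∑ p ∈ P, (phi (p * s) - Real.log (1 + 4 / (s ^ 2 * (p : ℝ) ^ 3))) := by
    rw [Finset.sum_sub_distrib]
    have := sum_log_one_add_le hs hP
    linarith
  refine (Real.exp_le_exp.2 h1).trans ?_
  rw [selGen_eq hP, Real.exp_sum]
  refine Finset.prod_le_prod (fun p _ => (Real.exp_pos _).le) fun p hp => ?_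
  have hp0 : (0 : ℝ) < p := by exact_mod_cast (hP p hp).pos
  have hu : 0 < p * s := by positivity
  have he := ell_pos hu
  have h4 : 0 < 4 / (s ^ 2 * (p : ℝ) ^ 3) := by positivity
  rw [Real.exp_sub, phi_eq hu, Real.exp_log (by linarith), Real.exp_log (by linarith),
    div_le_iff₀ (by linarith)]
  have h5 := ell_le_sum_Ico_add hs (hP p hp).one_lt.le
  have h6 : 0 ≤ ∑ i ∈ Finset.Ico 1 p, Real.exp (-(p * s * (i : ℝ))) / (i : ℝ) :=
    Finset.sum_nonneg fun i _ => by positivity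
  nlinarith

end PrimeProducts

section FiniteBounds

theorem zkExp_Tmap_le_exp {n k r : ℕ} (hk : 2 ≤ k) (hr : 0 < r) (hn : n = k * r) {N : ℝ}
    (hN : N = n / ((k : ℝ) - 1)) {t : ℝ} (ht : 0 < t) (ht1 : t < 1) :
    zkExp n k (fun f => (Tmap f : ℝ)) ≤
      Real.exp (N * (t + 1 / (2 * N)) ^ 2 / 2 +
        (primeSum t + errConst * t ^ (-(4 : ℝ) / 5))) := by
  have hP : ∀ p ∈ (Finset.range (n + 1)).filter Nat.Prime, p.Prime :=
    fun p hp => (Finset.mem_filter.1 hp).2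
  refine (zkExp_Tmap_le (by omega) hr hn (P := (Finset.range (n + 1)).filter Nat.Prime)
    (fun p hp hpn => Finset.mem_filter.2 ⟨Finset.mem_range.2 (Nat.lt_succ_of_le hpn), hp⟩)
    fun L => fixRatio_le_exp_linear hk hr hn hN t L).trans ?_
  rw [Real.exp_add]
  exact mul_le_mul_of_nonneg_left (log_prod_divPairs_le ht ht1 hP n) (Real.exp_pos _).le

theorem exists_finset_primes_primeSum_le {t : ℝ} (ht : 0 < t) (ht1 : t < 1) :
    ∃ P : Finset ℕ, (∀ p ∈ P, p.Prime) ∧ primeSum t - 1 ≤ ∑ p ∈ P, phi (p * t) := by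
  have h := (summable_phi ht ht1).hasSum.eventually (lt_mem_nhds (sub_one_lt (primeSum t)))
  obtain ⟨Q, hQ⟩ := h.exists
  refine ⟨Q.map ⟨fun p : Nat.Primes => (p : ℕ), Subtype.coe_injective⟩, fun p hp => ?_, ?_⟩
  · obtain ⟨q, -, rfl⟩ := Finset.mem_map.1 hp
    exact q.2
  · rw [Finset.sum_map]
    exact hQ.le

/-- If the weights tilted by `exp (-τ L)` have small upper and lower exponential moments outside
the window `x ≤ L ≤ y`, then at least half of the tilted mass lies in the window. -/
theorem half_le_sum_window {ι : Type*} (S : Finset ι) {w L : ι → ℝ} (hw : ∀ i ∈ S, 0 ≤ w i)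
    {τ h x y : ℝ} (hhτ : 0 ≤ h * τ)
    (hy : (∑ i ∈ S, w i * Real.exp (-((1 - h) * τ * L i))) * Real.exp (-(h * τ * y)) ≤
      (∑ i ∈ S, w i * Real.exp (-(τ * L i))) / 4)
    (hx : (∑ i ∈ S, w i * Real.exp (-((1 + h) * τ * L i))) * Real.exp (h * τ * x) ≤
      (∑ i ∈ S, w i * Real.exp (-(τ * L i))) / 4) :
    (∑ i ∈ S, w i * Real.exp (-(τ * L i))) / 2 ≤
      ∑ i ∈ S with x ≤ L i ∧ L i ≤ y, w i * Real.exp (-(τ * L i)) := by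
  have key : ∀ i ∈ S, w i * Real.exp (-(τ * L i)) ≤
      (if x ≤ L i ∧ L i ≤ y then w i * Real.exp (-(τ * L i)) else 0) +
      (w i * Real.exp (-((1 - h) * τ * L i)) * Real.exp (-(h * τ * y)) +
        w i * Real.exp (-((1 + h) * τ * L i)) * Real.exp (h * τ * x)) := by
    intro i hi
    have hwi := hw i hi
    have e1 := Real.exp_pos (-((1 - h) * τ * L i))
    have e2 := Real.exp_pos (-(h * τ * y))
    have e3 := Real.exp_pos (-((1 + h) * τ * L i))
    have e4 := Real.exp_pos (h * τ * x)
    have p1 : 0 ≤ w i * Real.exp (-((1 - h) * τ * L i)) * Real.exp (-(h * τ * y)) := by positivity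
    have p2 : 0 ≤ w i * Real.exp (-((1 + h) * τ * L i)) * Real.exp (h * τ * x) := by positivity
    split_ifs with hc
    · linarith
    · rcases not_and_or.1 hc with hc | hc
      · have : w i * Real.exp (-(τ * L i)) ≤
            w i * Real.exp (-((1 + h) * τ * L i)) * Real.exp (h * τ * x) := by
          rw [mul_assoc, ← Real.exp_add]
          gcongr
          nlinarith [mul_le_mul_of_nonneg_left (not_le.1 hc).le hhτ]
        linarith
      · have : w i * Real.exp (-(τ * L i)) ≤
            w i * Real.exp (-((1 - h) * τ * L i)) * Real.exp (-(h * τ * y)) := by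
          rw [mul_assoc, ← Real.exp_add]
          gcongr
          nlinarith [mul_le_mul_of_nonneg_left (not_le.1 hc).le hhτ]
        linarith
  have h1 := Finset.sum_le_sum key
  rw [Finset.sum_add_distrib, Finset.sum_add_distrib, ← Finset.sum_mul, ← Finset.sum_mul,
    ← Finset.sum_filter] at h1
  linarith

theorem exp_le_zkExp_Tmap {n k r : ℕ} (hk : 2 ≤ k) (hr : 0 < r) (hn : n = k * r) {N : ℝ}
    (hN : N = n / ((k : ℝ) - 1)) {τ δ h A : ℝ} (hτ : 0 < τ) (hh : 0 < h) (hh1 : h < 1)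
    (hτ1 : (1 + h) * τ < 1) (hδ : 0 < δ) (hδ1 : δ < 1) (hδτ : (1 + δ) * τ ≤ δ / 2)
    (hA : A = primeSum τ - 1 - errConst * τ ^ (-(4 : ℝ) / 5))
    (hup : primeSum ((1 - h) * τ) - h * (1 + δ) * (N * τ ^ 2) + Real.log 4 ≤ A)
    (hlo : primeSum ((1 + h) * τ) + h * (1 - δ) * (N * τ ^ 2) + Real.log 4 ≤ A) :
    Real.exp (-((1 + δ) ^ 2 / (2 * (1 - δ))) * (N * τ ^ 2) + (1 - δ) * (N * τ ^ 2) + A) /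
      (2 * N) ≤ zkExp n k (fun f => (Tmap f : ℝ)) := by
  have hk1 : (0 : ℝ) < (k : ℝ) - 1 := by
    have : (2 : ℝ) ≤ k := by exact_mod_cast hk
    linarith
  have hn0 : (0 : ℝ) < n := by
    rw [hn]; exact_mod_cast Nat.mul_pos (by omega) hr
  have hN0 : 0 < N := hN ▸ div_pos hn0 hk1
  have hτ2 : τ < 1 := by nlinarith
  obtain ⟨P, hP, hPsum⟩ := exists_finset_primes_primeSum_le hτ hτ2
  refine le_trans ?_ (le_zkExp_Tmap hk hr hn hP)
  set S := Fintype.piFinset fun p : P => Finset.range p with hS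
  set w : (P → ℕ) → ℝ := fun j => ∏ p, invWeight (j p) with hw
  set ℓ : (P → ℕ) → ℕ := fun j => ∑ p, j p * p with hℓ
  have hw0 : ∀ j, 0 ≤ w j := fun j => Finset.prod_nonneg fun p _ => invWeight_nonneg _
  have hsel : ∀ s, selGen P s = ∑ j ∈ S, w j * Real.exp (-(s * (ℓ j : ℝ))) := fun s => rfl
  have hGA : Real.exp A ≤ selGen P τ :=
    (Real.exp_le_exp.2 (by rw [hA]; linarith)).trans (le_selGen hτ hP)
  have h4 : ∀ z, z + Real.log 4 ≤ A → Real.exp z ≤ selGen P τ / 4 := by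
    intro z hz
    have h1 := Real.exp_le_exp.2 hz
    rw [Real.exp_add, Real.exp_log (by norm_num)] at h1
    linarith
  have hwin := half_le_sum_window S (w := w) (L := fun j => (ℓ j : ℝ)) (fun j _ => hw0 j)
    (τ := τ) (h := h) (x := (1 - δ) * (N * τ)) (y := (1 + δ) * (N * τ)) (by positivity)
    (by
      rw [← hsel, ← hsel]
      refine le_trans (mul_le_mul_of_nonneg_right (selGen_le (by nlinarith) (by nlinarith) hP)
        (Real.exp_pos _).le) ?_
      rw [← Real.exp_add]
      refine h4 _ (le_trans (le_of_eq ?_) hup)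
      ring)
    (by
      rw [← hsel, ← hsel]
      refine le_trans (mul_le_mul_of_nonneg_right (selGen_le (by nlinarith) hτ1 hP)
        (Real.exp_pos _).le) ?_
      rw [← Real.exp_add]
      refine h4 _ (le_trans (le_of_eq ?_) hlo)
      ring)
  rw [← hsel] at hwin
  have hterm : ∀ j ∈ S.filter (fun j => (1 - δ) * (N * τ) ≤ (ℓ j : ℝ) ∧
        (ℓ j : ℝ) ≤ (1 + δ) * (N * τ)),
      w j * Real.exp (-(τ * (ℓ j : ℝ))) *
        (Real.exp (-((1 + δ) ^ 2 / (2 * (1 - δ))) * (N * τ ^ 2) + (1 - δ) * (N * τ ^ 2)) / N) ≤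
      w j * (fixRatio n k (ℓ j) * (((k : ℝ) - 1) * (ℓ j : ℕ) / n)) := by
    intro j hj
    obtain ⟨-, hj1, hj2⟩ := Finset.mem_filter.1 hj
    rw [mul_assoc]
    refine mul_le_mul_of_nonneg_left ?_ (hw0 j)
    have hl0 : (0 : ℝ) < ℓ j := lt_of_lt_of_le (by
      have : 0 < 1 - δ := by linarith
      positivity) hj1
    have hl1 : (1 : ℝ) ≤ ℓ j := by exact_mod_cast (Nat.cast_pos.1 hl0 : 0 < ℓ j)
    have hf := exp_le_fixRatio hk hr hn hN hδ.le hδ1 (L := ℓ j) (by nlinarith)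
    have hlN : ((k : ℝ) - 1) * (ℓ j : ℕ) / n = ℓ j / N := by
      rw [hN]; field_simp
    rw [hlN, ← mul_div_assoc, ← Real.exp_add, ← mul_div_assoc]
    refine div_le_div_of_nonneg_right ?_ hN0.le
    refine le_trans ?_ (le_mul_of_one_le_right (fixRatio_nonneg (by omega) hn _) hl1)
    refine le_trans (Real.exp_le_exp.2 ?_) hf
    have h5 : (ℓ j : ℝ) ^ 2 / (2 * N * (1 - δ)) ≤
        (1 + δ) ^ 2 / (2 * (1 - δ)) * (N * τ ^ 2) := by
      have h6 : (1 + δ) ^ 2 / (2 * (1 - δ)) * (N * τ ^ 2) =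
          ((1 + δ) * (N * τ)) ^ 2 / (2 * N * (1 - δ)) := by
        have : 1 - δ ≠ 0 := by linarith
        field_simp
      rw [h6]
      have : 0 < 1 - δ := by linarith
      gcongr
    nlinarith
  calc Real.exp (-((1 + δ) ^ 2 / (2 * (1 - δ))) * (N * τ ^ 2) + (1 - δ) * (N * τ ^ 2) + A) /
        (2 * N)
      = Real.exp A / 2 * (Real.exp (-((1 + δ) ^ 2 / (2 * (1 - δ))) * (N * τ ^ 2) +
          (1 - δ) * (N * τ ^ 2)) / N) := by
        rw [Real.exp_add _ A]
        field_simp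
    _ ≤ (∑ j ∈ S with (1 - δ) * (N * τ) ≤ (ℓ j : ℝ) ∧ (ℓ j : ℝ) ≤ (1 + δ) * (N * τ),
          w j * Real.exp (-(τ * (ℓ j : ℝ)))) *
          (Real.exp (-((1 + δ) ^ 2 / (2 * (1 - δ))) * (N * τ ^ 2) +
          (1 - δ) * (N * τ ^ 2)) / N) := by
        gcongr
        linarith
    _ ≤ ∑ j ∈ S with (1 - δ) * (N * τ) ≤ (ℓ j : ℝ) ∧ (ℓ j : ℝ) ≤ (1 + δ) * (N * τ),
          w j * (fixRatio n k (ℓ j) * (((k : ℝ) - 1) * (ℓ j : ℕ) / n)) := by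
        rw [Finset.sum_mul]
        exact Finset.sum_le_sum hterm
    _ ≤ _ := by
        refine Finset.sum_le_sum_of_subset_of_nonneg (Finset.filter_subset _ _) fun j _ _ => ?_
        have := fixRatio_nonneg (n := n) (k := k) (by omega) hn (ℓ j)
        have := hw0 j
        positivity

end FiniteBounds

section Asymptotics

/-- The constant `I = ∫₀^∞ log log (e / (1 - e^{-t})) dt`. -/
def phiInt : ℝ := ∫ u in Set.Ioi 0, phi u

theorem phiInt_pos : 0 < phiInt := integral_phi_pos

/-- The approximate saddle point `(3 I / (N log N))^{1/3}`. -/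
def saddle (N : ℝ) : ℝ := (3 * phiInt / (N * Real.log N)) ^ ((1 : ℝ) / 3)

theorem saddle_pos {N : ℝ} (hN : 1 < N) : 0 < saddle N := by
  have := phiInt_pos
  have := Real.log_pos hN
  exact Real.rpow_pos_of_pos (by positivity) _

theorem mul_saddle_pow_three {N : ℝ} (hN : 1 < N) :
    N * saddle N ^ 3 = 3 * phiInt / Real.log N := by
  have h1 := phiInt_pos
  have h2 := Real.log_pos hN
  rw [saddle, ← Real.rpow_natCast, ← Real.rpow_mul (by positivity)]
  norm_num
  field_simp

theorem mul_saddle_sq {N : ℝ} (hN : 1 < N) :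
    N * saddle N ^ 2 =
      (3 * phiInt) ^ ((2 : ℝ) / 3) * N ^ ((1 : ℝ) / 3) / Real.log N ^ ((2 : ℝ) / 3) := by
  have h1 := phiInt_pos
  have h2 := Real.log_pos hN
  rw [saddle, ← Real.rpow_natCast, ← Real.rpow_mul (by positivity),
    Real.div_rpow (by positivity) (by positivity),
    Real.mul_rpow (x := N) (by positivity) (by positivity)]
  have h3 : N = N ^ ((1 : ℝ) / 3) * N ^ ((2 : ℝ) / 3) := by
    rw [← Real.rpow_add (by positivity)]; norm_num
  have h4 : 0 < N ^ ((2 : ℝ) / 3) := by positivity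
  norm_num
  rw [show N * ((3 * phiInt) ^ ((2 : ℝ) / 3) /
      (N ^ ((2 : ℝ) / 3) * Real.log N ^ ((2 : ℝ) / 3))) =
      N * (3 * phiInt) ^ ((2 : ℝ) / 3) / N ^ ((2 : ℝ) / 3) / Real.log N ^ ((2 : ℝ) / 3) by
    field_simp]
  congr 1
  nth_rewrite 1 [h3]
  norm_num
  field_simp

theorem mul_saddle_sq_pos {N : ℝ} (hN : 1 < N) : 0 < N * saddle N ^ 2 :=
  mul_pos (by linarith) (pow_pos (saddle_pos hN) 2)

theorem tendsto_saddle : Tendsto saddle atTop (nhdsWithin 0 (Set.Ioi 0)) := by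
  refine tendsto_nhdsWithin_iff.2 ⟨?_, ?_⟩
  · have h1 : Tendsto (fun N : ℝ => 3 * phiInt / (N * Real.log N)) atTop (nhds 0) :=
      (tendsto_id.atTop_mul_atTop₀ Real.tendsto_log_atTop).const_div_atTop _
    have h2 := h1.rpow_const (p := (1 : ℝ) / 3) (Or.inr (by norm_num))
    rwa [Real.zero_rpow (by norm_num)] at h2
  · filter_upwards [eventually_gt_atTop 1] with N hN using saddle_pos hN

theorem tendsto_log_inv_saddle {c : ℝ} (hc : 0 < c) :
    Tendsto (fun N => Real.log (1 / (c * saddle N)) / Real.log N) atTop (nhds (1 / 3)) := by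
  have h1 : Tendsto (fun N : ℝ => Real.log (Real.log N) / Real.log N) atTop (nhds 0) :=
    (Real.isLittleO_log_id_atTop.tendsto_div_nhds_zero).comp Real.tendsto_log_atTop
  have h2 : Tendsto (fun N : ℝ => (-Real.log c - 1 / 3 * Real.log (3 * phiInt)) / Real.log N)
      atTop (nhds 0) := Real.tendsto_log_atTop.const_div_atTop _
  have h3 : Tendsto (fun N : ℝ => (-Real.log c - 1 / 3 * Real.log (3 * phiInt)) / Real.log N +
      1 / 3 + 1 / 3 * (Real.log (Real.log N) / Real.log N)) atTop (nhds (0 + 1 / 3 + 1 / 3 * 0)) :=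
    (h2.add_const _).add (h1.const_mul _)
  rw [zero_add, mul_zero, add_zero] at h3
  refine h3.congr' ?_
  filter_upwards [eventually_gt_atTop 1] with N hN
  have hI := phiInt_pos
  have hl := Real.log_pos hN
  rw [one_div (c * saddle N), Real.log_inv, Real.log_mul hc.ne' (saddle_pos hN).ne', saddle,
    Real.log_rpow (by positivity), Real.log_div (by positivity) (by positivity),
    Real.log_mul (by positivity) hl.ne']
  field_simp
  ring

theorem tendsto_saddle_rpow_mul_log {s : ℝ} (hs : 0 < s) :
    Tendsto (fun N => saddle N ^ s * Real.log N) atTop (nhds 0) := by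
  have h1 := (tendsto_log_mul_rpow_nhdsGT_zero hs).comp tendsto_saddle
  have h2 := (tendsto_log_inv_saddle one_pos).inv₀ (by norm_num)
  have h3 := (h1.mul h2).neg
  rw [zero_mul, neg_zero] at h3
  refine h3.congr' ?_
  filter_upwards [eventually_gt_atTop 1, tendsto_saddle.eventually
    (Ioo_mem_nhdsGT (show (0 : ℝ) < 1 by norm_num))] with N hN hs1
  have hl := Real.log_pos hN
  have hl2 := (Real.log_neg hs1.1 hs1.2).ne
  simp only [Function.comp_def]
  rw [one_mul, one_div, Real.log_inv]
  field_simp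

theorem tendsto_log_div_mul_saddle_sq :
    Tendsto (fun N => Real.log N / (N * saddle N ^ 2)) atTop (nhds 0) := by
  have h1 := (tendsto_saddle_rpow_mul_log (show (0 : ℝ) < 1 / 2 by norm_num)).pow 2
  have h2 := h1.div_const (3 * phiInt)
  rw [zero_pow two_ne_zero, zero_div] at h2
  refine h2.congr' ?_
  filter_upwards [eventually_gt_atTop 1] with N hN
  have hl := Real.log_pos hN
  have hs := saddle_pos hN
  have hI := phiInt_pos
  have h3 := mul_saddle_pow_three hN
  rw [mul_pow, ← Real.rpow_natCast (saddle N ^ _), ← Real.rpow_mul hs.le]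
  norm_num
  rw [eq_div_iff hl.ne'] at h3
  rw [div_eq_div_iff (by positivity) (by positivity), ← h3]
  ring

theorem tendsto_const_div_mul_saddle_sq (c : ℝ) :
    Tendsto (fun N => c / (N * saddle N ^ 2)) atTop (nhds 0) := by
  have h1 := tendsto_log_div_mul_saddle_sq.mul (Real.tendsto_log_atTop.const_div_atTop c)
  rw [zero_mul] at h1
  refine h1.congr' ?_
  filter_upwards [eventually_gt_atTop 1] with N hN
  have hl := Real.log_pos hN
  field_simp

theorem tendsto_saddle_rpow_div :
    Tendsto (fun N => saddle N ^ (-(4 : ℝ) / 5) / (N * saddle N ^ 2)) atTop (nhds 0) := by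
  have h1 := (tendsto_saddle_rpow_mul_log (show (0 : ℝ) < 1 / 5 by norm_num)).div_const
    (3 * phiInt)
  rw [zero_div] at h1
  refine h1.congr' ?_
  filter_upwards [eventually_gt_atTop 1] with N hN
  have hl := Real.log_pos hN
  have hs := saddle_pos hN
  have hI := phiInt_pos
  have h3 := mul_saddle_pow_three hN
  have h4 : saddle N ^ ((1 : ℝ) / 5) = saddle N ^ (-(4 : ℝ) / 5) * saddle N := by
    rw [← Real.rpow_add_one hs.ne']; norm_num
  rw [eq_div_iff hl.ne'] at h3
  rw [div_eq_div_iff (by positivity) (mul_saddle_sq_pos hN).ne', h4, ← h3]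
  ring

theorem tendsto_primeSum_saddle {c : ℝ} (hc : 0 < c) :
    Tendsto (fun N => primeSum (c * saddle N) / (N * saddle N ^ 2)) atTop (nhds (1 / c)) := by
  have h0 : Tendsto (fun N => c * saddle N) atTop (nhdsWithin 0 (Set.Ioi 0)) := by
    refine tendsto_nhdsWithin_iff.2 ⟨?_, ?_⟩
    · simpa using (tendsto_nhdsWithin_iff.1 tendsto_saddle).1.const_mul c
    · filter_upwards [eventually_gt_atTop 1] with N hN using mul_pos hc (saddle_pos hN)
  have h1 := tendsto_primeSum.comp h0
  have hI := phiInt_pos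
  have h2 := h1.div ((tendsto_log_inv_saddle hc).const_mul (c * (3 * phiInt)))
    (by positivity)
  have h3 : (∫ u in Set.Ioi 0, phi u) / (c * (3 * phiInt) * (1 / 3)) = 1 / c := by
    change phiInt / _ = _
    field_simp
  rw [h3] at h2
  refine h2.congr' ?_
  filter_upwards [eventually_gt_atTop 1, h0.eventually
    (Ioo_mem_nhdsGT (show (0 : ℝ) < 1 by norm_num))] with N hN hs1
  have hl := Real.log_pos hN
  have hs := saddle_pos hN
  have hl2 : 0 < Real.log (1 / (c * saddle N)) :=
    Real.log_pos ((one_lt_div hs1.1).2 hs1.2)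
  have h4 := mul_saddle_pow_three hN
  rw [eq_div_iff hl.ne'] at h4
  simp only [Pi.div_apply, Function.comp_def]
  rw [← h4]
  field_simp

theorem tendsto_primeSum_saddle_one :
    Tendsto (fun N => primeSum (saddle N) / (N * saddle N ^ 2)) atTop (nhds 1) := by
  simpa using tendsto_primeSum_saddle one_pos

theorem eventually_log_zkExp_Tmap_le {ε : ℝ} (hε : 0 < ε) :
    ∀ᶠ N : ℝ in atTop, ∀ n k r : ℕ, 2 ≤ k → 0 < r → n = k * r → N = n / ((k : ℝ) - 1) →
      0 < zkExp n k (fun f => (Tmap f : ℝ)) →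
      Real.log (zkExp n k (fun f => (Tmap f : ℝ))) ≤ (3 / 2 + ε) * (N * saddle N ^ 2) := by
  have h1 : Tendsto (fun N => saddle N / (N * saddle N ^ 2)) atTop (nhds 0) := by
    have := (tendsto_nhdsWithin_iff.1 tendsto_saddle).1.mul (tendsto_const_div_mul_saddle_sq 1)
    rw [zero_mul] at this
    exact this.congr fun N => by ring
  have h2 : Tendsto (fun N => (1 + 1 / 2 * (saddle N / (N * saddle N ^ 2))) ^ 2 / 2 +
      (primeSum (saddle N) / (N * saddle N ^ 2) +
        errConst * (saddle N ^ (-(4 : ℝ) / 5) / (N * saddle N ^ 2)))) atTop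
      (nhds ((1 + 1 / 2 * 0) ^ 2 / 2 + (1 + errConst * 0))) :=
    ((((h1.const_mul _).const_add _).pow 2).div_const 2).add
      (tendsto_primeSum_saddle_one.add (tendsto_saddle_rpow_div.const_mul _))
  have h3 : (1 + 1 / 2 * 0) ^ 2 / 2 + (1 + errConst * 0) < 3 / 2 + ε := by norm_num; linarith
  filter_upwards [h2.eventually (gt_mem_nhds h3), eventually_gt_atTop 1,
    tendsto_saddle.eventually (Ioo_mem_nhdsGT (show (0 : ℝ) < 1 by norm_num))]
    with N hlt hN hs n k r hk hr hn hNn hpos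
  have hY := mul_saddle_sq_pos hN
  have hs0 := saddle_pos hN
  have h4 := zkExp_Tmap_le_exp hk hr hn hNn hs.1 hs.2
  have h5 := Real.log_le_log hpos h4
  rw [Real.log_exp] at h5
  refine h5.trans (le_trans (le_of_eq ?_) (mul_le_mul_of_nonneg_right hlt.le hY.le))
  field_simp

theorem eventually_le_log_zkExp_Tmap {ε : ℝ} (hε : 0 < ε) :
    ∀ᶠ N : ℝ in atTop, ∀ n k r : ℕ, 2 ≤ k → 0 < r → n = k * r → N = n / ((k : ℝ) - 1) →
      0 < zkExp n k (fun f => (Tmap f : ℝ)) ∧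
      (3 / 2 - ε) * (N * saddle N ^ 2) ≤ Real.log (zkExp n k (fun f => (Tmap f : ℝ))) := by
  obtain ⟨δ, ⟨hδ, hδ1⟩, hδε⟩ : ∃ δ : ℝ, (0 < δ ∧ δ < 1) ∧
      3 / 2 - ε < -((1 + δ) ^ 2 / (2 * (1 - δ))) + (1 - δ) + 1 := by
    have hc : ContinuousAt (fun δ : ℝ => -((1 + δ) ^ 2 / (2 * (1 - δ))) + (1 - δ) + 1) 0 := by
      have : (2 : ℝ) * (1 - 0) ≠ 0 := by norm_num
      fun_prop (disch := assumption)
    have hc2 := hc.eventually (lt_mem_nhds (a := 3 / 2 - ε) (by norm_num; linarith))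
    obtain ⟨δ, h1, h2⟩ := ((hc2.filter_mono nhdsWithin_le_nhds).and
      (Ioo_mem_nhdsGT (show (0 : ℝ) < 1 by norm_num))).exists
    exact ⟨δ, h2, h1⟩
  set h := δ / 4 with hh
  have hh0 : 0 < h := by positivity
  have hh1 : h < 1 := by linarith
  have hh2 : 0 < 1 - h := by linarith
  set A : ℝ → ℝ := fun N => primeSum (saddle N) - 1 - errConst * saddle N ^ (-(4 : ℝ) / 5)
    with hA
  have hAlim : Tendsto (fun N => A N / (N * saddle N ^ 2)) atTop (nhds 1) := by
    have := (tendsto_primeSum_saddle_one.sub (tendsto_const_div_mul_saddle_sq 1)).sub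
      (tendsto_saddle_rpow_div.const_mul errConst)
    rw [mul_zero, sub_zero, sub_zero] at this
    exact this.congr fun N => by rw [hA]; ring
  have hup : Tendsto (fun N => primeSum ((1 - h) * saddle N) / (N * saddle N ^ 2) +
      Real.log 4 / (N * saddle N ^ 2) - A N / (N * saddle N ^ 2)) atTop
      (nhds (1 / (1 - h) + 0 - 1)) :=
    ((tendsto_primeSum_saddle hh2).add (tendsto_const_div_mul_saddle_sq _)).sub hAlim
  have hlo : Tendsto (fun N => primeSum ((1 + h) * saddle N) / (N * saddle N ^ 2) +
      Real.log 4 / (N * saddle N ^ 2) - A N / (N * saddle N ^ 2)) atTop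
      (nhds (1 / (1 + h) + 0 - 1)) :=
    ((tendsto_primeSum_saddle (by positivity)).add (tendsto_const_div_mul_saddle_sq _)).sub hAlim
  have hfin : Tendsto (fun N => -((1 + δ) ^ 2 / (2 * (1 - δ))) + (1 - δ) +
      A N / (N * saddle N ^ 2) - (Real.log 2 / (N * saddle N ^ 2) +
        Real.log N / (N * saddle N ^ 2))) atTop
      (nhds (-((1 + δ) ^ 2 / (2 * (1 - δ))) + (1 - δ) + 1 - (0 + 0))) :=
    (hAlim.const_add _).sub
      ((tendsto_const_div_mul_saddle_sq _).add tendsto_log_div_mul_saddle_sq)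
  have hδh : δ = 4 * h := by rw [hh]; ring
  have hup' : 1 / (1 - h) + 0 - 1 < h * (1 + δ) := by
    rw [add_zero, sub_lt_iff_lt_add, div_lt_iff₀ hh2, hδh]
    nlinarith [mul_pos (pow_pos hh0 2) (show 0 < 3 - 4 * h by linarith)]
  have hlo' : 1 / (1 + h) + 0 - 1 < -(h * (1 - δ)) := by
    rw [add_zero, sub_lt_iff_lt_add, div_lt_iff₀ (by positivity), hδh]
    nlinarith [pow_pos hh0 2, pow_pos hh0 3]
  filter_upwards [hup.eventually (gt_mem_nhds hup'), hlo.eventually (gt_mem_nhds hlo'),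
    hfin.eventually (lt_mem_nhds (a := 3 / 2 - ε) (by linarith)), eventually_gt_atTop 1,
    tendsto_saddle.eventually (Ioo_mem_nhdsGT (show (0 : ℝ) < δ / 4 by positivity))]
    with N h1 h2 h3 hN hs n k r hk hr hn hNn
  have hY := mul_saddle_sq_pos hN
  rw [← add_div, ← sub_div, div_lt_iff₀ hY] at h1 h2
  have h4 := exp_le_zkExp_Tmap hk hr hn hNn (τ := saddle N) (δ := δ) (h := h) (A := A N)
    hs.1 hh0 hh1 (by nlinarith [hs.1, hs.2]) hδ hδ1 (by nlinarith [hs.1, hs.2]) rfl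
    (by linarith) (by linarith)
  have hN0 : 0 < N := by linarith
  have hpos := lt_of_lt_of_le (by positivity) h4
  refine ⟨hpos, ?_⟩
  have h5 := Real.log_le_log (by positivity) h4
  rw [Real.log_div (Real.exp_pos _).ne' (by positivity), Real.log_exp,
    Real.log_mul two_ne_zero hN0.ne'] at h5
  refine le_trans (mul_le_mul_of_nonneg_right h3.le hY.le) (le_trans (le_of_eq ?_) h5)
  have hs0 := saddle_pos hN
  field_simp

theorem tendsto_div_sub_one_atTop {k n : ℕ → ℕ} (hk : ∀ r, 2 ≤ k r) (hn : ∀ r, n r = k r * r) :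
    Tendsto (fun r => (n r : ℝ) / ((k r : ℝ) - 1)) atTop atTop := by
  refine tendsto_atTop_mono (fun r => ?_) tendsto_natCast_atTop_atTop
  have hk2 : (2 : ℝ) ≤ k r := by exact_mod_cast hk r
  rw [le_div_iff₀ (by linarith), hn]
  push_cast
  nlinarith [Nat.cast_nonneg (α := ℝ) r]

theorem tendsto_log_zkExp_Tmap_div {k n : ℕ → ℕ} (hk : ∀ r, 2 ≤ k r)
    (hn : ∀ r, n r = k r * r) :
    Tendsto (fun r => Real.log (zkExp (n r) (k r) (fun f => (Tmap f : ℝ))) /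
      ((n r : ℝ) / ((k r : ℝ) - 1) * saddle ((n r : ℝ) / ((k r : ℝ) - 1)) ^ 2)) atTop
      (nhds (3 / 2)) := by
  have hN := tendsto_div_sub_one_atTop hk hn
  refine tendsto_order.2 ⟨fun a ha => ?_, fun a ha => ?_⟩
  · filter_upwards [hN.eventually (eventually_le_log_zkExp_Tmap (half_pos (sub_pos.2 ha))),
      hN.eventually (eventually_gt_atTop 1), eventually_gt_atTop 0] with r h1 h2 h3
    have hY := mul_saddle_sq_pos h2
    rw [lt_div_iff₀ hY]
    refine lt_of_lt_of_le (mul_lt_mul_of_pos_right ?_ hY) (h1 _ _ _ (hk r) h3 (hn r) rfl).2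
    linarith
  · filter_upwards [hN.eventually (eventually_log_zkExp_Tmap_le (half_pos (sub_pos.2 ha))),
      hN.eventually (eventually_le_log_zkExp_Tmap one_pos),
      hN.eventually (eventually_gt_atTop 1), eventually_gt_atTop 0] with r h0 h1 h2 h3
    have hY := mul_saddle_sq_pos h2
    rw [div_lt_iff₀ hY]
    refine lt_of_le_of_lt (h0 _ _ _ (hk r) h3 (hn r) rfl (h1 _ _ _ (hk r) h3 (hn r) rfl).1)
      (mul_lt_mul_of_pos_right ?_ hY)
    linarith

end Asymptotics

end ZKMapping

/-- `log E_n^{{0,k}}(T) = k₀ (n/λ)^{1/3} / log^{2/3}(n/λ) (1 + o(1))`. -/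
theorem stmt_8 (k n : ℕ → ℕ) (α : ℝ) (hα1 : 0 < α) (hα2 : α < 1)
    (hk : ∀ r, 2 ≤ k r) (hn : ∀ r, n r = k r * r)
    (hko : (fun r : ℕ => (k r : ℝ)) =o[atTop] (fun r : ℕ => (n r : ℝ) ^ (1 - α)))
    (I k₀ : ℝ)
    (hI : I = ∫ t in Set.Ioi (0 : ℝ),
      Real.log (Real.log (Real.exp 1 / (1 - Real.exp (-t)))))
    (hk₀ : k₀ = 3 / 2 * (3 * I) ^ ((2 : ℝ) / 3)) :
    ∃ e : ℕ → ℝ, Tendsto e atTop (nhds 0) ∧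
      ∀ᶠ r in atTop,
        Real.log (zkExp (n r) (k r) (fun f => (Tmap f : ℝ))) =
          k₀ * ((n r : ℝ) / ((k r : ℝ) - 1)) ^ ((1 : ℝ) / 3) /
            (Real.log ((n r : ℝ) / ((k r : ℝ) - 1))) ^ ((2 : ℝ) / 3) * (1 + e r) := by
  have h := ZKMapping.tendsto_log_zkExp_Tmap_div hk hn
  have hI' : I = ZKMapping.phiInt := hI
  refine ⟨_, by simpa using (h.div_const (3 / 2)).sub_const 1, ?_⟩
  filter_upwards [(ZKMapping.tendsto_div_sub_one_atTop hk hn).eventually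
    (eventually_gt_atTop 1)] with r hr
  have hY := ZKMapping.mul_saddle_sq hr
  have hY0 := ZKMapping.mul_saddle_sq_pos hr
  rw [hk₀, hI', show 3 / 2 * (3 * ZKMapping.phiInt) ^ ((2 : ℝ) / 3) *
      ((n r : ℝ) / ((k r : ℝ) - 1)) ^ ((1 : ℝ) / 3) /
      (Real.log ((n r : ℝ) / ((k r : ℝ) - 1))) ^ ((2 : ℝ) / 3) =
      3 / 2 * ((n r : ℝ) / ((k r : ℝ) - 1) *
        ZKMapping.saddle ((n r : ℝ) / ((k r : ℝ) - 1)) ^ 2) by rw [hY]; ring]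
  generalize (n r : ℝ) / ((k r : ℝ) - 1) * ZKMapping.saddle ((n r : ℝ) / ((k r : ℝ) - 1)) ^ 2 = Y
    at hY0 ⊢
  field_simp
  ring
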